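/- Let ℓ > 0 and let a ∈ ℝ∖{0} satisfy the trace condition 2cosh²(ℓ/2) + (a+a⁻¹)sinh²(ℓ/2) = −2cosh(ℓ/2), and let Γ(ℓ,a) be the corresponding symmetric three-funnel Schottky group. Then the double product Z(Γ(ℓ,a),s) = ∏_{[γ]∈𝒫} ∏_{k≥0} (1 − e^{−(s+k)ℓ(γ)}) converges for Re s > 1 and extends to an entire function Z_ℓ on ℂ; moreover, for every ε ∈ (0,1) and every compact set K ⊂ ℂ there exist C > 0 and ℓ₀ ≥ 1 such that for all ℓ ≥ ℓ₀, all admissible a, and all s ∈ K, one has |Z_ℓ(s/ℓ) − (1 − 6e^{−s} + 9e^{−2s} − 4e^{−3s})| ≤ C·e^{−(1−ε)ℓ/4}. -/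

import Mathlib

noncomputable section

/-- The first generator `S₁` of the symmetric three-funnel Schottky group. -/
def S1mat (ℓ : ℝ) : Matrix (Fin 2) (Fin 2) ℝ :=
  !![Real.cosh (ℓ / 2), Real.sinh (ℓ / 2); Real.sinh (ℓ / 2), Real.cosh (ℓ / 2)]

lemma S1mat_det (ℓ : ℝ) : (S1mat ℓ).det = 1 := by
  simp only [S1mat, Matrix.det_fin_two_of]
  linear_combination Real.cosh_sq_sub_sinh_sq (ℓ / 2)

/-- `S₁` as an element of `SL₂(ℝ)`. -/
def S1 (ℓ : ℝ) : Matrix.SpecialLinearGroup (Fin 2) ℝ := ⟨S1mat ℓ, S1mat_det ℓ⟩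

/-- The second generator `S₂` of the symmetric three-funnel Schottky group. -/
def S2mat (ℓ a : ℝ) : Matrix (Fin 2) (Fin 2) ℝ :=
  !![Real.cosh (ℓ / 2), a⁻¹ * Real.sinh (ℓ / 2); a * Real.sinh (ℓ / 2), Real.cosh (ℓ / 2)]

lemma S2mat_det (ℓ a : ℝ) (ha : ¬ a = 0) : (S2mat ℓ a).det = 1 := by
  have h2 : a⁻¹ * a = 1 := inv_mul_cancel₀ ha
  simp only [S2mat, Matrix.det_fin_two_of]
  linear_combination Real.cosh_sq_sub_sinh_sq (ℓ / 2)
    - Real.sinh (ℓ / 2) * Real.sinh (ℓ / 2) * h2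

/-- `S₂` as an element of `SL₂(ℝ)` (junk value `1` when `a = 0`). -/
def S2 (ℓ a : ℝ) : Matrix.SpecialLinearGroup (Fin 2) ℝ :=
  if h : a = 0 then 1 else ⟨S2mat ℓ a, S2mat_det ℓ a h⟩

/-- The symmetric three-funnel Schottky group `Γ(ℓ,a) = ⟨S₁,S₂⟩ ≤ SL₂(ℝ)`. -/
def threeFunnelGroup (ℓ a : ℝ) : Subgroup (Matrix.SpecialLinearGroup (Fin 2) ℝ) :=
  Subgroup.closure {S1 ℓ, S2 ℓ a}

/-- The spectral radius of a real `2×2` matrix: the largest absolute value of a (complex)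
eigenvalue. -/
def spectralRad (A : Matrix (Fin 2) (Fin 2) ℝ) : ℝ :=
  sSup {r : ℝ | ∃ μ ∈ spectrum ℂ (A.map (fun x : ℝ => (x : ℂ))), r = ‖μ‖}

/-- The geodesic length `ℓ(γ) = 2 log(spectral radius of γ)`. -/
def geodLength (γ : Matrix.SpecialLinearGroup (Fin 2) ℝ) : ℝ :=
  2 * Real.log (spectralRad γ.1)

/-- `γ` is a primitive element of `Γ`: it lies in `Γ`, is nontrivial and is not a proper
power `β^k`, `k ≥ 2`, of an element `β ∈ Γ`. -/
def IsPrimitive (Γ : Subgroup (Matrix.SpecialLinearGroup (Fin 2) ℝ))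
    (γ : Matrix.SpecialLinearGroup (Fin 2) ℝ) : Prop :=
  γ ∈ Γ ∧ γ ≠ 1 ∧ ¬ ∃ β ∈ Γ, ∃ k : ℕ, 2 ≤ k ∧ γ = β ^ k

/-- Conjugacy (in `Γ`) of primitive elements of `Γ`. -/
def ConjRel (Γ : Subgroup (Matrix.SpecialLinearGroup (Fin 2) ℝ))
    (x y : {γ : Matrix.SpecialLinearGroup (Fin 2) ℝ // IsPrimitive Γ γ}) : Prop :=
  ∃ g ∈ Γ, (y : Matrix.SpecialLinearGroup (Fin 2) ℝ) =
    g * (x : Matrix.SpecialLinearGroup (Fin 2) ℝ) * g⁻¹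

/-- The set `𝒫` of conjugacy classes of primitive elements of `Γ`. -/
def PrimConjClasses (Γ : Subgroup (Matrix.SpecialLinearGroup (Fin 2) ℝ)) : Type :=
  Quot (ConjRel Γ)

/-- The length of a primitive conjugacy class (the geodesic length `ℓ(γ)` is constant on
conjugacy classes, so it is recovered as the infimum over representatives). -/
def classLength (Γ : Subgroup (Matrix.SpecialLinearGroup (Fin 2) ℝ))
    (c : PrimConjClasses Γ) : ℝ :=
  sInf {r : ℝ | ∃ γ : {γ : Matrix.SpecialLinearGroup (Fin 2) ℝ // IsPrimitive Γ γ},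
    Quot.mk (ConjRel Γ) γ = c ∧ r = geodLength (γ : Matrix.SpecialLinearGroup (Fin 2) ℝ)}

/-- The factor `1 - e^{-(s+k)ℓ(γ)}` of the Selberg zeta function, indexed by a pair
`([γ], k) ∈ 𝒫 × ℕ`. -/
def selbergTerm (Γ : Subgroup (Matrix.SpecialLinearGroup (Fin 2) ℝ)) (s : ℂ)
    (p : PrimConjClasses Γ × ℕ) : ℂ :=
  1 - Complex.exp (-(s + (p.2 : ℂ)) * (classLength Γ p.1 : ℂ))

noncomputable section

set_option linter.unusedSectionVars false

open Filter Topology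

namespace Fred

/-! ### Finite determinants -/

lemma norm_det_le {n : Type*} [Fintype n] [DecidableEq n] (X : Matrix n n ℂ) :
    ‖X.det‖ ≤ ∏ i, ∑ j, ‖X i j‖ := by
  rw [← Matrix.det_transpose, Matrix.det_apply, Finset.prod_univ_sum]
  refine (norm_sum_le _ _).trans ?_
  have h1 : ∀ σ : Equiv.Perm n, ‖Equiv.Perm.sign σ • ∏ i, X.transpose (σ i) i‖
      = ∏ i, ‖X i (σ i)‖ := by
    intro σ
    rw [Units.smul_def, ← Int.cast_smul_eq_zsmul ℂ, norm_smul]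
    simp only [Matrix.transpose_apply, norm_prod]
    rcases Int.units_eq_one_or (Equiv.Perm.sign σ) with h | h <;> simp [h]
  rw [Finset.sum_congr rfl (fun σ _ => h1 σ)]
  rw [← Finset.sum_image (s := Finset.univ) (g := fun σ : Equiv.Perm n => (σ : n → n))
    (f := fun x : n → n => ∏ i, ‖X i (x i)‖) (fun a _ b _ h => DFunLike.coe_injective h)]
  apply Finset.sum_le_sum_of_subset_of_nonneg
  · intro x _; simp
  · intro x _ _; positivity

lemma norm_det_one_sub_le {n : Type*} [Fintype n] [DecidableEq n] (M : Matrix n n ℂ) :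
    ‖(1 - M).det‖ ≤ Real.exp (∑ i, ∑ j, ‖M i j‖) := by
  refine (norm_det_le _).trans ?_
  rw [Real.exp_sum]
  apply Finset.prod_le_prod
  · intro i _; positivity
  · intro i _
    have : ∑ j, ‖(1 - M) i j‖ ≤ ∑ j, (‖(1 : Matrix n n ℂ) i j‖ + ‖M i j‖) :=
      Finset.sum_le_sum fun j _ => norm_sub_le _ _
    refine this.trans ?_
    rw [Finset.sum_add_distrib]
    have h2 : ∑ j, ‖(1 : Matrix n n ℂ) i j‖ = 1 := by
      rw [Finset.sum_eq_single i]
      · simp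
      · intro j _ hj; simp [hj.symm]
      · simp
    rw [h2, add_comm]
    exact Real.add_one_le_exp _

lemma differentiable_det {n : Type*} [Fintype n] [DecidableEq n] {X : ℂ → Matrix n n ℂ}
    {U : Set ℂ} (h : ∀ i j, DifferentiableOn ℂ (fun t => X t i j) U) :
    DifferentiableOn ℂ (fun t => (X t).det) U := by
  simp only [Matrix.det_apply]
  apply DifferentiableOn.fun_sum
  intro σ _
  simp only [Units.smul_def]
  apply DifferentiableOn.const_smul
  apply DifferentiableOn.fun_finsetProd
  intro i _
  exact h _ _

lemma det_lipschitz {n : Type*} [Fintype n] [DecidableEq n] (M N : Matrix n n ℂ) :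
    ‖(1 - M).det - (1 - N).det‖ ≤ (∑ i, ∑ j, ‖M i j - N i j‖) *
      Real.exp ((∑ i, ∑ j, ‖N i j‖) + (∑ i, ∑ j, ‖M i j - N i j‖) + 1) := by
  set d := ∑ i, ∑ j, ‖M i j - N i j‖ with hd
  set b := ∑ i, ∑ j, ‖N i j‖ with hb
  have hd0 : 0 ≤ d := by positivity
  rcases hd0.eq_or_lt with h0 | hpos
  · have : M = N := by
      ext i j
      have h1 := (Finset.sum_eq_zero_iff_of_nonneg (fun i _ => by positivity)).1 h0.symm i
        (Finset.mem_univ i)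
      have h2 := (Finset.sum_eq_zero_iff_of_nonneg (fun i _ => by positivity)).1 h1 j
        (Finset.mem_univ j)
      exact sub_eq_zero.1 (norm_eq_zero.1 h2)
    rw [this, sub_self, norm_zero]; positivity
  let h : ℂ → ℂ := fun t => (1 - (N + t • (M - N))).det
  have hdiff : Differentiable ℂ h := by
    rw [← differentiableOn_univ]
    apply differentiable_det
    intro i j
    simp only [Matrix.sub_apply, Matrix.add_apply, Matrix.smul_apply, smul_eq_mul]
    fun_prop
  have hbound : ∀ t, ‖h t‖ ≤ Real.exp (b + ‖t‖ * d) := by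
    intro t
    refine (norm_det_one_sub_le _).trans (Real.exp_le_exp.2 ?_)
    rw [hb, hd, Finset.mul_sum, ← Finset.sum_add_distrib]
    refine Finset.sum_le_sum fun i _ => ?_
    rw [Finset.mul_sum, ← Finset.sum_add_distrib]
    refine Finset.sum_le_sum fun j _ => ?_
    simp only [Matrix.add_apply, Matrix.smul_apply, Matrix.sub_apply, smul_eq_mul]
    exact (norm_add_le _ _).trans (by rw [norm_mul])
  have hder : ∀ t ∈ Metric.closedBall (0 : ℂ) 1, ‖deriv h t‖ ≤ d * Real.exp (b + d + 1) := by
    intro t ht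
    have hR : 0 < 1 / d := by positivity
    have := Complex.norm_deriv_le_of_forall_mem_sphere_norm_le (c := t) (R := 1 / d)
      (C := Real.exp (b + d + 1)) hR hdiff.diffContOnCl (by
        intro z hz
        refine (hbound z).trans (Real.exp_le_exp.2 ?_)
        have hz' : ‖z‖ ≤ 1 + 1 / d := by
          have h1 : ‖z - t‖ = 1 / d := by simpa [dist_eq_norm] using hz
          have h2 : ‖t‖ ≤ 1 := by simpa using ht
          calc ‖z‖ = ‖t + (z - t)‖ := by ring_nf
            _ ≤ ‖t‖ + ‖z - t‖ := norm_add_le _ _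
            _ ≤ 1 + 1 / d := by rw [h1]; linarith
        have : ‖z‖ * d ≤ (1 + 1 / d) * d := by gcongr
        have h3 : (1 + 1 / d) * d = d + 1 := by field_simp
        linarith)
    refine this.trans (le_of_eq ?_)
    field_simp
  have := (convex_closedBall (0 : ℂ) 1).norm_image_sub_le_of_norm_deriv_le
    (f := h) (fun x _ => hdiff x) hder (x := 0) (y := 1) (by simp) (by simp)
  simpa [h] using this

/-! ### Determinants of truncations -/

variable {ι : Type*} [DecidableEq ι]

/-- Determinant of the truncation of `1 - A` to a finite set. -/
def fdet (A : ι → ι → ℂ) (F : Finset ι) : ℂ :=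
  (1 - Matrix.of (fun i j : F => A i j)).det

/-- Restriction of a matrix to a finite block, extended by zero. -/
def cut (A : ι → ι → ℂ) (G : Finset ι) (i j : ι) : ℂ := if i ∈ G ∧ j ∈ G then A i j else 0

lemma fdet_cut (A : ι → ι → ℂ) {G F : Finset ι} (h : G ⊆ F) :
    fdet A G = fdet (cut A G) F := by
  unfold fdet
  rw [Matrix.twoBlockTriangular_det (1 - Matrix.of (fun i j : F => cut A G i j))
    (fun i : F => (i : ι) ∈ G)]
  · have h2 : ((1 - Matrix.of (fun i j : F => cut A G i j)).toSquareBlockProp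
        fun i => ¬ ((i : ι) ∈ G)) = 1 := by
      ext i j
      have : cut A G i j = 0 := by simp [cut, i.2]
      rw [Matrix.toSquareBlockProp_def, Matrix.of_apply, Matrix.sub_apply, Matrix.of_apply, this,
        sub_zero, Matrix.one_apply, Matrix.one_apply]
      simp only [Subtype.ext_iff]
    rw [h2, Matrix.det_one, mul_one]
    let e : {i : F // (i : ι) ∈ G} ≃ G :=
      { toFun := fun i => ⟨i.1.1, i.2⟩
        invFun := fun i => ⟨⟨i.1, h i.2⟩, i.2⟩
        left_inv := fun _ => rfl
        right_inv := fun _ => rfl }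
    rw [← Matrix.det_submatrix_equiv_self e]
    congr 1
    ext i j
    have : cut A G i j = A i j := by simp [cut, i.2, j.2]
    rw [Matrix.submatrix_apply, Matrix.toSquareBlockProp_def, Matrix.of_apply, Matrix.sub_apply,
      Matrix.sub_apply, Matrix.of_apply, Matrix.of_apply, this, Matrix.one_apply, Matrix.one_apply]
    simp only [Subtype.ext_iff]
    rfl
  · intro i hi j hj
    have h1 : cut A G i j = 0 := by simp [cut, hi]
    have h2 : i ≠ j := by rintro rfl; exact hi hj
    simp [h1, h2]

/-- Sum of the absolute values of all entries. -/
def l1 (A : ι → ι → ℂ) : ℝ := ∑' p : ι × ι, ‖A p.1 p.2‖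

/-- Absolute summability of all entries. -/
def Summ (A : ι → ι → ℂ) : Prop := Summable (fun p : ι × ι => ‖A p.1 p.2‖)

lemma l1_nonneg (A : ι → ι → ℂ) : 0 ≤ l1 A := tsum_nonneg fun _ => norm_nonneg _

lemma sum_le_l1 {A : ι → ι → ℂ} (hA : Summ A) (F : Finset ι) :
    ∑ i : F, ∑ j : F, ‖A i j‖ ≤ l1 A := by
  have : ∑ i : F, ∑ j : F, ‖A i j‖ = ∑ p ∈ F ×ˢ F, ‖A p.1 p.2‖ := by
    rw [Finset.sum_product, ← Finset.sum_coe_sort F]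
    refine Finset.sum_congr rfl fun i _ => ?_
    rw [← Finset.sum_coe_sort F]
  rw [this]
  exact hA.sum_le_tsum _ (fun _ _ => norm_nonneg _)

lemma Summ.of_le {A B : ι → ι → ℂ} (hB : Summ B) (h : ∀ i j, ‖A i j‖ ≤ ‖B i j‖) : Summ A :=
  Summable.of_nonneg_of_le (fun _ => norm_nonneg _) (fun p => h p.1 p.2) hB

lemma l1_mono {A B : ι → ι → ℂ} (hB : Summ B) (h : ∀ i j, ‖A i j‖ ≤ ‖B i j‖) : l1 A ≤ l1 B :=
  (hB.of_le h).tsum_le_tsum (fun p => h p.1 p.2) hB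

lemma fdet_lipschitz {A B : ι → ι → ℂ} (hB : Summ B)
    (hAB : Summ (fun i j => A i j - B i j)) (F : Finset ι) :
    ‖fdet A F - fdet B F‖ ≤ l1 (fun i j => A i j - B i j) *
      Real.exp (l1 B + l1 (fun i j => A i j - B i j) + 1) := by
  refine (det_lipschitz _ _).trans ?_
  have h1 := sum_le_l1 hB F
  have h2 := sum_le_l1 hAB F
  simp only [Matrix.of_apply]
  gcongr
  exact l1_nonneg _

lemma norm_cut_le (A : ι → ι → ℂ) (G : Finset ι) (i j : ι) : ‖cut A G i j‖ ≤ ‖A i j‖ := by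
  unfold cut; split_ifs <;> simp

lemma norm_sub_cut_le (A : ι → ι → ℂ) (G : Finset ι) (i j : ι) :
    ‖A i j - cut A G i j‖ ≤ ‖A i j‖ := by
  unfold cut; split_ifs <;> simp

/-- Tail of a matrix outside a finite block. -/
def tail (A : ι → ι → ℂ) (G : Finset ι) : ℝ := l1 (fun i j => A i j - cut A G i j)

lemma tail_nonneg (A : ι → ι → ℂ) (G : Finset ι) : 0 ≤ tail A G := l1_nonneg _

lemma tail_le {A : ι → ι → ℂ} (hA : Summ A) (G : Finset ι) : tail A G ≤ l1 A :=
  l1_mono hA (norm_sub_cut_le A G)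

lemma fdet_sub_le {A : ι → ι → ℂ} (hA : Summ A) {G F : Finset ι} (h : G ⊆ F) :
    ‖fdet A F - fdet A G‖ ≤ tail A G * Real.exp (2 * l1 A + 1) := by
  rw [fdet_cut A h]
  refine (fdet_lipschitz (hA.of_le (norm_cut_le A G)) (hA.of_le (norm_sub_cut_le A G)) F).trans ?_
  have h1 := l1_mono hA (norm_cut_le A G)
  have h2 := l1_mono hA (norm_sub_cut_le A G)
  have := l1_nonneg (fun i j => A i j - cut A G i j)
  unfold tail
  gcongr
  linarith

lemma tendsto_tail {A : ι → ι → ℂ} (hA : Summ A) : Tendsto (tail A) atTop (𝓝 0) := by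
  have : (0 : ℝ) = ∑' p : ι × ι, (0 : ℝ) := by simp
  rw [this]
  unfold tail l1
  refine tendsto_tsum_of_dominated_convergence hA ?_ ?_
  · intro p
    apply tendsto_const_nhds.congr'
    filter_upwards [eventually_ge_atTop ({p.1, p.2} : Finset ι)] with G hG
    have h1 : p.1 ∈ G := hG (by simp)
    have h2 : p.2 ∈ G := hG (by simp)
    simp [cut, h1, h2]
  · filter_upwards with G p
    simpa using norm_sub_cut_le A G p.1 p.2

/-- The Fredholm determinant `det(1 - A)`. -/
def FD (A : ι → ι → ℂ) : ℂ := limUnder atTop (fdet A)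

lemma tendsto_fdet {A : ι → ι → ℂ} (hA : Summ A) : Tendsto (fdet A) atTop (𝓝 (FD A)) := by
  refine CauchySeq.tendsto_limUnder (u := fdet A) ?_
  rw [Metric.cauchySeq_iff']
  intro ε hε
  have h1 : Tendsto (fun G => tail A G * Real.exp (2 * l1 A + 1)) atTop (𝓝 0) := by
    simpa using (tendsto_tail hA).mul_const (Real.exp (2 * l1 A + 1))
  obtain ⟨G, hG⟩ := (h1.eventually (gt_mem_nhds hε)).exists
  refine ⟨G, fun F hF => ?_⟩
  rw [dist_eq_norm]
  exact (fdet_sub_le hA hF).trans_lt hG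

lemma FD_sub_le {A : ι → ι → ℂ} (hA : Summ A) (G : Finset ι) :
    ‖FD A - fdet A G‖ ≤ tail A G * Real.exp (2 * l1 A + 1) := by
  refine le_of_tendsto ((tendsto_fdet hA).sub_const (fdet A G)).norm ?_
  filter_upwards [eventually_ge_atTop G] with F hF
  exact fdet_sub_le hA hF

lemma differentiableOn_FD {A : ℂ → ι → ι → ℂ} {U : Set ℂ} (hU : IsOpen U)
    (hA : ∀ i j, DifferentiableOn ℂ (fun s => A s i j) U) {B : ι → ι → ℂ} (hB : Summ B)
    (hAB : ∀ s ∈ U, ∀ i j, ‖A s i j‖ ≤ ‖B i j‖) :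
    DifferentiableOn ℂ (fun s => FD (A s)) U := by
  have key : TendstoUniformlyOn (fun (F : Finset ι) s => fdet (A s) F) (fun s => FD (A s))
      atTop U := by
    rw [Metric.tendstoUniformlyOn_iff]
    intro ε hε
    have h1 : Tendsto (fun G => tail B G * Real.exp (2 * l1 B + 1)) atTop (𝓝 0) := by
      simpa using (tendsto_tail hB).mul_const (Real.exp (2 * l1 B + 1))
    filter_upwards [h1.eventually (gt_mem_nhds hε)] with G hG s hs
    rw [dist_eq_norm]
    have hAs := hB.of_le (hAB s hs)
    refine (FD_sub_le hAs G).trans_lt (lt_of_le_of_lt ?_ hG)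
    have h2 : l1 (A s) ≤ l1 B := l1_mono hB (hAB s hs)
    have h3 : tail (A s) G ≤ tail B G := by
      apply l1_mono (hB.of_le (norm_sub_cut_le B G))
      intro i j
      unfold cut
      split_ifs
      · simp
      · simpa using hAB s hs i j
    have := tail_nonneg B G
    gcongr
  refine key.tendstoLocallyUniformlyOn.differentiableOn ?_ hU
  filter_upwards with F
  apply differentiable_det
  intro i j
  simp only [Matrix.sub_apply, Matrix.of_apply]
  exact (differentiableOn_const _).sub (hA i j)

end Fred

end

noncomputable section

set_option linter.unusedSectionVars false

open Filter Topology

namespace Fred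

/-! ### The trace formula for finite matrices -/

lemma l1_mul_le {n : Type*} [Fintype n] (M N : Matrix n n ℂ) :
    ∑ i, ∑ j, ‖(M * N) i j‖ ≤ (∑ i, ∑ j, ‖M i j‖) * ∑ i, ∑ j, ‖N i j‖ := by
  calc ∑ i, ∑ j, ‖(M * N) i j‖ ≤ ∑ i, ∑ j, ∑ k, ‖M i k‖ * ‖N k j‖ := by
        refine Finset.sum_le_sum fun i _ => Finset.sum_le_sum fun j _ => ?_
        rw [Matrix.mul_apply]
        exact (norm_sum_le _ _).trans (Finset.sum_le_sum fun k _ => by rw [norm_mul])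
    _ = ∑ i, ∑ k, ‖M i k‖ * ∑ j, ‖N k j‖ := by
        refine Finset.sum_congr rfl fun i _ => ?_
        rw [Finset.sum_comm]
        simp only [Finset.mul_sum]
    _ ≤ ∑ i, ∑ k, ‖M i k‖ * ∑ l, ∑ j, ‖N l j‖ := by
        refine Finset.sum_le_sum fun i _ => Finset.sum_le_sum fun k _ => ?_
        exact mul_le_mul_of_nonneg_left (Finset.single_le_sum (f := fun l => ∑ j, ‖N l j‖)
          (fun _ _ => by positivity) (Finset.mem_univ k)) (norm_nonneg _)
    _ = _ := by simp only [Finset.sum_mul]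

lemma l1_pow_le {n : Type*} [Fintype n] [DecidableEq n] (M : Matrix n n ℂ) (k : ℕ) :
    ∑ i, ∑ j, ‖(M ^ (k + 1)) i j‖ ≤ (∑ i, ∑ j, ‖M i j‖) ^ (k + 1) := by
  induction k with
  | zero => simp
  | succ k ih =>
    rw [pow_succ, pow_succ (∑ i, ∑ j, ‖M i j‖)]
    exact (l1_mul_le _ _).trans (by gcongr)

lemma norm_trace_pow_le {n : Type*} [Fintype n] [DecidableEq n] (M : Matrix n n ℂ) (k : ℕ) :
    ‖(M ^ (k + 1)).trace‖ ≤ (∑ i, ∑ j, ‖M i j‖) ^ (k + 1) := by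
  refine le_trans ?_ (l1_pow_le M k)
  refine (norm_sum_le _ _).trans (Finset.sum_le_sum fun i _ => ?_)
  exact Finset.single_le_sum (f := fun j => ‖(M ^ (k + 1)) i j‖)
    (fun _ _ => norm_nonneg _) (Finset.mem_univ i)

section
attribute [local instance] Matrix.linftyOpNormedRing Matrix.linftyOpNormedAlgebra

lemma linfty_norm_le {n : Type*} [Fintype n] [DecidableEq n] (M : Matrix n n ℂ) :
    ‖M‖ ≤ ∑ i, ∑ j, ‖M i j‖ := by
  rw [Matrix.linfty_opNorm_def]
  have : ∀ i ∈ Finset.univ, (∑ j, ‖M i j‖₊) ≤ (∑ i, ∑ j, ‖M i j‖₊) := fun i hi =>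
    Finset.single_le_sum (f := fun i => ∑ j, ‖M i j‖₊) (fun _ _ => zero_le) hi
  have h := Finset.sup_le this
  have h2 : ((Finset.univ.sup fun i => ∑ j, ‖M i j‖₊ : NNReal) : ℝ)
    ≤ ((∑ i, ∑ j, ‖M i j‖₊ : NNReal) : ℝ) := by exact_mod_cast h
  simpa using h2

/-- Neumann series at the level of traces. -/
lemma exists_inv {n : Type*} [Fintype n] [DecidableEq n] (M : Matrix n n ℂ) (t : ℂ)
    (h : ‖t‖ * (∑ i, ∑ j, ‖M i j‖) < 1) :
    ∃ N : Matrix n n ℂ, (1 - t • M) * N = 1 ∧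
      HasSum (fun k : ℕ => t ^ k * (M ^ (k + 1)).trace) (N * M).trace := by
  have hn : ‖t • M‖ < 1 := by
    rw [norm_smul]
    refine lt_of_le_of_lt ?_ h
    gcongr
    exact linfty_norm_le M
  refine ⟨∑' k : ℕ, (t • M) ^ k, mul_neg_geom_series (t • M) hn, ?_⟩
  have h1 : HasSum (fun k : ℕ => (t • M) ^ k) (∑' k : ℕ, (t • M) ^ k) :=
    (summable_geometric_of_norm_lt_one hn).hasSum
  have h2 := h1.mul_right M
  have h3 := h2.map (Matrix.traceAddMonoidHom n ℂ)
    (by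
      change Continuous fun X : Matrix n n ℂ => X.trace
      exact continuous_id.matrix_trace)
  convert! h3 using 2 with k
  simp [smul_pow, pow_succ]

end

lemma hasDerivAt_det_one_sub {n : Type*} [Fintype n] [DecidableEq n] (M N : Matrix n n ℂ) (t : ℂ)
    (hN : (1 - t • M) * N = 1) :
    HasDerivAt (fun t : ℂ => (1 - t • M).det) (-(N * M).trace * (1 - t • M).det) t := by
  have h1 : ∀ z : ℂ, (1 - z • M).det = (1 - t • M).det * (1 + (z - t) • (-(N * M))).det := by
    intro z
    rw [← Matrix.det_mul]
    congr 1
    rw [mul_add, mul_one, Matrix.mul_smul, mul_neg, ← mul_assoc, hN, one_mul]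
    module
  have h2 : (fun z : ℂ => (1 - z • M).det) = fun z => (1 - t • M).det *
      (1 + (-(N * M)).trace * (z - t) + Polynomial.eval (z - t)
        (1 + (Polynomial.X : Polynomial ℂ) • (-(N * M)).map Polynomial.C).det.divX.divX
          * (z - t) ^ 2) := by
    funext z
    rw [h1 z, Matrix.det_one_add_smul]
  rw [h2]
  set p := (1 + (Polynomial.X : Polynomial ℂ) • (-(N * M)).map Polynomial.C).det.divX.divX
  have hs : HasDerivAt (fun z : ℂ => z - t) 1 t := (hasDerivAt_id t).sub_const t
  have hp : HasDerivAt (fun z : ℂ => Polynomial.eval (z - t) p)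
      (Polynomial.eval (t - t) p.derivative * 1) t :=
    HasDerivAt.comp (h₂ := fun x => Polynomial.eval x p) (h := fun z => z - t) t
      (p.hasDerivAt (t - t)) hs
  have := (((hs.const_mul (-(N * M)).trace).const_add 1).add (hp.mul (hs.pow 2))).const_mul
    (1 - t • M).det
  convert! this using 1
  simp
  ring

lemma det_eq_exp {n : Type*} [Fintype n] [DecidableEq n] (M : Matrix n n ℂ)
    (h : (∑ i, ∑ j, ‖M i j‖) < 1) :
    (1 - M).det = Complex.exp (-∑' k : ℕ, (M ^ (k + 1)).trace / ((k : ℂ) + 1)) := by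
  set a := ∑ i, ∑ j, ‖M i j‖ with ha
  have ha0 : 0 ≤ a := by positivity
  obtain ⟨r, hr1, hr2⟩ : ∃ r : ℝ, 1 < r ∧ r * a < 1 := by
    refine ⟨2 / (1 + a), ?_, ?_⟩
    · rw [lt_div_iff₀ (by positivity)]; linarith
    · rw [div_mul_eq_mul_div, div_lt_one (by positivity)]; linarith
  let S : ℂ → ℂ := fun t => ∑' k : ℕ, t ^ (k + 1) * ((M ^ (k + 1)).trace / ((k : ℂ) + 1))
  have hS : ∀ t ∈ Metric.ball (0 : ℂ) r,
      HasDerivAt S (∑' k : ℕ, t ^ k * (M ^ (k + 1)).trace) t := by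
    intro t ht
    refine hasDerivAt_tsum_of_isPreconnected (u := fun k => a * (r * a) ^ k) ?_
      Metric.isOpen_ball (convex_ball (0 : ℂ) r).isPreconnected
      (g := fun (k : ℕ) (t : ℂ) => t ^ (k + 1) * ((M ^ (k + 1)).trace / ((k : ℂ) + 1)))
      (g' := fun (k : ℕ) (t : ℂ) => t ^ k * (M ^ (k + 1)).trace) ?_ ?_
      (y₀ := 0) (by simp; linarith) ?_ ht
    · exact (summable_geometric_of_lt_one (by positivity) hr2).mul_left a
    · intro k y _
      have := (hasDerivAt_pow (k + 1) y).mul_const ((M ^ (k + 1)).trace / ((k : ℂ) + 1))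
      convert! this using 1
      have : (k : ℂ) + 1 ≠ 0 := by exact_mod_cast Nat.succ_ne_zero k
      push_cast
      field_simp
    · intro k y hy
      rw [norm_mul, norm_pow]
      have hy' : ‖y‖ ≤ r := (mem_ball_zero_iff.1 hy).le
      calc ‖y‖ ^ k * ‖(M ^ (k + 1)).trace‖ ≤ r ^ k * a ^ (k + 1) := by
            gcongr; exact norm_trace_pow_le M k
        _ = _ := by ring
    · simpa using (summable_zero : Summable fun _ : ℕ => (0 : ℂ))
  let H : ℂ → ℂ := fun t => (1 - t • M).det * Complex.exp (S t)
  have hH : ∀ t ∈ Metric.ball (0 : ℂ) r, HasDerivAt H 0 t := by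
    intro t ht
    have ht' : ‖t‖ < r := by simpa using ht
    have hlt : ‖t‖ * a < 1 := lt_of_le_of_lt (by gcongr) hr2
    obtain ⟨N, hN, hsum⟩ := exists_inv M t hlt
    have := (hasDerivAt_det_one_sub M N t hN).mul (hS t ht).cexp
    rw [hsum.tsum_eq] at this
    convert! this using 1
    ring
  have hconst : H 1 = H 0 := by
    refine (convex_ball (0 : ℂ) r).is_const_of_fderivWithin_eq_zero (𝕜 := ℂ) (f := H)
      (fun t ht => (hH t ht).differentiableAt.differentiableWithinAt) ?_ (by simpa using hr1)
      (by simp; linarith)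
    intro t ht
    rw [fderivWithin_of_isOpen Metric.isOpen_ball ht]
    have := (hH t ht).hasFDerivAt.fderiv
    rw [this]; simp
  have hS0 : S 0 = 0 := by simp [S]
  have hS1 : S 1 = ∑' k : ℕ, (M ^ (k + 1)).trace / ((k : ℂ) + 1) := by simp [S]
  simp only [H, hS0, hS1, one_smul, zero_smul, sub_zero, Matrix.det_one, Complex.exp_zero,
    mul_one] at hconst
  rw [Complex.exp_neg]
  exact eq_inv_of_mul_eq_one_left hconst

/-! ### The trace formula for infinite matrices -/

variable {ι : Type*} [DecidableEq ι]

/-- Powers of infinite matrices. -/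
def mpow (A : ι → ι → ℂ) : ℕ → ι → ι → ℂ
  | 0 => fun i j => if i = j then 1 else 0
  | n + 1 => fun i j => ∑' k, A i k * mpow A n k j

/-- Trace of powers. -/
def mtr (A : ι → ι → ℂ) (n : ℕ) : ℂ := ∑' i, mpow A n i i

lemma Summ.row {A : ι → ι → ℂ} (hA : Summ A) (i : ι) : Summable fun k => ‖A i k‖ :=
  hA.comp_injective (i := fun k => (i, k)) (fun a b h => by simpa using h)

lemma Summ.rows {A : ι → ι → ℂ} (hA : Summ A) : Summable fun i => ∑' k, ‖A i k‖ :=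
  (summable_prod_of_nonneg (fun _ => norm_nonneg _)).1 hA |>.2

lemma Summ.tsum_rows {A : ι → ι → ℂ} (hA : Summ A) : ∑' i, ∑' k, ‖A i k‖ = l1 A :=
  (hA.tsum_prod' (fun i => hA.row i)).symm

lemma Summ.row_le {A : ι → ι → ℂ} (hA : Summ A) (i : ι) : ∑' k, ‖A i k‖ ≤ l1 A := by
  rw [← hA.tsum_rows]
  exact hA.rows.le_tsum i (fun _ _ => tsum_nonneg fun _ => norm_nonneg _)

lemma norm_mpow_succ_le {A : ι → ι → ℂ} (hA : Summ A) (n : ℕ) (C : ℝ)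
    (h : ∀ i j, ‖mpow A n i j‖ ≤ C) (i j : ι) :
    ‖mpow A (n + 1) i j‖ ≤ (∑' k, ‖A i k‖) * C := by
  rw [← tsum_mul_right]
  refine tsum_of_norm_bounded ((hA.row i).mul_right C).hasSum (fun k => ?_)
  rw [norm_mul]
  gcongr
  exact h k j

lemma norm_mpow_le {A : ι → ι → ℂ} (hA : Summ A) (n : ℕ) (i j : ι) :
    ‖mpow A n i j‖ ≤ l1 A ^ n := by
  induction n generalizing i j with
  | zero => simp only [mpow, pow_zero]; split_ifs <;> simp
  | succ n ih =>
    refine (norm_mpow_succ_le hA n _ ih i j).trans ?_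
    rw [pow_succ']
    have := l1_nonneg A
    gcongr
    exact hA.row_le i

lemma norm_mpow_le' {A : ι → ι → ℂ} (hA : Summ A) (n : ℕ) (i j : ι) :
    ‖mpow A (n + 1) i j‖ ≤ (∑' k, ‖A i k‖) * l1 A ^ n :=
  norm_mpow_succ_le hA n _ (norm_mpow_le hA n) i j

lemma summable_mpow_diag {A : ι → ι → ℂ} (hA : Summ A) (n : ℕ) :
    Summable fun i => mpow A (n + 1) i i :=
  Summable.of_norm_bounded (hA.rows.mul_right (l1 A ^ n)) (fun i => norm_mpow_le' hA n i i)

lemma norm_mtr_le {A : ι → ι → ℂ} (hA : Summ A) (n : ℕ) : ‖mtr A (n + 1)‖ ≤ l1 A ^ (n + 1) := by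
  rw [pow_succ', ← hA.tsum_rows, ← tsum_mul_right]
  refine tsum_of_norm_bounded ((hA.rows.mul_right _).hasSum) (fun i => ?_)
  rw [hA.tsum_rows]
  exact norm_mpow_le' hA n i i

lemma mpow_cut (A : ι → ι → ℂ) (F : Finset ι) (n : ℕ) (i j : F) :
    mpow (cut A F) n i j = ((Matrix.of (fun i j : F => A i j)) ^ n) i j := by
  induction n generalizing i j with
  | zero => rw [pow_zero, Matrix.one_apply]; simp only [mpow, Subtype.ext_iff]
  | succ n ih =>
    rw [pow_succ', Matrix.mul_apply]
    simp only [mpow]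
    rw [tsum_eq_sum (s := F), ← Finset.sum_coe_sort F]
    · refine Finset.sum_congr rfl fun k _ => ?_
      rw [ih k j]
      simp [cut]
    · intro k hk
      simp [cut, hk]

lemma mtr_cut (A : ι → ι → ℂ) (F : Finset ι) (n : ℕ) :
    mtr (cut A F) (n + 1) = ((Matrix.of (fun i j : F => A i j)) ^ (n + 1)).trace := by
  unfold mtr Matrix.trace
  rw [tsum_eq_sum (s := F), ← Finset.sum_coe_sort F]
  · exact Finset.sum_congr rfl fun i _ => mpow_cut A F (n + 1) i i
  · intro i hi
    simp [mpow, cut, hi]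

lemma tendsto_mpow_cut {A : ι → ι → ℂ} (hA : Summ A) (n : ℕ) (i j : ι) :
    Tendsto (fun F => mpow (cut A F) n i j) atTop (𝓝 (mpow A n i j)) := by
  induction n generalizing i j with
  | zero => simpa [mpow] using tendsto_const_nhds
  | succ n ih =>
    simp only [mpow]
    refine tendsto_tsum_of_dominated_convergence ((hA.row i).mul_right (l1 A ^ n)) ?_ ?_
    · intro k
      refine Tendsto.mul ?_ (ih k j)
      apply tendsto_const_nhds.congr'
      filter_upwards [eventually_ge_atTop ({i, k} : Finset ι)] with G hG
      have h1 : i ∈ G := hG (by simp)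
      have h2 : k ∈ G := hG (by simp)
      simp [cut, h1, h2]
    · filter_upwards with F k
      rw [norm_mul]
      have h1 := norm_mpow_le (hA.of_le (norm_cut_le A F)) n k j
      have h2 := l1_mono hA (norm_cut_le A F)
      have h3 := l1_nonneg (cut A F)
      exact mul_le_mul (norm_cut_le A F i k) (h1.trans (by gcongr)) (norm_nonneg _)
        (norm_nonneg _)

lemma tendsto_mtr_cut {A : ι → ι → ℂ} (hA : Summ A) (n : ℕ) :
    Tendsto (fun F => mtr (cut A F) (n + 1)) atTop (𝓝 (mtr A (n + 1))) := by
  refine tendsto_tsum_of_dominated_convergence (hA.rows.mul_right (l1 A ^ n))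
    (fun i => tendsto_mpow_cut hA (n + 1) i i) ?_
  filter_upwards with F i
  have hc := hA.of_le (norm_cut_le A F)
  have h1 := norm_mpow_le' hc n i i
  have h2 := l1_mono hA (norm_cut_le A F)
  have h3 := l1_nonneg (cut A F)
  refine h1.trans (mul_le_mul ?_ (by gcongr) (by positivity)
    (tsum_nonneg fun _ => norm_nonneg _))
  exact (hc.row i).tsum_le_tsum (fun k => norm_cut_le A F i k) (hA.row i)

theorem FD_eq_exp {A : ι → ι → ℂ} (hA : Summ A) (h : l1 A < 1) :
    FD A = Complex.exp (-∑' k : ℕ, mtr A (k + 1) / ((k : ℂ) + 1)) := by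
  refine tendsto_nhds_unique (tendsto_fdet hA) ?_
  have h1 : ∀ F : Finset ι, fdet A F =
      Complex.exp (-∑' k : ℕ, mtr (cut A F) (k + 1) / ((k : ℂ) + 1)) := by
    intro F
    unfold fdet
    rw [det_eq_exp (Matrix.of (fun i j : F => A i j)) (lt_of_le_of_lt (sum_le_l1 hA F) h)]
    simp only [mtr_cut]
  simp_rw [funext h1]
  refine (Complex.continuous_exp.tendsto _).comp (Tendsto.neg ?_)
  refine tendsto_tsum_of_dominated_convergence
    ((summable_geometric_of_lt_one (l1_nonneg A) h).mul_left (l1 A)) ?_ ?_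
  · intro k
    exact (tendsto_mtr_cut hA k).div_const _
  · filter_upwards with F k
    rw [norm_div]
    have h2 := l1_mono hA (norm_cut_le A F)
    have h3 := l1_nonneg (cut A F)
    have h4 : (1 : ℝ) ≤ ‖(k : ℂ) + 1‖ := by
      have : ((k : ℂ) + 1) = ((k + 1 : ℕ) : ℂ) := by push_cast; ring
      rw [this, Complex.norm_natCast]
      exact_mod_cast Nat.succ_le_succ (Nat.zero_le k)
    calc ‖mtr (cut A F) (k + 1)‖ / ‖(k : ℂ) + 1‖ ≤ ‖mtr (cut A F) (k + 1)‖ :=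
          div_le_self (norm_nonneg _) h4
      _ ≤ l1 (cut A F) ^ (k + 1) := norm_mtr_le (hA.of_le (norm_cut_le A F)) k
      _ ≤ l1 A ^ (k + 1) := by gcongr
      _ = l1 A * l1 A ^ k := pow_succ' _ _

end Fred

end

noncomputable section

set_option linter.unusedSectionVars false

open Filter Topology

namespace Fred

/-- Coefficients of `(1 - x)^(-w)`. -/
def bc (w : ℂ) (m : ℕ) : ℂ := ∏ k ∈ Finset.range m, (w + k) / (k + 1)

/-- Real version of `bc`. -/
def rbc (w : ℝ) (m : ℕ) : ℝ := ∏ k ∈ Finset.range m, (w + k) / (k + 1)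

lemma bc_ofReal (w : ℝ) (m : ℕ) : bc (w : ℂ) m = (rbc w m : ℂ) := by
  simp [bc, rbc]

lemma choose_eq_bc (w : ℂ) (m : ℕ) : Ring.choose (-w) m = (-1) ^ m * bc w m := by
  have key : ∀ m : ℕ, (m.factorial : ℂ) * bc w m * (-1) ^ m =
      (descPochhammer ℤ m).smeval (-w) := by
    intro m
    induction m with
    | zero => simp [bc]
    | succ m ih =>
      rw [descPochhammer_succ_right, Polynomial.smeval_mul, ← ih]
      have h1 : (Polynomial.X - (m : Polynomial ℤ)).smeval (-w) = -w - m := by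
        rw [Polynomial.smeval_sub]
        simp [Polynomial.smeval_natCast]
      rw [h1]
      have : (m : ℂ) + 1 ≠ 0 := by exact_mod_cast Nat.succ_ne_zero m
      simp only [bc, Finset.prod_range_succ, Nat.factorial_succ]
      push_cast
      field_simp
      ring
  have h := Ring.descPochhammer_eq_factorial_smul_choose (-w) m
  rw [← key m, nsmul_eq_mul] at h
  have hm : (m.factorial : ℂ) ≠ 0 := by exact_mod_cast m.factorial_ne_zero
  apply mul_left_cancel₀ hm
  rw [← h]; ring

lemma bc_hasSum (w x : ℂ) (hx : ‖x‖ < 1) :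
    HasSum (fun m => bc w m * x ^ m) ((1 - x) ^ (-w)) := by
  have h := (Complex.one_add_cpow_hasFPowerSeriesOnBall_zero (a := -w)).hasSum (y := -x)
    (by simpa [enorm_eq_nnnorm, ← NNReal.coe_lt_coe] using hx)
  simp only [zero_add] at h
  convert! h using 2 with m
  rw [binomialSeries_apply, choose_eq_bc]
  simp only [List.ofFn_const, List.prod_replicate, smul_eq_mul]
  rw [neg_pow x]
  have : ((-1 : ℂ) ^ m) * (-1) ^ m = 1 := by rw [← mul_pow]; simp
  linear_combination (-(bc w m * x ^ m)) * this

lemma rbc_nonneg {w : ℝ} (hw : 0 ≤ w) (m : ℕ) : 0 ≤ rbc w m :=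
  Finset.prod_nonneg fun k _ => by positivity

lemma norm_bc_le {w : ℂ} {N : ℝ} (h : ‖w‖ ≤ N) (m : ℕ) : ‖bc w m‖ ≤ rbc N m := by
  unfold bc rbc
  rw [norm_prod]
  refine Finset.prod_le_prod (fun _ _ => norm_nonneg _) fun k _ => ?_
  rw [norm_div]
  have h4 : ‖(k : ℂ) + 1‖ = (k : ℝ) + 1 := by
    have : ((k : ℂ) + 1) = ((k + 1 : ℕ) : ℂ) := by push_cast; ring
    rw [this, Complex.norm_natCast]; push_cast; rfl
  rw [h4]
  gcongr
  refine (norm_add_le _ _).trans ?_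
  rw [Complex.norm_natCast]
  gcongr

lemma rbc_hasSum (N x : ℝ) (hx0 : 0 ≤ x) (hx : x < 1) :
    HasSum (fun m => rbc N m * x ^ m) ((1 - x) ^ (-N)) := by
  have h := bc_hasSum (N : ℂ) (x : ℂ) (by simpa [abs_of_nonneg hx0] using hx)
  have h2 := Complex.hasSum_re h
  convert! h2 using 1
  · funext m; rw [bc_ofReal]; norm_cast
  · have : (1 - (x : ℂ)) ^ (-(N : ℂ)) = (((1 - x) ^ (-N) : ℝ) : ℂ) := by
      rw [Complex.ofReal_cpow (by linarith)]; push_cast; rfl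
    rw [this, Complex.ofReal_re]

lemma differentiable_bc (m : ℕ) : Differentiable ℂ fun w => bc w m := by
  unfold bc
  apply Differentiable.fun_finsetProd
  intro k _
  fun_prop

/-! ### Systems of contracting Möbius maps -/

/-- A finite system of contracting real Möbius maps `u ↦ e / (A + B u)` of the unit disc. -/
structure Sys (L : Type*) where
  adm : L → L → Prop
  dec : DecidableRel adm
  A : L → L → ℝ
  B : L → L → ℝ
  e : L → L → ℝ
  r : L → ℝ
  hA : ∀ i j, adm i j → 1 + |B i j| < A i j
  he : ∀ i j, |e i j| = 1
  hr : ∀ i, 0 < r i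
  hdet : ∀ i j, adm i j → -(e i j * B i j) = r i / r j

attribute [instance] Sys.dec

namespace Sys

variable {L : Type*} [Fintype L] [DecidableEq L] (S : Sys L)

lemma A_pos {i j : L} (h : S.adm i j) : 1 < S.A i j := by
  have := S.hA i j h; have := abs_nonneg (S.B i j); linarith

lemma norm_le_AB {i j : L} (h : S.adm i j) {u : ℂ} (hu : ‖u‖ ≤ 1) :
    S.A i j - |S.B i j| ≤ ((S.A i j : ℂ) + S.B i j * u).re := by
  have h1 : |(S.B i j * u : ℂ).re| ≤ |S.B i j| := by
    refine (Complex.abs_re_le_norm _).trans ?_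
    rw [norm_mul]
    simp only [Complex.norm_real, Real.norm_eq_abs]
    exact mul_le_of_le_one_right (abs_nonneg _) hu
  have := neg_abs_le ((S.B i j * u : ℂ).re)
  simp only [Complex.add_re, Complex.ofReal_re]
  linarith

lemma one_lt_re {i j : L} (h : S.adm i j) {u : ℂ} (hu : ‖u‖ ≤ 1) :
    1 < ((S.A i j : ℂ) + S.B i j * u).re := by
  have := S.norm_le_AB h hu
  have := S.hA i j h
  linarith

lemma one_lt_norm {i j : L} (h : S.adm i j) {u : ℂ} (hu : ‖u‖ ≤ 1) :
    1 < ‖(S.A i j : ℂ) + S.B i j * u‖ :=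
  (S.one_lt_re h hu).trans_le (Complex.re_le_norm _)

lemma AB_ne {i j : L} (h : S.adm i j) {u : ℂ} (hu : ‖u‖ ≤ 1) :
    (S.A i j : ℂ) + S.B i j * u ≠ 0 := by
  intro h0
  have := S.one_lt_re h hu
  rw [h0] at this
  simp at this
  linarith

/-- The transfer matrix entries. -/
def ent (σ : ℂ) (i j : L) (m n : ℕ) : ℂ :=
  if S.adm i j then
    (S.e i j : ℂ) ^ n * (S.A i j : ℂ) ^ (-(2 * σ + n)) * (bc (2 * σ + n) m *
      (-(S.B i j : ℂ) / S.A i j) ^ m)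
  else 0

/-- One step maps. -/
def phi1 (i j : L) (u : ℂ) : ℂ := (S.e i j : ℂ) / ((S.A i j : ℂ) + S.B i j * u)

lemma norm_phi1_lt {i j : L} (h : S.adm i j) {u : ℂ} (hu : ‖u‖ ≤ 1) : ‖S.phi1 i j u‖ < 1 := by
  unfold phi1
  rw [norm_div, Complex.norm_real, Real.norm_eq_abs, S.he,
    div_lt_one (by linarith [S.one_lt_norm h hu])]
  exact S.one_lt_norm h hu

lemma ent_hasSum {σ : ℂ} {i j : L} (h : S.adm i j) (n : ℕ) {u : ℂ} (hu : ‖u‖ ≤ 1) :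
    HasSum (fun m => S.ent σ i j m n * u ^ m)
      (((S.A i j : ℂ) + S.B i j * u) ^ (-(2 * σ)) * S.phi1 i j u ^ n) := by
  have hA := S.A_pos h
  have hA0 : (S.A i j : ℂ) ≠ 0 := by exact_mod_cast (by linarith : S.A i j ≠ 0)
  have hx : ‖-((S.B i j : ℂ) / S.A i j * u)‖ < 1 := by
    rw [norm_neg, norm_mul, norm_div]
    simp only [Complex.norm_real, Real.norm_eq_abs]
    rw [abs_of_pos (a := S.A i j) (by linarith)]
    have h1 : |S.B i j| / S.A i j < 1 := by
      rw [div_lt_one (by linarith)]; have := S.hA i j h; linarith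
    exact lt_of_le_of_lt (mul_le_of_le_one_right (by positivity) hu) h1
  have h1 := (bc_hasSum (2 * σ + n) _ hx).mul_left
    ((S.e i j : ℂ) ^ n * (S.A i j : ℂ) ^ (-(2 * σ + n)))
  convert! h1 using 1
  · funext m
    rw [ent, if_pos h]
    rw [show -((S.B i j : ℂ) / S.A i j * u) = (-(S.B i j : ℂ) / S.A i j) * u by ring, mul_pow]
    ring
  · have hf : (S.A i j : ℂ) + S.B i j * u = (S.A i j : ℂ) * (1 - -((S.B i j : ℂ) / S.A i j * u)) := by
      field_simp
      ring
    have hne := S.AB_ne h hu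
    have e1 : (1 - -((S.B i j : ℂ) / S.A i j * u)) ≠ 0 := by
      intro h0; rw [hf, h0, mul_zero] at hne; exact hne rfl
    have e2 : ∀ z : ℂ, ((S.A i j : ℂ) + S.B i j * u) ^ z = (S.A i j : ℂ) ^ z *
        (1 - -((S.B i j : ℂ) / S.A i j * u)) ^ z := by
      intro z
      have hA' : (0:ℝ) < S.A i j := by linarith
      rw [Complex.cpow_def_of_ne_zero hne, Complex.cpow_def_of_ne_zero hA0,
        Complex.cpow_def_of_ne_zero e1, hf, Complex.log_ofReal_mul hA' e1,
        Complex.ofReal_log hA'.le, add_mul, Complex.exp_add]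
    rw [mul_assoc, ← e2, phi1, div_pow, neg_add, Complex.cpow_add _ _ hne,
      Complex.cpow_neg _ (n : ℂ), Complex.cpow_natCast]
    field_simp

/-- basic majorant -/
def base (N : ℝ) (i j : L) (m n : ℕ) : ℝ :=
  (S.A i j ^ n)⁻¹ * (rbc (2 * N + n) m * (|S.B i j| / S.A i j) ^ m)

lemma base_nonneg {N : ℝ} (hN : 0 ≤ N) {i j : L} (h : S.adm i j) (m n : ℕ) :
    0 ≤ S.base N i j m n := by
  have := S.A_pos h
  have : 0 < S.A i j := by linarith
  have := rbc_nonneg (w := 2 * N + n) (by positivity) m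
  unfold base
  positivity

lemma norm_ent_le {σ : ℂ} {N : ℝ} (hN : ‖σ‖ ≤ N) {i j : L} (h : S.adm i j) (m n : ℕ) :
    ‖S.ent σ i j m n‖ ≤ S.A i j ^ (-(2 * σ.re)) * S.base N i j m n := by
  have hA := S.A_pos h
  have hA0 : 0 < S.A i j := by linarith
  rw [ent, if_pos h, base]
  simp only [norm_mul, norm_pow, norm_div, norm_neg, Complex.norm_real, Real.norm_eq_abs, S.he,
    one_pow, one_mul]
  rw [Complex.norm_cpow_eq_rpow_re_of_pos hA0, abs_of_pos hA0]
  have e1 : (-(2 * σ + (n : ℂ))).re = -(2 * σ.re) + (-(n : ℝ)) := by simp; ring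
  rw [e1, Real.rpow_add hA0, Real.rpow_neg hA0.le (n : ℝ), Real.rpow_natCast, mul_assoc]
  gcongr
  apply norm_bc_le
  refine (norm_add_le _ _).trans ?_
  simp only [norm_mul, Complex.norm_ofNat, Complex.norm_natCast]
  gcongr

/-- contraction denominators -/
def q (i j : L) : ℝ := S.A i j - |S.B i j|

lemma one_lt_q {i j : L} (h : S.adm i j) : 1 < S.q i j := by
  have := S.hA i j h; unfold q; linarith

lemma base_hasSum (N : ℝ) {i j : L} (h : S.adm i j) (n : ℕ) :
    HasSum (fun m => S.base N i j m n)
      ((S.A i j / S.q i j) ^ (2 * N) * (S.q i j ^ n)⁻¹) := by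
  have hA := S.A_pos h
  have hq := S.one_lt_q h
  have hA0 : 0 < S.A i j := by linarith
  have hq0 : 0 < S.q i j := by linarith
  have hx : |S.B i j| / S.A i j < 1 := by
    rw [div_lt_one hA0]; unfold q at hq; linarith
  have h1 := (rbc_hasSum (2 * N + n) _ (by positivity) hx).mul_left ((S.A i j ^ n)⁻¹)
  convert! h1 using 1
  have e1 : 1 - |S.B i j| / S.A i j = S.q i j / S.A i j := by unfold q; field_simp
  rw [e1, Real.rpow_neg (by positivity), ← Real.inv_rpow (by positivity), inv_div,
    Real.rpow_add (by positivity), Real.rpow_natCast, div_pow]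
  field_simp

/-- The transfer matrix. -/
def mat (σ : ℂ) (p q : L × ℕ) : ℂ := S.ent σ p.1 q.1 p.2 q.2

end Sys

lemma summ_of_cols {L : Type*} [Fintype L] (M : (L × ℕ) → (L × ℕ) → ℂ) (b : L → L → ℕ → ℝ)
    (h : ∀ i j n, Summable fun m => ‖M (i, m) (j, n)‖)
    (h2 : ∀ i j n, ∑' m, ‖M (i, m) (j, n)‖ ≤ b i j n)
    (h3 : ∀ i j, Summable (b i j)) :
    Summ M ∧ l1 M ≤ ∑ i, ∑ j, ∑' n, b i j n := by
  let f : (L × L) × (ℕ × ℕ) → ℝ := fun p => ‖M (p.1.1, p.2.2) (p.1.2, p.2.1)‖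
  have hs : ∀ i j, Summable fun n => ∑' m, ‖M (i, m) (j, n)‖ := fun i j =>
    Summable.of_nonneg_of_le (fun _ => tsum_nonneg fun _ => norm_nonneg _) (h2 i j) (h3 i j)
  have hij : ∀ p : L × L, Summable fun x : ℕ × ℕ => f (p, x) := by
    rintro ⟨i, j⟩
    refine (summable_prod_of_nonneg (fun _ => norm_nonneg _)).2 ⟨fun n => h i j n, hs i j⟩
  have hf : Summable f :=
    (summable_prod_of_nonneg (fun _ => norm_nonneg _)).2 ⟨hij, Summable.of_finite⟩
  let E : (L × ℕ) × (L × ℕ) ≃ (L × L) × (ℕ × ℕ) :=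
    (Equiv.prodProdProdComm L ℕ L ℕ).trans ((Equiv.refl _).prodCongr (Equiv.prodComm _ _))
  have hE : ∀ p : (L × ℕ) × (L × ℕ), f (E p) = ‖M p.1 p.2‖ := fun p => rfl
  have hS : Summ M := by
    have := hf.comp_injective E.injective
    exact this
  refine ⟨hS, ?_⟩
  have e1 : l1 M = ∑' p, f p := by
    rw [← E.tsum_eq f]; rfl
  rw [e1, hf.tsum_prod' hij, tsum_fintype, Fintype.sum_prod_type]
  refine Finset.sum_le_sum fun i _ => Finset.sum_le_sum fun j _ => ?_
  rw [(hij (i, j)).tsum_prod' (fun n => h i j n)]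
  exact (hs i j).tsum_le_tsum (h2 i j) (h3 i j)

end Fred

end

noncomputable section

set_option linter.unusedSectionVars false

open Filter Topology

namespace Fred
namespace Sys

variable {L : Type*} [Fintype L] [DecidableEq L] (S : Sys L)

lemma summable_qinv {i j : L} (h : S.adm i j) : Summable fun n : ℕ => (S.q i j ^ n)⁻¹ := by
  have := S.one_lt_q h
  simp_rw [← inv_pow]
  exact summable_geometric_of_lt_one (by positivity) (inv_lt_one_of_one_lt₀ this)

lemma summable_ent (σ : ℂ) (i j : L) (n : ℕ) : Summable fun m => ‖S.ent σ i j m n‖ := by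
  by_cases h : S.adm i j
  · exact Summable.of_nonneg_of_le (fun _ => norm_nonneg _)
      (fun m => S.norm_ent_le le_rfl h m n) ((S.base_hasSum ‖σ‖ h n).summable.mul_left _)
  · simp [ent, h]

/-- column bound -/
def colB (σ : ℂ) (i j : L) (n : ℕ) : ℝ :=
  if S.adm i j then S.A i j ^ (-(2 * σ.re)) * ((S.A i j / S.q i j) ^ (2 * ‖σ‖) *
    (S.q i j ^ n)⁻¹) else 0

lemma tsum_ent_le (σ : ℂ) (i j : L) (n : ℕ) : ∑' m, ‖S.ent σ i j m n‖ ≤ S.colB σ i j n := by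
  by_cases h : S.adm i j
  · rw [colB, if_pos h, ← ((S.base_hasSum ‖σ‖ h n).mul_left _).tsum_eq]
    exact (S.summable_ent σ i j n).tsum_le_tsum (fun m => S.norm_ent_le le_rfl h m n)
      ((S.base_hasSum ‖σ‖ h n).summable.mul_left _)
  · simp [ent, h, colB]

lemma summable_colB (σ : ℂ) (i j : L) : Summable (S.colB σ i j) := by
  unfold colB
  by_cases h : S.adm i j
  · simp only [if_pos h]
    exact ((S.summable_qinv h).mul_left _).mul_left _
  · simp only [if_neg h]; exact summable_zero

lemma summ_mat (σ : ℂ) : Summ (S.mat σ) :=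
  (summ_of_cols (S.mat σ) (S.colB σ) (fun i j n => S.summable_ent σ i j n)
    (fun i j n => S.tsum_ent_le σ i j n) (S.summable_colB σ)).1

lemma l1_mat_le (σ : ℂ) : l1 (S.mat σ) ≤ ∑ i, ∑ j, ∑' n, S.colB σ i j n :=
  (summ_of_cols (S.mat σ) (S.colB σ) (fun i j n => S.summable_ent σ i j n)
    (fun i j n => S.tsum_ent_le σ i j n) (S.summable_colB σ)).2

/-- majorant matrix for `‖σ‖ ≤ N`. -/
def bmat (N : ℝ) (p q : L × ℕ) : ℂ :=
  if S.adm p.1 q.1 then ((S.A p.1 q.1 ^ (2 * N) * S.base N p.1 q.1 p.2 q.2 : ℝ) : ℂ) else 0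

lemma norm_bmat {N : ℝ} (hN : 0 ≤ N) {i j : L} (h : S.adm i j) (m n : ℕ) :
    ‖S.bmat N (i, m) (j, n)‖ = S.A i j ^ (2 * N) * S.base N i j m n := by
  have hA := S.A_pos h
  simp only [bmat, if_pos h, Complex.norm_real, Real.norm_eq_abs]
  exact abs_of_nonneg (mul_nonneg (Real.rpow_nonneg (by linarith) _) (S.base_nonneg hN h m n))

lemma summ_bmat {N : ℝ} (hN : 0 ≤ N) : Summ (S.bmat N) := by
  refine (summ_of_cols (S.bmat N) (fun i j n => ∑' m, ‖S.bmat N (i, m) (j, n)‖) ?_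
    (fun _ _ _ => le_rfl) ?_).1
  · intro i j n
    by_cases h : S.adm i j
    · simp_rw [S.norm_bmat hN h]
      exact (S.base_hasSum N h n).summable.mul_left _
    · simp [bmat, h]
  · intro i j
    by_cases h : S.adm i j
    · simp_rw [S.norm_bmat hN h, ((S.base_hasSum N h _).mul_left _).tsum_eq]
      exact ((S.summable_qinv h).mul_left _).mul_left _
    · simp only [bmat, if_neg h, norm_zero, tsum_zero]; exact summable_zero

lemma norm_mat_le_bmat {N : ℝ} {σ : ℂ} (hN : ‖σ‖ ≤ N) (p q : L × ℕ) :
    ‖S.mat σ p q‖ ≤ ‖S.bmat N p q‖ := by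
  obtain ⟨i, m⟩ := p
  obtain ⟨j, n⟩ := q
  have hN0 : 0 ≤ N := (norm_nonneg _).trans hN
  by_cases h : S.adm i j
  · rw [S.norm_bmat hN0 h]
    refine (S.norm_ent_le hN h m n).trans ?_
    have hA := S.A_pos h
    have := S.base_nonneg hN0 h m n
    gcongr
    · exact hA.le
    · have := (abs_le.1 ((Complex.abs_re_le_norm σ).trans hN)).1
      linarith
  · simp [mat, ent, bmat, h]

lemma differentiable_ent (i j : L) (m n : ℕ) : Differentiable ℂ fun σ => S.ent σ i j m n := by
  by_cases h : S.adm i j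
  · have hA := S.A_pos h
    have hA0 : (S.A i j : ℂ) ≠ 0 := by exact_mod_cast (by linarith : S.A i j ≠ 0)
    simp only [ent, if_pos h]
    have h1 : Differentiable ℂ fun σ : ℂ => (S.A i j : ℂ) ^ (-(2 * σ + n)) := by
      intro σ
      refine DifferentiableAt.const_cpow (by fun_prop) (Or.inl hA0)
    have h2 : Differentiable ℂ fun σ : ℂ => bc (2 * σ + n) m :=
      (differentiable_bc m).comp (by fun_prop)
    exact (h1.const_mul _).mul (h2.mul_const _)
  · simp only [ent, if_neg h]; fun_prop

theorem differentiable_FD : Differentiable ℂ fun σ => FD (S.mat σ) := by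
  intro σ
  have h := differentiableOn_FD (A := S.mat) (U := Metric.ball 0 (‖σ‖ + 1)) Metric.isOpen_ball
    (fun p q => (S.differentiable_ent p.1 q.1 p.2 q.2).differentiableOn)
    (S.summ_bmat (N := ‖σ‖ + 1) (by positivity))
    (fun s hs p q => S.norm_mat_le_bmat (mem_ball_zero_iff.1 hs).le p q)
  exact h.differentiableAt (Metric.isOpen_ball.mem_nhds (by simp))

/-- For large real part the `ℓ¹`-norm is smaller than one. -/
theorem exists_l1_lt_one : ∃ R : ℝ, ∀ σ : ℂ, R < σ.re → |σ.im| < 1 → l1 (S.mat σ) < 1 := by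
  have hlim : Tendsto (fun x : ℝ => ∑ i, ∑ j, if S.adm i j then
      S.A i j ^ (2 : ℝ) * (S.q i j ^ (-(2 * x)) * ∑' n : ℕ, (S.q i j ^ n)⁻¹) else 0) atTop
      (𝓝 (∑ _i : L, ∑ _j : L, 0)) := by
    refine tendsto_finsetSum _ fun i _ => tendsto_finsetSum _ fun j _ => ?_
    by_cases h : S.adm i j
    · simp only [if_pos h]
      have hq := S.one_lt_q h
      have h1 : Tendsto (fun x : ℝ => S.q i j ^ (-(2 * x))) atTop (𝓝 0) := by
        have h0 := tendsto_rpow_atBot_of_base_gt_one (S.q i j) hq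
        refine h0.comp ?_
        exact tendsto_neg_atTop_atBot.comp (tendsto_id.const_mul_atTop (by norm_num))
      simpa using (h1.mul_const _).const_mul _
    · simp only [if_neg h]; exact tendsto_const_nhds
  simp only [Finset.sum_const_zero] at hlim
  obtain ⟨R, hR⟩ := (hlim.eventually (gt_mem_nhds one_pos)).exists_forall_of_atTop
  refine ⟨max R 0, fun σ hσ him => ?_⟩
  refine lt_of_le_of_lt (S.l1_mat_le σ) (lt_of_le_of_lt ?_ (hR σ.re ((le_max_left _ _).trans hσ.le)))
  have hre : 0 < σ.re := lt_of_le_of_lt (le_max_right _ _) hσ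
  refine Finset.sum_le_sum fun i _ => Finset.sum_le_sum fun j _ => ?_
  by_cases h : S.adm i j
  · simp only [colB, if_pos h]
    rw [tsum_mul_left, tsum_mul_left, ← mul_assoc, ← mul_assoc]
    have hq := S.one_lt_q h
    have hA := S.A_pos h
    have hq0 : 0 < S.q i j := by linarith
    have hA0 : 0 < S.A i j := by linarith
    have ht : 0 ≤ ∑' n : ℕ, (S.q i j ^ n)⁻¹ := tsum_nonneg fun _ => by positivity
    refine mul_le_mul_of_nonneg_right ?_ ht
    rw [Real.div_rpow hA0.le hq0.le, div_eq_mul_inv, ← Real.rpow_neg hq0.le, ← mul_assoc,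
      ← Real.rpow_add hA0]
    have h1 : ‖σ‖ ≤ σ.re + 1 := by
      refine (Complex.norm_le_abs_re_add_abs_im σ).trans ?_
      rw [abs_of_pos hre]; linarith
    have h2 : σ.re ≤ ‖σ‖ := Complex.re_le_norm σ
    refine mul_le_mul (Real.rpow_le_rpow_of_exponent_le hA.le (by linarith))
      (Real.rpow_le_rpow_of_exponent_le hq.le (by linarith)) (by positivity) (by positivity)
  · simp [colB, h]

end Sys
end Fred

end

noncomputable section

set_option linter.unusedSectionVars false

open Filter Topology

namespace Fred

lemma hasSum_swap {F : ℕ → ℕ → ℂ} (hF : Summable fun p : ℕ × ℕ => F p.1 p.2) {g : ℕ → ℂ} {t : ℂ}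
    (h1 : ∀ n, HasSum (fun m => F n m) (g n)) (h2 : HasSum g t) :
    HasSum (fun m => ∑' n, F n m) t := by
  have e : ∑' p : ℕ × ℕ, F p.1 p.2 = t := by
    have := hF.hasSum.prod_fiberwise h1
    exact this.unique h2
  have hs : HasSum (fun p : ℕ × ℕ => F p.2 p.1) t := by
    have := (Equiv.prodComm ℕ ℕ).hasSum_iff.2 hF.hasSum
    rw [e] at this
    exact this
  exact hs.prod_fiberwise fun m => (hs.summable.prod_factor m).hasSum

namespace Sys

variable {L : Type*} [Fintype L] [DecidableEq L] (S : Sys L)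

/-- Endpoint of a path. -/
def last : L → List L → L
  | i, [] => i
  | _, j :: w => last j w

/-- All lists of a given length. -/
def lists (L : Type*) [Fintype L] [DecidableEq L] : ℕ → Finset (List L)
  | 0 => {[]}
  | n + 1 => (Finset.univ ×ˢ lists L n).image fun p => p.1 :: p.2

lemma mem_lists (n : ℕ) (w : List L) : w ∈ lists L n ↔ w.length = n := by
  induction n generalizing w with
  | zero => simp [lists]
  | succ n ih =>
    simp only [lists, Finset.mem_image, Finset.mem_product, Finset.mem_univ, true_and, Prod.exists]
    constructor
    · rintro ⟨a, b, hb, rfl⟩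
      simp [(ih b).1 hb]
    · intro h
      cases w with
      | nil => simp at h
      | cons a b => exact ⟨a, b, (ih b).2 (by simpa using h), rfl⟩

lemma sum_lists_succ {M : Type*} [AddCommMonoid M] (n : ℕ) (f : List L → M) :
    ∑ w ∈ lists L (n + 1), f w = ∑ j, ∑ w ∈ lists L n, f (j :: w) := by
  rw [lists, Finset.sum_image, Finset.sum_product]
  rintro ⟨a, b⟩ _ ⟨c, d⟩ _ h
  simpa using h

/-- Path matrices. -/
def P (σ : ℂ) : L → List L → ℕ → ℕ → ℂ
  | _, [] => fun m k => if m = k then 1 else 0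
  | i, j :: w => fun m k => ∑' n, S.ent σ i j m n * P σ j w n k

lemma colB_le (σ : ℂ) (i j : L) (n : ℕ) : S.colB σ i j n ≤ S.colB σ i j 0 := by
  unfold colB
  split_ifs with h
  · have hq := S.one_lt_q h
    have hA := S.A_pos h
    have hA0 : 0 < S.A i j := by linarith
    have hq0 : 0 < S.q i j := by linarith
    have h1 : (S.q i j ^ n)⁻¹ ≤ (S.q i j ^ 0)⁻¹ := by
      simpa using inv_le_one_of_one_le₀ (one_le_pow₀ hq.le)
    exact mul_le_mul_of_nonneg_left (mul_le_mul_of_nonneg_left h1 (by positivity)) (by positivity)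
  · exact le_rfl

lemma colB_nonneg (σ : ℂ) (i j : L) (n : ℕ) : 0 ≤ S.colB σ i j n :=
  (tsum_nonneg fun _ => norm_nonneg _).trans (S.tsum_ent_le σ i j n)

lemma step_summable (σ : ℂ) (i j : L) (v : ℕ → ℂ) (hv : Summable fun n => ‖v n‖) :
    Summable fun p : ℕ × ℕ => ‖S.ent σ i j p.2 p.1 * v p.1‖ := by
  rw [summable_prod_of_nonneg (fun _ => norm_nonneg _)]
  refine ⟨fun n => ?_, ?_⟩
  · simp_rw [norm_mul]
    exact (S.summable_ent σ i j n).mul_right _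
  · simp_rw [norm_mul, tsum_mul_right]
    refine Summable.of_nonneg_of_le (fun n => mul_nonneg (tsum_nonneg fun _ => norm_nonneg _)
      (norm_nonneg _)) (fun n => ?_) (hv.mul_left (S.colB σ i j 0))
    gcongr
    exact (S.tsum_ent_le σ i j n).trans (S.colB_le σ i j n)

lemma step_bound (σ : ℂ) (i j : L) (v : ℕ → ℂ) (hv : Summable fun n => ‖v n‖) :
    (Summable fun m => ‖∑' n, S.ent σ i j m n * v n‖) ∧
    ∑' m, ‖∑' n, S.ent σ i j m n * v n‖ ≤ S.colB σ i j 0 * ∑' n, ‖v n‖ := by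
  have h0 := S.step_summable σ i j v hv
  have h1 : Summable fun p : ℕ × ℕ => ‖S.ent σ i j p.1 p.2 * v p.2‖ :=
    h0.prod_symm
  have h2 : ∀ m, Summable fun n => ‖S.ent σ i j m n * v n‖ := fun m => h1.prod_factor m
  have h3 : Summable fun m => ∑' n, ‖S.ent σ i j m n * v n‖ := h1.prod
  have h4 : ∀ m, ‖∑' n, S.ent σ i j m n * v n‖ ≤ ∑' n, ‖S.ent σ i j m n * v n‖ :=
    fun m => norm_tsum_le_tsum_norm (h2 m)
  have h5 : Summable fun m => ‖∑' n, S.ent σ i j m n * v n‖ :=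
    Summable.of_nonneg_of_le (fun _ => norm_nonneg _) h4 h3
  refine ⟨h5, (h5.tsum_le_tsum h4 h3).trans ?_⟩
  have h6 : ∑' m, ∑' n, ‖S.ent σ i j m n * v n‖ = ∑' n, ∑' m, ‖S.ent σ i j m n * v n‖ :=
    Summable.tsum_comm (f := fun n m => ‖S.ent σ i j m n * v n‖) h0
  rw [h6, ← tsum_mul_left]
  refine Summable.tsum_le_tsum (fun n => ?_) h0.prod (hv.mul_left _)
  simp_rw [norm_mul, tsum_mul_right]
  gcongr
  exact (S.tsum_ent_le σ i j n).trans (S.colB_le σ i j n)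

lemma P_bound (σ : ℂ) (i : L) (w : List L) : ∃ C : ℝ, 0 ≤ C ∧ ∀ k,
    (Summable fun m => ‖S.P σ i w m k‖) ∧ ∑' m, ‖S.P σ i w m k‖ ≤ C := by
  induction w generalizing i with
  | nil =>
    refine ⟨1, zero_le_one, fun k => ?_⟩
    have : HasSum (fun m => ‖S.P σ i [] m k‖) 1 := by
      convert! hasSum_ite_eq (β := ℕ) k (1 : ℝ) using 2 with m
      simp only [P]; split_ifs <;> simp
    exact ⟨this.summable, this.tsum_eq.le⟩
  | cons j w ih =>
    obtain ⟨C, hC0, hC⟩ := ih j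
    refine ⟨S.colB σ i j 0 * C, mul_nonneg (S.colB_nonneg σ i j 0) hC0, fun k => ?_⟩
    obtain ⟨h1, h2⟩ := S.step_bound σ i j _ (hC k).1
    refine ⟨h1, h2.trans ?_⟩
    exact mul_le_mul_of_nonneg_left (hC k).2 (S.colB_nonneg σ i j 0)

lemma P_norm_le (σ : ℂ) (i : L) (w : List L) : ∃ C : ℝ, ∀ m k, ‖S.P σ i w m k‖ ≤ C := by
  obtain ⟨C, _, hC⟩ := S.P_bound σ i w
  exact ⟨C, fun m k => ((hC k).1.le_tsum m (fun _ _ => norm_nonneg _)).trans (hC k).2⟩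

lemma mpow_mat (σ : ℂ) (n : ℕ) (i j : L) (m k : ℕ) :
    mpow (S.mat σ) n (i, m) (j, k) =
      ∑ w ∈ lists L n, if last i w = j then S.P σ i w m k else 0 := by
  induction n generalizing i m with
  | zero =>
    simp only [mpow, lists, Finset.sum_singleton, last, P, Prod.mk.injEq]
    split_ifs <;> simp_all
  | succ n ih =>
    have hrow : Summable fun p : L × ℕ => S.mat σ (i, m) p * mpow (S.mat σ) n p (j, k) :=
      Summable.of_norm_bounded ((((S.summ_mat σ).row (i, m))).mul_right (l1 (S.mat σ) ^ n))
        (fun p => by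
          rw [norm_mul]
          exact mul_le_mul_of_nonneg_left (norm_mpow_le (S.summ_mat σ) n _ _) (norm_nonneg _))
    simp only [mpow]
    rw [hrow.tsum_prod, tsum_fintype, sum_lists_succ]
    refine Finset.sum_congr rfl fun j' _ => ?_
    simp_rw [ih]
    have hn : ∀ w : List L, Summable fun n => S.ent σ i j' m n * S.P σ j' w n k := by
      intro w
      obtain ⟨C, hC⟩ := S.P_norm_le σ j' w
      have hr : Summable fun n => ‖S.ent σ i j' m n‖ :=
        ((S.summ_mat σ).row (i, m)).prod_factor j'
      refine Summable.of_norm_bounded (hr.mul_right C) (fun n => ?_)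
      rw [norm_mul]
      exact mul_le_mul_of_nonneg_left (hC n k) (norm_nonneg _)
    simp_rw [Finset.mul_sum]
    rw [Summable.tsum_finsetSum]
    · refine Finset.sum_congr rfl fun w _ => ?_
      by_cases hl : last j' w = j
      · have hl' : last i (j' :: w) = j := hl
        simp only [if_pos hl, if_pos hl', P, mat]
      · have hl' : ¬ last i (j' :: w) = j := hl
        simp only [if_neg hl, if_neg hl', mul_zero, tsum_zero]
    · intro w _
      simp only [mat]
      split_ifs
      · exact hn w
      · simpa using summable_zero

/-- Path weights. -/
def W (σ : ℂ) : L → List L → ℂ → ℂ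
  | _, [] => fun _ => 1
  | i, j :: w => fun u => if S.adm i j then
      ((S.A i j : ℂ) + S.B i j * u) ^ (-(2 * σ)) * W σ j w (S.phi1 i j u) else 0

/-- Path maps. -/
def phi : L → List L → ℂ → ℂ
  | _, [] => fun u => u
  | i, j :: w => fun u => phi j w (S.phi1 i j u)

lemma P_hasSum (σ : ℂ) (i : L) (w : List L) (k : ℕ) {u : ℂ} (hu : ‖u‖ ≤ 1) :
    HasSum (fun m => S.P σ i w m k * u ^ m) (S.W σ i w u * S.phi i w u ^ k) := by
  induction w generalizing i u with
  | nil =>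
    simp only [P, W, phi, one_mul]
    convert! hasSum_ite_eq k (u ^ k) using 2 with m
    split_ifs with h <;> simp [h]
  | cons j w ih =>
    by_cases h : S.adm i j
    · simp only [P, W, phi, if_pos h]
      obtain ⟨C, _, hC⟩ := S.P_bound σ j w
      have hsum : Summable fun p : ℕ × ℕ =>
          (S.ent σ i j p.2 p.1 * S.P σ j w p.1 k) * u ^ p.2 := by
        refine Summable.of_norm_bounded (S.step_summable σ i j _ (hC k).1) (fun p => ?_)
        rw [norm_mul, norm_pow]
        exact mul_le_of_le_one_right (norm_nonneg _) (pow_le_one₀ (norm_nonneg _) hu)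
      have := hasSum_swap (F := fun n m => (S.ent σ i j m n * S.P σ j w n k) * u ^ m) hsum
        (fun n => by
          have := (S.ent_hasSum (σ := σ) h n hu).mul_right (S.P σ j w n k)
          convert! this using 2 with m
          ring)
        (by
          have := (ih j (S.norm_phi1_lt h hu).le).mul_left
            (((S.A i j : ℂ) + S.B i j * u) ^ (-(2 * σ)))
          rw [← mul_assoc] at this
          convert! this using 2 with n
          ring)
      convert! this using 2 with m
      rw [tsum_mul_right]
    · simp only [P, W, ent, if_neg h, zero_mul, tsum_zero]
      exact hasSum_zero

end Sys
end Fred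

end

noncomputable section

set_option linter.unusedSectionVars false

open Filter Topology

namespace Fred

lemma circle_hasSum {f : ℕ → ℂ → ℂ} {g : ℂ → ℂ} {b : ℕ → ℝ}
    (hf : ∀ n, ContinuousOn (f n) (Metric.sphere 0 1)) (hb : Summable b)
    (hfb : ∀ n u, ‖u‖ = 1 → ‖f n u‖ ≤ b n)
    (hs : ∀ u, ‖u‖ = 1 → HasSum (fun n => f n u) (g u)) :
    HasSum (fun n => ∮ u in C(0, 1), f n u) (∮ u in C(0, 1), g u) := by
  unfold circleIntegral
  have hc : ∀ θ : ℝ, ‖circleMap 0 1 θ‖ = 1 := fun θ => by simp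
  refine intervalIntegral.hasSum_integral_of_dominated_convergence (fun n _ => b n) ?_ ?_ ?_ ?_ ?_
  · intro n
    have h1 : Continuous fun θ => f n (circleMap 0 1 θ) :=
      (hf n).comp_continuous (continuous_circleMap 0 1) (fun θ => by simp)
    have h2 : Continuous fun θ : ℝ => deriv (circleMap 0 1) θ • f n (circleMap 0 1 θ) := by
      simp only [deriv_circleMap]
      exact ((continuous_circleMap 0 1).mul continuous_const).smul h1
    exact h2.aestronglyMeasurable
  · intro n
    filter_upwards with θ _
    rw [norm_smul, deriv_circleMap, norm_mul, hc, Complex.norm_I, one_mul, one_mul]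
    exact hfb n _ (hc θ)
  · filter_upwards with θ _
    exact hb
  · exact intervalIntegrable_const
  · filter_upwards with θ _
    exact (hs _ (hc θ)).const_smul _

lemma coef_eq {p : ℕ → ℂ} {F : ℂ → ℂ} (hp : Summable fun m => ‖p m‖)
    (h : ∀ u, ‖u‖ = 1 → HasSum (fun m => p m * u ^ m) (F u)) (m : ℕ) :
    ∮ u in C(0, 1), F u * (u ^ (m + 1))⁻¹ = 2 * Real.pi * Complex.I * p m := by
  have h1 := circle_hasSum (f := fun m' u => p m' * u ^ m' * (u ^ (m + 1))⁻¹)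
    (g := fun u => F u * (u ^ (m + 1))⁻¹) (b := fun m => ‖p m‖) ?_ hp ?_ ?_
  · refine h1.unique ?_
    have h2 : ∀ m', ∮ u in C(0, 1), p m' * u ^ m' * (u ^ (m + 1))⁻¹ =
        if m' = m then 2 * Real.pi * Complex.I * p m else 0 := by
      intro m'
      have e1 : ∮ u in C(0, 1), p m' * u ^ m' * (u ^ (m + 1))⁻¹ =
          ∮ u in C(0, 1), p m' * (u - 0) ^ ((m' : ℤ) - m - 1) := by
        refine circleIntegral.integral_congr zero_le_one fun u hu => ?_
        have hu0 : u ≠ 0 := by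
          rintro rfl; simp at hu
        simp only [sub_zero]
        rw [mul_assoc]
        congr 1
        rw [show ((m' : ℤ) - m - 1) = (m' : ℤ) - ((m + 1 : ℕ) : ℤ) by push_cast; ring,
          zpow_sub₀ hu0, zpow_natCast, zpow_natCast, div_eq_mul_inv]
      rw [e1, circleIntegral.integral_const_mul]
      split_ifs with hm
      · subst hm
        simp only [sub_self, zero_sub, zpow_neg_one]
        rw [circleIntegral.integral_sub_center_inv 0 one_ne_zero]
        ring
      · rw [circleIntegral.integral_sub_zpow_of_ne (by omega), mul_zero]
    simp_rw [h2]
    exact hasSum_ite_eq m _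
  · intro n
    refine ContinuousOn.mul (by fun_prop) (ContinuousOn.inv₀ (by fun_prop) ?_)
    intro u hu
    apply pow_ne_zero
    rintro rfl; simp at hu
  · intro n u hu
    simp [hu]
  · intro u hu
    exact (h u hu).mul_right _

lemma trace_circle {p : ℕ → ℕ → ℂ} {W φ : ℂ → ℂ} {ρ : ℝ} (hρ0 : 0 ≤ ρ) (hρ : ρ < 1)
    (hW : ContinuousOn W (Metric.sphere 0 1)) (hφ : ContinuousOn φ (Metric.sphere 0 1))
    (hφρ : ∀ u, ‖u‖ = 1 → ‖φ u‖ ≤ ρ)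
    (hp : ∀ k, Summable fun m => ‖p m k‖)
    (h : ∀ k u, ‖u‖ = 1 → HasSum (fun m => p m k * u ^ m) (W u * φ u ^ k)) :
    HasSum (fun m => 2 * Real.pi * Complex.I * p m m) (∮ u in C(0, 1), W u * (u - φ u)⁻¹) := by
  simp_rw [← fun k m => coef_eq (hp k) (h k) m]
  obtain ⟨C, hC⟩ := (isCompact_sphere (0 : ℂ) 1).exists_bound_of_continuousOn hW
  have hC' : ∀ u : ℂ, ‖u‖ = 1 → ‖W u‖ ≤ C := fun u hu => hC u (by simpa using hu)
  have hC0 : 0 ≤ C := (norm_nonneg _).trans (hC' 1 (by simp))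
  have hne : ∀ u ∈ Metric.sphere (0 : ℂ) 1, u ≠ 0 := by
    rintro u hu rfl; simp at hu
  refine circle_hasSum (b := fun m => C * ρ ^ m) ?_
    ((summable_geometric_of_lt_one hρ0 hρ).mul_left C) ?_ ?_
  · intro n
    refine (hW.mul (hφ.pow n)).mul (ContinuousOn.inv₀ (by fun_prop) ?_)
    intro u hu
    exact pow_ne_zero _ (hne u hu)
  · intro n u hu
    simp only [norm_mul, norm_pow, norm_inv, hu, one_pow, inv_one, mul_one]
    have := hφρ u hu
    have := hC' u hu
    gcongr
  · intro u hu
    have hu0 : u ≠ 0 := by rintro rfl; simp at hu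
    have h1 : ‖φ u / u‖ < 1 := by rw [norm_div, hu, div_one]; exact (hφρ u hu).trans_lt hρ
    have h2 := (hasSum_geometric_of_norm_lt_one h1).mul_left (W u * u⁻¹)
    convert! h2 using 1
    · funext m; rw [div_pow]; field_simp; ring
    · rw [mul_assoc, ← mul_inv]; congr 2; field_simp

namespace Sys

variable {L : Type*} [Fintype L] [DecidableEq L] (S : Sys L)

/-- Admissible paths. -/
def Adm : L → List L → Prop
  | _, [] => True
  | i, j :: w => S.adm i j ∧ Adm j w

/-- One-step matrix. -/
def N1 (i j : L) : Matrix (Fin 2) (Fin 2) ℝ := !![0, S.e i j; S.B i j, S.A i j]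

/-- Path matrix (real Möbius transformation). -/
def N : L → List L → Matrix (Fin 2) (Fin 2) ℝ
  | _, [] => 1
  | i, j :: w => N j w * S.N1 i j

/-- Denominators. -/
def den : L → List L → ℂ → ℂ
  | _, [] => fun _ => 1
  | i, j :: w => fun u => ((S.A i j : ℂ) + S.B i j * u) * den j w (S.phi1 i j u)

/-- Real denominators. -/
def rden : L → List L → ℝ → ℝ
  | _, [] => fun _ => 1
  | i, j :: w => fun x => (S.A i j + S.B i j * x) * rden j w (S.e i j / (S.A i j + S.B i j * x))

lemma P_eq_zero {σ : ℂ} {i : L} {w : List L} (h : ¬ S.Adm i w) (m k : ℕ) : S.P σ i w m k = 0 := by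
  induction w generalizing i m with
  | nil => exact absurd trivial h
  | cons j w ih =>
    simp only [P]
    by_cases h1 : S.adm i j
    · have h2 : ¬ S.Adm j w := fun h2 => h ⟨h1, h2⟩
      simp [ih h2]
    · simp [ent, h1]

lemma norm_phi_le {i : L} {w : List L} (h : S.Adm i w) {u : ℂ} (hu : ‖u‖ ≤ 1) :
    ‖S.phi i w u‖ ≤ 1 := by
  induction w generalizing i u with
  | nil => exact hu
  | cons j w ih => exact ih h.2 (S.norm_phi1_lt h.1 hu).le

lemma norm_phi_lt {i : L} {w : List L} (h : S.Adm i w) (hw : w ≠ []) {u : ℂ} (hu : ‖u‖ ≤ 1) :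
    ‖S.phi i w u‖ < 1 := by
  induction w generalizing i u with
  | nil => exact absurd rfl hw
  | cons j w ih =>
    cases w with
    | nil => exact S.norm_phi1_lt h.1 hu
    | cons k w => exact ih h.2 (by simp) (S.norm_phi1_lt h.1 hu).le

lemma den_ne {i : L} {w : List L} (h : S.Adm i w) {u : ℂ} (hu : ‖u‖ ≤ 1) : S.den i w u ≠ 0 := by
  induction w generalizing i u with
  | nil => exact one_ne_zero
  | cons j w ih => exact mul_ne_zero (S.AB_ne h.1 hu) (ih h.2 (S.norm_phi1_lt h.1 hu).le)

lemma N_apply {i : L} {w : List L} (h : S.Adm i w) {u : ℂ} (hu : ‖u‖ ≤ 1) :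
    (S.N i w 0 0 : ℂ) * u + S.N i w 0 1 = S.den i w u * S.phi i w u ∧
    (S.N i w 1 0 : ℂ) * u + S.N i w 1 1 = S.den i w u := by
  induction w generalizing i u with
  | nil => simp [N, den, phi]
  | cons j w ih =>
    obtain ⟨h1, h2⟩ := ih h.2 (S.norm_phi1_lt h.1 hu).le
    have hne := S.AB_ne h.1 hu
    have e1 : ((S.A i j : ℂ) + S.B i j * u) * S.phi1 i j u = S.e i j := by
      unfold phi1; field_simp
    simp only [N, N1, den, phi, Matrix.mul_apply, Fin.sum_univ_two, Matrix.of_apply,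
      Matrix.cons_val', Matrix.cons_val_zero, Matrix.cons_val_one, Matrix.cons_val_fin_one]
    push_cast
    constructor
    · rw [mul_assoc, ← h1]; linear_combination (-(S.N j w 0 0 : ℂ)) * e1
    · rw [← h2]; linear_combination (-(S.N j w 1 0 : ℂ)) * e1

lemma det_N {i : L} {w : List L} (h : S.Adm i w) : (S.N i w).det = S.r i / S.r (last i w) := by
  induction w generalizing i with
  | nil => simp [N, last, (S.hr i).ne']
  | cons j w ih =>
    rw [N, Matrix.det_mul, ih h.2, N1, Matrix.det_fin_two_of, zero_mul, zero_sub, S.hdet i j h.1]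
    have := (S.hr j).ne'
    have := (S.hr (last j w)).ne'
    simp only [last]
    field_simp

lemma rden_spec {i : L} {w : List L} (h : S.Adm i w) {x : ℝ} (hx : |x| ≤ 1) {q0 : ℝ}
    (hq0 : 0 ≤ q0) (hq : ∀ i j, S.adm i j → q0 ≤ S.q i j) :
    S.den i w x = (S.rden i w x : ℂ) ∧ 0 < S.rden i w x ∧ q0 ^ w.length ≤ S.rden i w x ∧
      ∀ σ : ℂ, S.W σ i w x = (S.rden i w x : ℂ) ^ (-(2 * σ)) := by
  induction w generalizing i x with
  | nil => simp [den, rden, W]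
  | cons j w ih =>
    have hu : ‖(x : ℂ)‖ ≤ 1 := by simpa using hx
    have hp : S.phi1 i j x = ((S.e i j / (S.A i j + S.B i j * x) : ℝ) : ℂ) := by
      unfold phi1; push_cast; rfl
    have hlt := S.norm_phi1_lt h.1 hu
    rw [hp, Complex.norm_real, Real.norm_eq_abs] at hlt
    obtain ⟨h1, h2, h3, h4⟩ := ih h.2 hlt.le
    have hre := S.norm_le_AB h.1 hu
    have hpos : S.q i j ≤ S.A i j + S.B i j * x := by
      have : ((S.A i j : ℂ) + S.B i j * x).re = S.A i j + S.B i j * x := by simp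
      rw [this] at hre; exact hre
    have hq1 := S.one_lt_q h.1
    have hpos0 : 0 < S.A i j + S.B i j * x := by linarith
    refine ⟨?_, ?_, ?_, ?_⟩
    · simp only [den, rden, hp, h1]; push_cast; rfl
    · exact mul_pos hpos0 h2
    · rw [List.length_cons, pow_succ']
      exact mul_le_mul ((hq i j h.1).trans hpos) h3 (by positivity) hpos0.le
    · intro σ
      simp only [W, if_pos h.1, hp, h4, rden]
      rw [Complex.ofReal_mul, Complex.mul_cpow_ofReal_nonneg hpos0.le h2.le]
      push_cast; rfl

lemma differentiableAt_phi1 {i j : L} (h : S.adm i j) {u : ℂ} (hu : ‖u‖ ≤ 1) :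
    DifferentiableAt ℂ (S.phi1 i j) u := by
  unfold phi1
  exact DifferentiableAt.div (by fun_prop) (by fun_prop) (S.AB_ne h hu)

lemma differentiableAt_W {σ : ℂ} {i : L} {w : List L} (h : S.Adm i w) {u : ℂ} (hu : ‖u‖ ≤ 1) :
    DifferentiableAt ℂ (S.W σ i w) u := by
  induction w generalizing i u with
  | nil => exact differentiableAt_const _
  | cons j w ih =>
    simp only [W, if_pos h.1]
    refine DifferentiableAt.mul ?_ ?_
    · refine DifferentiableAt.cpow (by fun_prop) (by fun_prop) ?_
      exact Or.inl (by have := S.one_lt_re h.1 hu; linarith)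
    · exact DifferentiableAt.comp u (ih h.2 (S.norm_phi1_lt h.1 hu).le)
        (S.differentiableAt_phi1 h.1 hu)

lemma differentiableAt_phi {i : L} {w : List L} (h : S.Adm i w) {u : ℂ} (hu : ‖u‖ ≤ 1) :
    DifferentiableAt ℂ (S.phi i w) u := by
  induction w generalizing i u with
  | nil => exact differentiableAt_id
  | cons j w ih =>
    exact DifferentiableAt.comp u (ih h.2 (S.norm_phi1_lt h.1 hu).le)
        (S.differentiableAt_phi1 h.1 hu)

/-- The local trace formula. -/
theorem trace_path {i : L} {w : List L} (h : S.Adm i w) (hw : w ≠ []) (hl : last i w = i) {q0 : ℝ}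
    (hq1 : 1 < q0) (hq : ∀ i j, S.adm i j → q0 ≤ S.q i j) :
    (S.N i w).det = 1 ∧ ∃ lam : ℝ, q0 ^ w.length ≤ lam ∧ (S.N i w).trace = lam + lam⁻¹ ∧
      ∀ σ : ℂ, HasSum (fun m => S.P σ i w m m)
        ((lam : ℂ) ^ (-(2 * σ)) / (1 - ((lam : ℂ) ^ 2)⁻¹)) := by
  have hdet : (S.N i w).det = 1 := by rw [S.det_N h, hl, div_self (S.hr i).ne']
  refine ⟨hdet, ?_⟩
  set α := S.N i w 0 0 with hα
  set β := S.N i w 0 1 with hβ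
  set γ := S.N i w 1 0 with hγ
  set δ := S.N i w 1 1 with hδ
  have hdet' : α * δ - β * γ = 1 := by rw [← hdet, Matrix.det_fin_two]
  have happ : ∀ u : ℂ, ‖u‖ ≤ 1 → (α : ℂ) * u + β = S.den i w u * S.phi i w u ∧
    (γ : ℂ) * u + δ = S.den i w u := fun u hu => S.N_apply h hu
  have hq0 : 0 ≤ q0 := by linarith
  -- real analysis of the quadratic
  have hreal : ∀ x : ℝ, |x| ≤ 1 → 0 < γ * x + δ ∧ |α * x + β| < γ * x + δ := by
    intro x hx
    obtain ⟨h1, h2, _, _⟩ := S.rden_spec h hx hq0 hq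
    have hu : ‖(x : ℂ)‖ ≤ 1 := by simpa using hx
    obtain ⟨e1, e2⟩ := happ x hu
    rw [h1] at e1 e2
    have e3 : γ * x + δ = S.rden i w x := by exact_mod_cast e2
    refine ⟨e3 ▸ h2, ?_⟩
    have h5 := S.norm_phi_lt h hw hu
    have e4 := congrArg norm e1
    rw [norm_mul, Complex.norm_real, Real.norm_eq_abs, abs_of_pos h2] at e4
    have e5 : ‖(α : ℂ) * x + β‖ = |α * x + β| := by
      rw [← Real.norm_eq_abs, ← Complex.norm_real]; push_cast; rfl
    rw [← e5, e4, e3]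
    exact mul_lt_of_lt_one_right h2 h5
  let Q : ℝ → ℝ := fun x => x * (γ * x + δ) - (α * x + β)
  have hQ1 : 0 < Q 1 := by
    obtain ⟨h1, h2⟩ := hreal 1 (by simp)
    have := (abs_lt.1 h2).2
    simp only [Q]; linarith
  have hQm : Q (-1) < 0 := by
    obtain ⟨h1, h2⟩ := hreal (-1) (by simp)
    have := (abs_lt.1 h2).1
    simp only [Q]; linarith
  obtain ⟨x, ⟨hx1, hx2⟩, hx⟩ : (0 : ℝ) ∈ Q '' Set.Icc (-1) 1 :=
    intermediate_value_Icc (by norm_num) (by fun_prop) ⟨hQm.le, hQ1.le⟩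
  have hx1' : -1 < x := lt_of_le_of_ne hx1 (by rintro rfl; linarith)
  have hx2' : x < 1 := lt_of_le_of_ne hx2 (by rintro rfl; linarith)
  have hxa : |x| ≤ 1 := abs_le.2 ⟨hx1, hx2⟩
  have hxa' : ‖(x : ℂ)‖ < 1 := by simpa using abs_lt.2 ⟨hx1', hx2'⟩
  set lam := γ * x + δ with hlam
  obtain ⟨d1, d2, d3, d4⟩ := S.rden_spec h hxa hq0 hq
  have hden : S.rden i w x = lam := by
    have := (happ x hxa'.le).2
    rw [d1] at this
    exact_mod_cast this.symm
  rw [hden] at d1 d2 d3 d4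
  have hQx : x * (γ * x + δ) = α * x + β := by simp only [Q] at hx; linarith
  set mu := γ * x + δ - α with hmu
  have hfac : ∀ y : ℝ, Q y = (y - x) * (γ * y + mu) := by
    intro y; simp only [Q, hmu]; linear_combination hQx
  have hmu1 : 0 < γ + mu := by
    have h1 := hfac 1
    rw [mul_one] at h1
    rw [h1] at hQ1
    exact (mul_pos_iff_of_pos_left (by linarith)).1 hQ1
  have hmu2 : 0 < mu - γ := by
    have h1 := hfac (-1)
    rw [h1] at hQm
    by_contra hcon
    have : 0 ≤ (-1 - x) * (γ * -1 + mu) := mul_nonneg_of_nonpos_of_nonpos (by linarith) (by linarith)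
    linarith
  have hlam' : lam * (α - γ * x) = 1 := by
    rw [← hdet', hlam]; linear_combination (-γ) * hQx
  have hinv : lam⁻¹ = α - γ * x := by
    rw [inv_eq_one_div, div_eq_iff d2.ne']; linarith
  have hne : ∀ u : ℂ, ‖u‖ ≤ 1 → (γ : ℂ) * u + mu ≠ 0 := by
    intro u hu h0
    have h1 : ((γ : ℂ) * u + mu).re = 0 := by rw [h0]; simp
    have h2 : γ * u.re + mu = 0 := by simpa using h1
    have h3 := abs_le.1 ((Complex.abs_re_le_norm u).trans hu)
    rcases le_total 0 γ with hg | hg <;> nlinarith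
  have hlam1 : 1 < lam := by
    refine lt_of_lt_of_le (one_lt_pow₀ hq1 ?_) d3
    simpa using hw
  refine ⟨lam, d3, ?_, ?_⟩
  · rw [Matrix.trace_fin_two, hinv, hlam]; ring
  intro σ
  have hcW : ContinuousOn (S.W σ i w) (Metric.closedBall 0 1) := fun u hu =>
    (S.differentiableAt_W h (by simpa using hu)).continuousAt.continuousWithinAt
  have hcφ : ContinuousOn (S.phi i w) (Metric.closedBall 0 1) := fun u hu =>
    (S.differentiableAt_phi h (by simpa using hu)).continuousAt.continuousWithinAt
  obtain ⟨ρ, hρ0, hρ1, hρ⟩ : ∃ ρ : ℝ, 0 ≤ ρ ∧ ρ < 1 ∧ ∀ u : ℂ, ‖u‖ = 1 → ‖S.phi i w u‖ ≤ ρ := by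
    obtain ⟨u0, hu0, hmax⟩ := (isCompact_sphere (0 : ℂ) 1).exists_isMaxOn
      ⟨1, by simp⟩ ((hcφ.mono Metric.sphere_subset_closedBall).norm)
    refine ⟨‖S.phi i w u0‖, norm_nonneg _, S.norm_phi_lt h hw (by simpa using hu0.le), ?_⟩
    intro u hu
    exact hmax (show u ∈ Metric.sphere (0 : ℂ) 1 by simpa using hu)
  obtain ⟨C, _, hC⟩ := S.P_bound σ i w
  have htr := trace_circle hρ0 hρ1 (hcW.mono Metric.sphere_subset_closedBall)
    (hcφ.mono Metric.sphere_subset_closedBall) hρ (fun k => (hC k).1)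
    (fun k u hu => S.P_hasSum σ i w k hu.le)
  have e1 : ∮ u in C(0, 1), S.W σ i w u * (u - S.phi i w u)⁻¹ =
      ∮ u in C(0, 1), (u - x)⁻¹ • (S.W σ i w u * ((γ * u + δ) / (γ * u + mu))) := by
    refine circleIntegral.integral_congr zero_le_one fun u hu => ?_
    have hu1 : ‖u‖ ≤ 1 := by simpa using hu.le
    obtain ⟨a1, a2⟩ := happ u hu1
    have hd := S.den_ne h hu1
    have hm := hne u hu1
    have hux : u - x ≠ 0 := by
      intro h0
      rw [sub_eq_zero] at h0
      rw [h0] at hu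
      simp at hu
      rw [Complex.norm_real, Real.norm_eq_abs] at hxa'
      linarith
    have hQu : (u - S.phi i w u) * (γ * u + δ) = (u - x) * (γ * u + mu) := by
      have hQx' : (x : ℂ) * (γ * x + δ) = α * x + β := by exact_mod_cast hQx
      have hmu' : (mu : ℂ) = γ * x + δ - α := by rw [hmu]; push_cast; ring
      rw [hmu']
      rw [← a2] at a1
      linear_combination a1 + hQx'
    have hd' : (γ : ℂ) * u + δ ≠ 0 := by rw [a2]; exact hd
    have hup : u - S.phi i w u ≠ 0 := by
      intro h0
      rw [h0, zero_mul] at hQu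
      exact mul_ne_zero hux hm hQu.symm
    have key : (u - S.phi i w u)⁻¹ = (u - x)⁻¹ * ((γ * u + δ) / (γ * u + mu)) := by
      rw [← div_eq_inv_mul, div_div, inv_eq_one_div, div_eq_div_iff hup (mul_ne_zero hm hux)]
      linear_combination -hQu
    simp only [smul_eq_mul]
    rw [key]; ring
  rw [e1, Complex.circleIntegral_sub_inv_smul_of_differentiable_on_off_countable
    (s := ∅) Set.countable_empty (by simpa using hxa') ?_ ?_] at htr
  · have h2pi : (2 * Real.pi * Complex.I : ℂ) ≠ 0 := Complex.two_pi_I_ne_zero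
    have := htr.mul_left (2 * Real.pi * Complex.I : ℂ)⁻¹
    convert! this using 1
    · funext m; field_simp
    · rw [smul_eq_mul, d4 σ]
      have hm' : (γ : ℂ) * x + mu = lam - (lam : ℂ)⁻¹ := by
        have : γ * x + mu = lam - lam⁻¹ := by rw [hinv, hmu, hlam]; ring
        exact_mod_cast this
      have hl' : (γ : ℂ) * x + δ = lam := by rw [hlam]; push_cast; ring
      rw [hm', hl']
      have hl0 : (lam : ℂ) ≠ 0 := by exact_mod_cast d2.ne'
      have hl2 : (lam : ℂ) ^ 2 - 1 ≠ 0 := by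
        have : lam ^ 2 - 1 ≠ 0 := by nlinarith
        exact_mod_cast this
      have e2 : (1 - ((lam : ℂ) ^ 2)⁻¹) = (lam ^ 2 - 1) / lam ^ 2 := by field_simp
      have e3 : ((lam : ℂ) - (lam : ℂ)⁻¹) = (lam ^ 2 - 1) / lam := by field_simp
      rw [e2, e3]
      field_simp
  · refine hcW.mul (ContinuousOn.div (by fun_prop) (by fun_prop) ?_)
    intro u hu
    exact hne u (by simpa using hu)
  · rintro u ⟨hu, _⟩
    have hu' : ‖u‖ ≤ 1 := (mem_ball_zero_iff.1 hu).le
    exact (S.differentiableAt_W h hu').mul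
      (DifferentiableAt.div (by fun_prop) (by fun_prop) (hne u hu'))

end Sys

end Fred

end

noncomputable section

set_option linter.unusedSectionVars false

open Filter Topology

namespace Fred

namespace Sys

variable {L : Type*} [Fintype L] [DecidableEq L] (S : Sys L)

/-- Closed admissible paths. -/
def Closed (w : List L) : Prop := ∃ i, last i w = i ∧ S.Adm i w

lemma last_indep (i i' : L) {w : List L} (hw : w ≠ []) : last i w = last i' w := by
  cases w with
  | nil => exact absurd rfl hw
  | cons j w => rfl

open Classical in
theorem mtr_mat (σ : ℂ) (n : ℕ) (f : List L → ℂ)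
    (hf : ∀ i w, w.length = n + 1 → last i w = i → S.Adm i w →
      HasSum (fun m => S.P σ i w m m) (f w)) :
    mtr (S.mat σ) (n + 1) = ∑ w ∈ lists L (n + 1), if S.Closed w then f w else 0 := by
  have h1 : ∀ i, HasSum (fun m => mpow (S.mat σ) (n + 1) (i, m) (i, m))
      (∑ w ∈ lists L (n + 1), if last i w = i ∧ S.Adm i w then f w else 0) := by
    intro i
    simp_rw [mpow_mat]
    refine hasSum_sum fun w hw => ?_
    rw [mem_lists] at hw
    by_cases hl : last i w = i
    · by_cases ha : S.Adm i w
      · simpa [hl, ha] using hf i w hw hl ha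
      · simpa [hl, ha, S.P_eq_zero ha] using hasSum_zero
    · simpa [hl] using hasSum_zero
  have h2 := (summable_mpow_diag (S.summ_mat σ) n).hasSum.prod_fiberwise h1
  rw [mtr, ← h2.tsum_eq, tsum_fintype, Finset.sum_comm]
  refine Finset.sum_congr rfl fun w hw => ?_
  rw [mem_lists] at hw
  have hw0 : w ≠ [] := by rintro rfl; simp at hw
  by_cases hc : S.Closed w
  · obtain ⟨i, hi1, hi2⟩ := id hc
    rw [if_pos hc, Finset.sum_eq_single i]
    · rw [if_pos ⟨hi1, hi2⟩]
    · intro b _ hb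
      rw [if_neg]
      rintro ⟨h, _⟩
      rw [last_indep b i hw0] at h
      exact hb (h.symm.trans hi1)
    · simp
  · rw [if_neg hc]
    refine Finset.sum_eq_zero fun i _ => if_neg fun h => hc ⟨i, h⟩

end Sys

end Fred

end

noncomputable section

set_option linter.unusedSectionVars false

open Filter Topology

namespace Fred

/-- Parameters of the symmetric three-funnel group. -/
structure Par where
  c : ℝ
  s : ℝ
  a : ℝ
  hc : 1 < c
  hs : 0 < s
  hcs : c ^ 2 - s ^ 2 = 1
  ha : a < 0
  htr : 2 * c ^ 2 + (a + a⁻¹) * s ^ 2 = -2 * c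

/-- Letters. -/
abbrev Let := Bool × Bool

namespace Par

variable (p : Par)

/-- The parameter of a generator. -/
def kap (b : Bool) : ℝ := if b then p.a else 1

/-- Sign of a letter. -/
def sg (b : Bool) : ℝ := if b then 1 else -1

lemma kap_ne (b : Bool) : p.kap b ≠ 0 := by
  unfold kap; split_ifs; exacts [p.ha.ne, one_ne_zero]

lemma sg_sq (b : Bool) : sg b * sg b = 1 := by unfold sg; split_ifs <;> norm_num

lemma abs_sg (b : Bool) : |sg b| = 1 := by unfold sg; split_ifs <;> norm_num

/-- Admissible transitions. -/
def adm (i j : Let) : Prop := i.1 = j.1 → i.2 = j.2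

instance : DecidableRel adm := fun i j => by unfold adm; infer_instance

/-- The key quantity. -/
def om (i j : Let) : ℝ := 1 + sg i.2 * sg j.2 * (p.kap j.1 / p.kap i.1)

/-- Its sign. -/
def tau (i j : Let) : ℝ := if 0 ≤ p.om i j then 1 else -1

lemma tau_om (i j : Let) : p.tau i j * p.om i j = |p.om i j| := by
  unfold tau; split_ifs with h
  · rw [one_mul, abs_of_nonneg h]
  · rw [abs_of_neg (not_le.1 h), neg_one_mul]

lemma tau_sq (i j : Let) : p.tau i j * p.tau i j = 1 := by
  unfold tau; split_ifs <;> norm_num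

lemma abs_tau (i j : Let) : |p.tau i j| = 1 := by
  unfold tau; split_ifs <;> norm_num

lemma sq_a : p.c * p.c * (1 + p.a) ^ 2 - (1 - p.a) ^ 2 = -2 * p.a * (p.c - 1) := by
  have h := p.htr
  have ha := p.ha.ne
  have hs : p.s ^ 2 = (p.c - 1) * (p.c + 1) := by linear_combination -p.hcs
  have h1 : (p.c + 1) * (2 * p.c * p.a + (p.a ^ 2 + 1) * (p.c - 1)) = 0 := by
    have : (2 * p.c ^ 2 + (p.a + p.a⁻¹) * p.s ^ 2) * p.a = -2 * p.c * p.a := by rw [h]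
    rw [hs] at this
    field_simp at this
    linear_combination this
  have h2 : 2 * p.c * p.a + (p.a ^ 2 + 1) * (p.c - 1) = 0 := by
    rcases mul_eq_zero.1 h1 with h3 | h3
    · have := p.hc; linarith
    · exact h3
  linear_combination (p.c + 1) * h2

lemma rel_a : 2 * p.c * p.a + (p.a ^ 2 + 1) * (p.c - 1) = 0 := by
  have h := p.sq_a
  have h1 : (p.c + 1) * (2 * p.c * p.a + (p.a ^ 2 + 1) * (p.c - 1)) = 0 := by
    linear_combination h
  rcases mul_eq_zero.1 h1 with h3 | h3
  · have := p.hc; linarith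
  · exact h3

lemma key_a : 1 - p.a < p.c * |1 + p.a| := by
  have h := p.sq_a
  have hc := p.hc
  have ha := p.ha
  refine lt_of_pow_lt_pow_left₀ 2 (by positivity) ?_
  rw [mul_pow, sq_abs]
  nlinarith

lemma adm_key {i j : Let} (h : adm i j) : 1 + |p.kap j.1 / p.kap i.1| < p.c * |p.om i j| := by
  have hc := p.hc
  have ha := p.ha
  have hk := p.key_a
  obtain ⟨i1, i2⟩ := i
  obtain ⟨j1, j2⟩ := j
  have h3 : |p.a| = - p.a := abs_of_neg ha
  have hop : 1 + (p.a)⁻¹ = (1 + p.a) * p.a⁻¹ := by field_simp [ha.ne]; ring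
  have hom : 1 - (p.a)⁻¹ = (1 - p.a) * (-p.a)⁻¹ := by field_simp [ha.ne]; ring
  have h4 : |1 - p.a| = 1 - p.a := abs_of_pos (by linarith)
  have hapos : 0 < (-p.a)⁻¹ := by rw [inv_pos]; linarith
  have h5 : 1 + |p.a⁻¹| = (1 - p.a) * (-p.a)⁻¹ := by
    rw [abs_inv, h3]; field_simp [ha.ne]; ring
  have h6 : |1 + p.a⁻¹| = |1 + p.a| * (-p.a)⁻¹ := by rw [hop, abs_mul, abs_inv, h3]
  have h7 : |1 - p.a⁻¹| = (1 - p.a) * (-p.a)⁻¹ := by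
    rw [hom, abs_mul, h4, abs_of_pos hapos]
  have k1 : (1 - p.a) * (-p.a)⁻¹ < p.c * (|1 + p.a| * (-p.a)⁻¹) := by
    rw [← mul_assoc]; exact mul_lt_mul_of_pos_right hk hapos
  have k2 : (1 - p.a) * (-p.a)⁻¹ < p.c * ((1 - p.a) * (-p.a)⁻¹) := by
    have : 0 < (1 - p.a) * (-p.a)⁻¹ := mul_pos (by linarith) hapos
    nlinarith
  cases i1 <;> cases j1 <;> cases i2 <;> cases j2 <;>
    simp [adm, om, kap, sg, ha.ne, ← sub_eq_add_neg, h3, h4, h5, h6, h7] at h ⊢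
  all_goals first
    | exact k1
    | exact k2
    | (rw [← abs_inv, h5]; first | exact k1 | exact k2)
    | (norm_num; nlinarith)
    | nlinarith

/-- The transfer system. -/
def sys : Sys Let where
  adm := adm
  dec := inferInstance
  A i j := p.c * |p.om i j|
  B i j := -(p.tau i j * sg j.2 * p.kap j.1 / |p.kap i.1|)
  e i j := p.tau i j * sg j.2 * (p.kap j.1 / |p.kap j.1|)
  r i := 1 / (|p.kap i.1| * p.s)
  hA i j h := by
    have := p.adm_key h
    rw [abs_neg, abs_div, abs_mul, abs_mul, abs_tau, abs_sg, abs_abs, one_mul, one_mul, ← abs_div]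
    exact this
  he i j := by
    rw [abs_mul, abs_mul, abs_tau, abs_sg, abs_div, abs_abs,
      div_self (abs_ne_zero.2 (p.kap_ne _)), one_mul, one_mul]
  hr i := by
    have := abs_pos.2 (p.kap_ne i.1)
    have := p.hs
    positivity
  hdet i j _ := by
    have h1 := abs_pos.2 (p.kap_ne i.1)
    have h2 := abs_pos.2 (p.kap_ne j.1)
    have h3 := p.hs
    field_simp
    have e1 := p.tau_sq i j
    have e2 := sg_sq j.2
    have e3 := abs_mul_abs_self (p.kap j.1)
    linear_combination (p.kap j.1) ^ 2 * sg j.2 * sg j.2 * e1 + (p.kap j.1) ^ 2 * e2 - e3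

/-- Letter matrices (inverse of the generator matrix). -/
def M (j : Let) : Matrix (Fin 2) (Fin 2) ℝ :=
  !![p.c, -(sg j.2 * p.s / p.kap j.1); -(sg j.2 * p.kap j.1 * p.s), p.c]

/-- Generator matrices. -/
def G (j : Let) : Matrix (Fin 2) (Fin 2) ℝ :=
  !![p.c, sg j.2 * p.s / p.kap j.1; sg j.2 * p.kap j.1 * p.s, p.c]

/-- Disc centre. -/
def z (i : Let) : ℝ := -(sg i.2 * p.c / (p.kap i.1 * p.s))

/-- Affine normalisation. -/
def H (i : Let) : Matrix (Fin 2) (Fin 2) ℝ := !![p.sys.r i, p.z i; 0, 1]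

lemma M_mul_G (j : Let) : p.M j * p.G j = 1 := by
  have h1 := sg_sq j.2
  have h2 := p.hcs
  have h3 := p.kap_ne j.1
  have hh : p.c * p.c - sg j.2 * sg j.2 * p.s * p.s = 1 := by rw [h1]; linarith
  ext x y
  fin_cases x <;> fin_cases y <;>
    simp [M, G, Matrix.mul_apply, Fin.sum_univ_two] <;> field_simp <;>
    first | linarith | ring

lemma M_mul_H (i j : Let) : p.M j * p.H i = p.tau i j • (p.H j * p.sys.N1 i j) := by
  have h1 := sg_sq j.2
  have h2 := p.hcs
  have h3 := p.kap_ne j.1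
  have h4 := p.kap_ne i.1
  have h5 := p.hs.ne'
  have e1 := p.tau_sq i j
  have e4 := p.tau_om i j
  have hA : p.tau i j * p.sys.A i j = p.c * p.om i j := by
    show p.tau i j * (p.c * |p.om i j|) = _
    rw [← e4]; linear_combination p.c * p.om i j * e1
  have hB : p.tau i j * p.sys.B i j = -(sg j.2 * p.kap j.1 / |p.kap i.1|) := by
    show p.tau i j * -(p.tau i j * sg j.2 * p.kap j.1 / |p.kap i.1|) = _
    linear_combination (-(sg j.2 * p.kap j.1 / |p.kap i.1|)) * e1
  have he : p.tau i j * p.sys.e i j = sg j.2 * (p.kap j.1 / |p.kap j.1|) := by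
    show p.tau i j * (p.tau i j * sg j.2 * (p.kap j.1 / |p.kap j.1|)) = _
    linear_combination (sg j.2 * (p.kap j.1 / |p.kap j.1|)) * e1
  have hr : ∀ i, p.sys.r i = 1 / (|p.kap i.1| * p.s) := fun i => rfl
  have e3 : |p.kap j.1| * |p.kap j.1| = p.kap j.1 * p.kap j.1 := abs_mul_abs_self (p.kap j.1)
  have h6 : |p.kap i.1| ≠ 0 := abs_ne_zero.2 h4
  have h7 : |p.kap j.1| ≠ 0 := abs_ne_zero.2 h3
  have hre : p.kap j.1 / |p.kap j.1| * (1 / (|p.kap j.1| * p.s)) = 1 / (p.kap j.1 * p.s) := by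
    field_simp; linear_combination -e3
  ext x y
  fin_cases x <;> fin_cases y
  · have : (p.tau i j • (p.H j * p.sys.N1 i j)) 0 0 = p.z j * (p.tau i j * p.sys.B i j) := by
      simp [H, Sys.N1, Matrix.mul_apply, Fin.sum_univ_two]; ring
    show _ = (p.tau i j • (p.H j * p.sys.N1 i j)) 0 0
    rw [this, hB]
    simp [M, H, Matrix.mul_apply, Fin.sum_univ_two, hr, z]
    field_simp
    linear_combination (-p.c) * h1
  · have : (p.tau i j • (p.H j * p.sys.N1 i j)) 0 1 =
        p.sys.r j * (p.tau i j * p.sys.e i j) + p.z j * (p.tau i j * p.sys.A i j) := by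
      simp [H, Sys.N1, Matrix.mul_apply, Fin.sum_univ_two]; ring
    show _ = (p.tau i j • (p.H j * p.sys.N1 i j)) 0 1
    have h8 : p.sys.r j * (sg j.2 * (p.kap j.1 / |p.kap j.1|)) = sg j.2 * (1 / (p.kap j.1 * p.s)) := by
      rw [hr, ← hre]; ring
    rw [this, hA, he, h8]
    simp [M, H, Matrix.mul_apply, Fin.sum_univ_two, z, om]
    field_simp
    linear_combination (p.kap i.1 * sg j.2) * h2 + (p.kap j.1 * p.c ^ 2 * sg i.2) * h1
  · have : (p.tau i j • (p.H j * p.sys.N1 i j)) 1 0 = (p.tau i j * p.sys.B i j) := by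
      simp [H, Sys.N1, Matrix.mul_apply, Fin.sum_univ_two]
    show _ = (p.tau i j • (p.H j * p.sys.N1 i j)) 1 0
    rw [this, hB]
    simp [M, H, Matrix.mul_apply, Fin.sum_univ_two, hr]
    field_simp
  · have : (p.tau i j • (p.H j * p.sys.N1 i j)) 1 1 = (p.tau i j * p.sys.A i j) := by
      simp [H, Sys.N1, Matrix.mul_apply, Fin.sum_univ_two]
    show _ = (p.tau i j • (p.H j * p.sys.N1 i j)) 1 1
    rw [this, hA]
    simp [M, H, Matrix.mul_apply, Fin.sum_univ_two, z, om]
    field_simp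
    ring

end Par

end Fred

end

noncomputable section

set_option linter.unusedSectionVars false

open Filter Topology

namespace Fred

local notation "SL2" => Matrix.SpecialLinearGroup (Fin 2) ℝ

lemma spectralRad_eq {A : Matrix (Fin 2) (Fin 2) ℝ} (hdet : A.det = 1) {lam : ℝ} (hl : 1 ≤ lam)
    (htr : |A.trace| = lam + lam⁻¹) : spectralRad A = lam := by
  have hl0 : 0 < lam := by linarith
  obtain ⟨t, ht, htt⟩ : ∃ t : ℝ, |t| = 1 ∧ A.trace = t * lam + t * lam⁻¹ := by
    rcases abs_choice A.trace with h | h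
    · exact ⟨1, by simp, by linarith⟩
    · exact ⟨-1, by simp, by linarith⟩
  have ht2 : t * t = 1 := by rw [← abs_mul_abs_self, ht]; norm_num
  have hspec : ∀ μ : ℂ, μ ∈ spectrum ℂ (A.map (fun x : ℝ => (x : ℂ))) ↔
      μ = (t * lam : ℝ) ∨ μ = (t * lam⁻¹ : ℝ) := by
    intro μ
    rw [spectrum.mem_iff, Matrix.isUnit_iff_isUnit_det, isUnit_iff_ne_zero, not_not]
    have : (algebraMap ℂ (Matrix (Fin 2) (Fin 2) ℂ) μ - A.map (fun x : ℝ => (x : ℂ))).det =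
        (μ - (t * lam : ℝ)) * (μ - (t * lam⁻¹ : ℝ)) := by
      have h1 : (A 0 0 : ℂ) * A 1 1 - A 0 1 * A 1 0 = 1 := by
        rw [Matrix.det_fin_two] at hdet; exact_mod_cast hdet
      have h2 : (A 0 0 : ℂ) + A 1 1 = (t * lam : ℝ) + (t * lam⁻¹ : ℝ) := by
        rw [Matrix.trace_fin_two] at htt; exact_mod_cast htt
      have h3 : ((t * lam : ℝ) : ℂ) * (t * lam⁻¹ : ℝ) = 1 := by
        have : (t * lam) * (t * lam⁻¹) = 1 := by field_simp; linarith
        exact_mod_cast this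
      rw [Matrix.det_fin_two]
      simp [Matrix.algebraMap_matrix_apply]
      push_cast at h2 h3
      linear_combination (-μ) * h2 + h1 - h3
    rw [this, mul_eq_zero, sub_eq_zero, sub_eq_zero]
  have n1 : ‖((t * lam : ℝ) : ℂ)‖ = lam := by
    rw [Complex.norm_real, Real.norm_eq_abs, abs_mul, ht, one_mul, abs_of_pos hl0]
  have n2 : ‖((t * lam⁻¹ : ℝ) : ℂ)‖ = lam⁻¹ := by
    rw [Complex.norm_real, Real.norm_eq_abs, abs_mul, ht, one_mul, abs_of_pos (inv_pos.2 hl0)]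
  have : IsGreatest {r : ℝ | ∃ μ ∈ spectrum ℂ (A.map (fun x : ℝ => (x : ℂ))), r = ‖μ‖} lam := by
    refine ⟨⟨_, (hspec _).2 (Or.inl rfl), n1.symm⟩, ?_⟩
    rintro r ⟨μ, hμ, rfl⟩
    rcases (hspec μ).1 hμ with rfl | rfl
    · exact n1.le
    · rw [n2]; exact (inv_le_one_of_one_le₀ hl).trans hl
  exact this.csSup_eq

namespace Par

variable (p : Par)

lemma det_G (j : Let) : (p.G j).det = 1 := by
  have h1 := sg_sq j.2
  have h2 := p.hcs
  have h3 := p.kap_ne j.1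
  rw [G, Matrix.det_fin_two_of]
  field_simp
  linear_combination h2 - p.s ^ 2 * h1

/-- Generators in `SL₂`. -/
def gen (b : Bool) : SL2 := ⟨p.G (b, true), p.det_G _⟩

/-- The representation. -/
def rho : FreeGroup Bool →* SL2 := FreeGroup.lift p.gen

lemma gen_inv (b : Bool) : ((p.gen b)⁻¹ : SL2).1 = p.G (b, false) := by
  rw [Matrix.SpecialLinearGroup.coe_inv, Matrix.adjugate_fin_two]
  ext x y
  fin_cases x <;> fin_cases y <;> simp [gen, G, sg] <;> ring

lemma rho_cons (j : Let) (w : List Let) :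
    (p.rho (FreeGroup.mk (j :: w))).1 = p.G j * (p.rho (FreeGroup.mk w)).1 := by
  simp only [rho, FreeGroup.lift_mk, List.map_cons, List.prod_cons,
    Matrix.SpecialLinearGroup.coe_mul]
  congr 1
  obtain ⟨b, e⟩ := j
  cases e
  · exact p.gen_inv b
  · rfl

/-- Reversed product. -/
def Mw : List Let → Matrix (Fin 2) (Fin 2) ℝ
  | [] => 1
  | j :: w => Mw w * p.M j

lemma Mw_mul (w : List Let) : p.Mw w * (p.rho (FreeGroup.mk w)).1 = 1 := by
  induction w with
  | nil => simp [Mw, ← FreeGroup.one_eq_mk]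
  | cons j w ih =>
    rw [rho_cons, Mw, Matrix.mul_assoc, ← Matrix.mul_assoc (p.M j), M_mul_G, Matrix.one_mul, ih]

lemma Mw_eq (w : List Let) : p.Mw w = ((p.rho (FreeGroup.mk w))⁻¹).1 := by
  have h2 : (p.rho (FreeGroup.mk w)).1 * ((p.rho (FreeGroup.mk w))⁻¹).1 = 1 := by
    rw [← Matrix.SpecialLinearGroup.coe_mul, mul_inv_cancel]; rfl
  calc p.Mw w = p.Mw w * ((p.rho (FreeGroup.mk w)).1 * ((p.rho (FreeGroup.mk w))⁻¹).1) := by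
        rw [h2, Matrix.mul_one]
    _ = _ := by rw [← Matrix.mul_assoc, Mw_mul, Matrix.one_mul]

lemma trace_Mw (w : List Let) : (p.Mw w).trace = (p.rho (FreeGroup.mk w)).1.trace := by
  rw [Mw_eq, Matrix.SpecialLinearGroup.coe_inv, Matrix.adjugate_fin_two, Matrix.trace_fin_two,
    Matrix.trace_fin_two]
  simp [add_comm]

lemma Mw_mul_H (i : Let) (w : List Let) : ∃ t : ℝ, |t| = 1 ∧
    p.Mw w * p.H i = t • (p.H (Sys.last i w) * p.sys.N i w) := by
  induction w generalizing i with
  | nil => exact ⟨1, by simp, by simp [Mw, Sys.last, Sys.N]⟩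
  | cons j w ih =>
    obtain ⟨t, ht, he⟩ := ih j
    refine ⟨p.tau i j * t, by rw [abs_mul, abs_tau, ht, one_mul], ?_⟩
    rw [Mw, Matrix.mul_assoc, M_mul_H, Matrix.mul_smul, ← Matrix.mul_assoc, he, Matrix.smul_mul,
      smul_smul, Sys.N, Sys.last, Matrix.mul_assoc]

/-- Inverse of `H`. -/
def Hi (i : Let) : Matrix (Fin 2) (Fin 2) ℝ := !![(p.sys.r i)⁻¹, -(p.sys.r i)⁻¹ * p.z i; 0, 1]

lemma H_mul_Hi (i : Let) : p.H i * p.Hi i = 1 := by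
  have := (p.sys.hr i).ne'
  ext x y
  fin_cases x <;> fin_cases y <;> simp [H, Hi, this]

lemma Hi_mul_H (i : Let) : p.Hi i * p.H i = 1 := by
  have := (p.sys.hr i).ne'
  ext x y
  fin_cases x <;> fin_cases y <;> simp [H, Hi, this]

lemma Mw_closed {i : Let} {w : List Let} (h : Sys.last i w = i) : ∃ t : ℝ, |t| = 1 ∧
    p.Mw w = t • (p.H i * p.sys.N i w * p.Hi i) := by
  obtain ⟨t, ht, he⟩ := p.Mw_mul_H i w
  refine ⟨t, ht, ?_⟩
  rw [h] at he
  rw [← Matrix.smul_mul, ← he, Matrix.mul_assoc, H_mul_Hi, Matrix.mul_one]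

/-- Uniform expansion. -/
lemma exists_q0 : ∃ q0 : ℝ, 1 < q0 ∧ ∀ i j, p.sys.adm i j → q0 ≤ p.sys.q i j := by
  classical
  let g : Let × Let → ℝ := fun x => if p.sys.adm x.1 x.2 then p.sys.q x.1 x.2 else 2
  obtain ⟨x, hx⟩ := Finite.exists_min g
  refine ⟨g x, ?_, fun i j h => ?_⟩
  · simp only [g]
    split_ifs with h
    · exact p.sys.one_lt_q h
    · norm_num
  · have := hx (i, j)
    simpa only [g, if_pos h] using this

lemma closed_iff {w : List Let} (hw : w ≠ []) :
    p.sys.Closed w ↔ FreeGroup.IsCyclicallyReduced w := by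
  have hA : ∀ (i : Let) (w : List Let), p.sys.Adm i w ↔ FreeGroup.IsReduced (i :: w) := by
    intro i w
    induction w generalizing i with
    | nil => simp [Sys.Adm]
    | cons j w ih => rw [Sys.Adm, ih, FreeGroup.isReduced_cons_cons]; rfl
  have hl : ∀ (i : Let) (w : List Let) (hw : w ≠ []), Sys.last i w = w.getLast hw := by
    intro i w hw
    induction w generalizing i with
    | nil => exact absurd rfl hw
    | cons j w ih =>
      cases w with
      | nil => rfl
      | cons k w => rw [List.getLast_cons (by simp), ← ih j (by simp)]; rfl
  cases w with
  | nil => exact absurd rfl hw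
  | cons j w =>
    simp only [Sys.Closed, hA, FreeGroup.isReduced_cons_cons, hl _ _ hw]
    rw [FreeGroup.IsCyclicallyReduced]
    simp only [List.getLast?_eq_getLast_of_ne_nil hw, List.head?_cons, Option.mem_def,
      Option.some.injEq]
    constructor
    · rintro ⟨i, h1, h2, h3⟩
      refine ⟨h3, ?_⟩
      rintro a rfl b rfl
      rw [h1]; exact h2
    · rintro ⟨h1, h2⟩
      exact ⟨_, rfl, h2 _ rfl _ rfl, h1⟩

/-- Length of a word. -/
def len (w : List Let) : ℝ := geodLength (p.rho (FreeGroup.mk w))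

theorem word_main : ∃ q0 : ℝ, 1 < q0 ∧ ∀ i w, p.sys.Adm i w → w ≠ [] → Sys.last i w = i →
    ∃ lam : ℝ, q0 ^ w.length ≤ lam ∧ spectralRad (p.rho (FreeGroup.mk w)).1 = lam ∧
      |(p.rho (FreeGroup.mk w)).1.trace| = lam + lam⁻¹ ∧
      (p.sys.N i w).det = 1 ∧ (p.sys.N i w).trace = lam + lam⁻¹ ∧
      ∀ σ, HasSum (fun m => p.sys.P σ i w m m)
        (Complex.exp (-(σ * p.len w)) / (1 - Complex.exp (-(p.len w)))) := by
  obtain ⟨q0, hq0, hq⟩ := p.exists_q0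
  refine ⟨q0, hq0, fun i w h hw hl => ?_⟩
  obtain ⟨hdet, lam, h1, h2, h3⟩ := p.sys.trace_path h hw hl hq0 hq
  have hlam : 1 < lam := lt_of_lt_of_le (one_lt_pow₀ hq0 (by simpa using hw)) h1
  have hl0 : 0 < lam := by linarith
  have htr : |(p.rho (FreeGroup.mk w)).1.trace| = lam + lam⁻¹ := by
    obtain ⟨t, ht, he⟩ := p.Mw_closed hl
    rw [← trace_Mw, he, Matrix.trace_smul, smul_eq_mul, abs_mul, ht, one_mul, Matrix.trace_mul_comm,
      ← Matrix.mul_assoc, Hi_mul_H, Matrix.one_mul, h2, abs_of_pos (by positivity)]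
  have hsp := spectralRad_eq (p.rho (FreeGroup.mk w)).2 hlam.le htr
  refine ⟨lam, h1, hsp, htr, hdet, h2, fun σ => ?_⟩
  convert! h3 σ using 2
  · have : (p.len w : ℂ) = 2 * Complex.log lam := by
      rw [len, geodLength, hsp]; push_cast; rw [Complex.ofReal_log hl0.le]
    rw [this, Complex.cpow_def_of_ne_zero (by exact_mod_cast hl0.ne')]
    congr 1; ring
  · have : p.len w = Real.log (lam ^ 2) := by
      rw [len, geodLength, hsp, Real.log_pow]; norm_num
    rw [this, ← Complex.ofReal_neg, ← Complex.ofReal_exp, Real.exp_neg, Real.exp_log (by positivity)]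
    push_cast; rfl

end Par

end Fred

end

noncomputable section

set_option linter.unusedSectionVars false

open Filter Topology

namespace Fred

namespace FG

open FreeGroup

variable {α : Type} [DecidableEq α]

lemma eq_of_reduced {w w' : List (α × Bool)} (h : IsReduced w) (h' : IsReduced w')
    (he : FreeGroup.mk w = FreeGroup.mk w') : w = w' := by
  rw [← h.reduce_eq, ← h'.reduce_eq, ← toWord_mk, ← toWord_mk, he]

lemma CR_rotate_one {x : α × Bool} {w : List (α × Bool)} (h : IsCyclicallyReduced (x :: w)) :
    IsCyclicallyReduced (w ++ [x]) := by
  obtain ⟨h1, h2⟩ := h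
  rw [FreeGroup.IsReduced, List.isChain_cons] at h1
  refine ⟨?_, ?_⟩
  · rw [FreeGroup.IsReduced, List.isChain_append]
    refine ⟨h1.2, List.isChain_singleton x, ?_⟩
    intro a ha b hb
    refine h2 a ?_ b (by simpa using hb)
    cases w with
    | nil => simp at ha
    | cons y w => simpa [List.getLast?_cons_cons] using ha
  · intro a ha b hb
    simp only [List.getLast?_concat, Option.mem_def, Option.some.injEq] at ha
    subst ha
    cases w with
    | nil => simp at hb; simp [hb]
    | cons y w => exact h1.1 b (by simpa using hb)

lemma CR_rotate {w : List (α × Bool)} (h : IsCyclicallyReduced w) (n : ℕ) :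
    IsCyclicallyReduced (w.rotate n) := by
  induction n generalizing w with
  | zero => simpa using h
  | succ n ih =>
    cases w with
    | nil => simpa using h
    | cons x w => rw [List.rotate_cons_succ]; exact ih (CR_rotate_one h)

lemma mk_append (u v : List (α × Bool)) : FreeGroup.mk (u ++ v) = FreeGroup.mk u * FreeGroup.mk v :=
  (FreeGroup.mul_mk).symm

lemma mk_inv_letter (y : α × Bool) : FreeGroup.mk [(y.1, !y.2)] = (FreeGroup.mk [y])⁻¹ := by
  simp [FreeGroup.inv_mk, invRev]

lemma eq_inv_of {x y : α × Bool} (h : ¬ (x.1 = y.1 → x.2 = y.2)) : y = (x.1, !x.2) := by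
  obtain ⟨x1, x2⟩ := x
  obtain ⟨y1, y2⟩ := y
  simp only [Classical.not_imp] at h
  obtain ⟨h1, h2⟩ := h
  subst h1
  cases x2 <;> cases y2 <;> simp_all

/-- Either the conjugator is trivial or one can rotate, or the concatenation is reduced. -/
theorem conj_rotated (u : List (α × Bool)) (hu : IsReduced u) {w w' : List (α × Bool)}
    (hw : IsCyclicallyReduced w) (hw' : IsCyclicallyReduced w')
    (he : FreeGroup.mk w' = FreeGroup.mk u * FreeGroup.mk w * (FreeGroup.mk u)⁻¹) : w ~r w' := by
  induction u using List.reverseRecOn generalizing w with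
  | nil =>
    have : w = w' := eq_of_reduced hw.1 hw'.1 (by rw [he]; simp [← FreeGroup.one_eq_mk])
    rw [this]
  | append_singleton u y ih =>
    have hu' : IsReduced u := hu.infix ⟨[], [y], by simp⟩
    rw [mk_append] at he
    cases w with
    | nil =>
      have : w' = [] := eq_of_reduced hw'.1 IsReduced.nil (by
        rw [he, ← FreeGroup.one_eq_mk, mul_one, mul_inv_cancel])
      rw [this]
    | cons x w =>
      by_cases h1 : y.1 = x.1 → y.2 = x.2
      · by_cases h2 : ∀ a ∈ (x :: w).getLast?, a ≠ y
        · exfalso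
          have hred : IsReduced ((u ++ [y]) ++ (x :: w) ++ invRev (u ++ [y])) := by
            refine IsReduced.append_overlap ?_ ?_ (by simp)
            · rw [FreeGroup.IsReduced, List.isChain_append]
              refine ⟨hu, hw.1, ?_⟩
              intro a ha b hb
              simp at ha hb
              subst ha; subst hb
              exact h1
            · rw [FreeGroup.IsReduced, List.isChain_append]
              refine ⟨hw.1, FreeGroup.IsReduced.of_reduce_eq (by rw [FreeGroup.reduce_invRev, FreeGroup.IsReduced.reduce_eq hu]), ?_⟩
              intro a ha b hb
              have h3 := h2 a ha
              simp [invRev] at hb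
              subst hb
              intro h4
              simp only at h4 ⊢
              by_contra h5
              apply h3
              obtain ⟨a1, a2⟩ := a
              obtain ⟨y1, y2⟩ := y
              simp only at h4 h5
              subst h4
              cases a2 <;> cases y2 <;> simp_all
          have hww := eq_of_reduced hred hw'.1 (by
            rw [he, mk_append, mk_append, mk_append, ← FreeGroup.inv_mk, mk_append])
          have hcr := hw'.2
          rw [← hww] at hcr
          obtain ⟨z, t, hz⟩ : ∃ z t, u ++ [y] = z :: t := by
            cases u with
            | nil => exact ⟨y, [], rfl⟩
            | cons z t => exact ⟨z, t ++ [y], rfl⟩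
          rw [hz] at hcr
          have := hcr (z.1, !z.2) (by
            rw [show invRev (z :: t) = invRev t ++ [(z.1, !z.2)] by simp [invRev], ← List.append_assoc,
              List.getLast?_concat]; rfl) z (by simp)
          simp at this
        · push Not at h2
          obtain ⟨a, ha, rfl⟩ := h2
          have hne : x :: w ≠ [] := by simp
          obtain ⟨w1, hw1⟩ : ∃ w1, x :: w = w1 ++ [a] := by
            rcases List.eq_nil_or_concat (x :: w) with h | ⟨w1, b, hb⟩
            · simp at h
            · rw [List.concat_eq_append] at hb
              rw [hb] at ha
              simp at ha
              exact ⟨w1, by rw [hb, ha]⟩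
          rw [hw1] at he hw ⊢
          have hrot : (w1 ++ [a]).rotate w1.length = a :: w1 := by simp
          have hcr : IsCyclicallyReduced (a :: w1) := hrot ▸ CR_rotate hw w1.length
          have := ih hu' hcr (by
            rw [he, mk_append, show a :: w1 = [a] ++ w1 from rfl, mk_append]; group)
          exact List.IsRotated.trans ⟨w1.length, hrot⟩ this
      · have hx := eq_inv_of h1
        have hrot : (x :: w).rotate 1 = w ++ [x] := by simp
        have hcr := CR_rotate_one hw
        have := ih hu' hcr (by
          rw [he, mk_append, show x :: w = [x] ++ w from rfl, mk_append, hx, mk_inv_letter]; group)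
        exact List.IsRotated.trans ⟨1, hrot⟩ this

lemma exists_CR (g : FreeGroup α) : ∃ (h : FreeGroup α) (V : List (α × Bool)),
    IsCyclicallyReduced V ∧ g = h * FreeGroup.mk V * h⁻¹ ∧ V.length ≤ g.norm := by
  refine ⟨FreeGroup.mk (reduceCyclically.conjugator g.toWord), reduceCyclically g.toWord,
    reduceCyclically.isCyclicallyReduced isReduced_toWord, ?_, ?_⟩
  · rw [FreeGroup.inv_mk, ← mk_append, ← mk_append, reduceCyclically.conj_conjugator_reduceCyclically,
      mk_toWord]
  · have := congrArg List.length (reduceCyclically.conj_conjugator_reduceCyclically g.toWord)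
    rw [FreeGroup.norm, ← this, List.length_append, List.length_append]
    omega

lemma rotated_of_conj {g : FreeGroup α} {w w' : List (α × Bool)}
    (hw : IsCyclicallyReduced w) (hw' : IsCyclicallyReduced w')
    (he : FreeGroup.mk w' = g * FreeGroup.mk w * g⁻¹) : w ~r w' :=
  conj_rotated g.toWord isReduced_toWord hw hw' (by rw [mk_toWord]; exact he)

lemma norm_conj_ge {g : FreeGroup α} {w : List (α × Bool)} (hw : IsCyclicallyReduced w) :
    w.length ≤ (g * FreeGroup.mk w * g⁻¹).norm := by
  obtain ⟨h, V, hV, he, hl⟩ := exists_CR (g * FreeGroup.mk w * g⁻¹)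
  have : w ~r V := rotated_of_conj (g := h⁻¹ * g) hw hV (by
    rw [mul_inv_rev, inv_inv]
    calc FreeGroup.mk V = h⁻¹ * (h * FreeGroup.mk V * h⁻¹) * h := by group
      _ = _ := by rw [← he]; group)
  rw [this.perm.length_eq]; exact hl

/-- Powers of words. -/
def wpow (V : List (α × Bool)) (k : ℕ) : List (α × Bool) := (List.replicate k V).flatten

lemma mk_wpow (V : List (α × Bool)) (k : ℕ) : FreeGroup.mk (wpow V k) = FreeGroup.mk V ^ k := by
  induction k with
  | zero => simp [wpow, FreeGroup.one_eq_mk]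
  | succ k ih =>
    rw [wpow, List.replicate_succ, List.flatten_cons, mk_append, pow_succ', ← ih]; rfl

lemma length_wpow (V : List (α × Bool)) (k : ℕ) : (wpow V k).length = k * V.length := by
  simp [wpow]

lemma CR_wpow {V : List (α × Bool)} (h : IsCyclicallyReduced V) (k : ℕ) :
    IsCyclicallyReduced (wpow V k) := h.flatten_replicate k

lemma le_norm_pow {b : FreeGroup α} (hb : b ≠ 1) (k : ℕ) : k ≤ (b ^ k).norm := by
  obtain ⟨h, V, hV, he, _⟩ := exists_CR b
  have hV0 : V ≠ [] := by
    rintro rfl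
    apply hb; rw [he, ← FreeGroup.one_eq_mk]; simp
  have h1 := norm_conj_ge (g := h) (CR_wpow hV k)
  rw [mk_wpow, length_wpow, ← conj_pow, ← he] at h1
  have : 0 < V.length := List.length_pos_iff.2 hV0
  exact (Nat.le_mul_of_pos_right k this).trans h1

/-- Primitive elements of a group. -/
def Prim {G : Type*} [Group G] (v : G) : Prop := v ≠ 1 ∧ ¬ ∃ (b : G) (k : ℕ), 2 ≤ k ∧ v = b ^ k

lemma Prim.conj {G : Type*} [Group G] {v : G} (h : Prim v) (g : G) : Prim (g * v * g⁻¹) := by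
  refine ⟨fun h0 => h.1 (by simpa using h0), ?_⟩
  rintro ⟨b, k, hk, he⟩
  refine h.2 ⟨g⁻¹ * b * g, k, hk, ?_⟩
  have := conj_pow (i := k) (a := g⁻¹) (b := b)
  rw [inv_inv] at this
  rw [this, ← he]; group

lemma exists_root {g : FreeGroup α} (hg : g ≠ 1) : ∃ v k, Prim v ∧ g = v ^ (k + 1) := by
  classical
  let Q : ℕ → Prop := fun k => ∃ b : FreeGroup α, g = b ^ (k + 1)
  have hb : ∀ k, Q k → k ≤ g.norm := by
    rintro k ⟨b, hb⟩
    have hb1 : b ≠ 1 := by rintro rfl; apply hg; rw [hb, one_pow]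
    have := le_norm_pow hb1 (k + 1)
    rw [← hb] at this; omega
  have h0 : Q 0 := ⟨g, by simp⟩
  obtain ⟨b, hb'⟩ := Nat.findGreatest_spec (P := Q) (Nat.zero_le g.norm) h0
  refine ⟨b, _, ⟨?_, ?_⟩, hb'⟩
  · rintro rfl; apply hg; rw [hb', one_pow]
  · rintro ⟨c, k, hk, rfl⟩
    set n := Nat.findGreatest Q g.norm with hn
    have hq : Q (k * (n + 1) - 1) := ⟨c, by
      rw [hb', ← pow_mul, Nat.sub_add_cancel (by nlinarith)]⟩
    have h1 := Nat.le_findGreatest (hb _ hq) hq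
    rw [← hn] at h1
    have : 2 * (n + 1) ≤ k * (n + 1) := Nat.mul_le_mul_right _ hk
    omega

lemma cyclic_of_comm (K : Subgroup (FreeGroup α)) (hK : ∀ x ∈ K, ∀ y ∈ K, x * y = y * x) :
    ∃ t ∈ K, ∀ x ∈ K, x ∈ Subgroup.zpowers t := by
  let e := IsFreeGroup.toFreeGroup K
  have hcomm : ∀ x y : FreeGroup (IsFreeGroup.Generators K), x * y = y * x := by
    intro x y
    apply e.symm.injective
    rw [_root_.map_mul, _root_.map_mul]
    exact Subtype.ext (hK _ (e.symm x).2 _ (e.symm y).2)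
  have hsub : Subsingleton (IsFreeGroup.Generators K) := by
    classical
    constructor
    intro x y
    by_contra hne
    have h1 := hcomm (FreeGroup.of x) (FreeGroup.of y)
    have h2 := eq_of_reduced (w := [(x, true), (y, true)]) (w' := [(y, true), (x, true)])
      (by simp [FreeGroup.IsReduced]) (by simp [FreeGroup.IsReduced]) (by
        simpa [FreeGroup.of, FreeGroup.mul_mk] using h1)
    simp at h2
    exact hne h2.1
  rcases isEmpty_or_nonempty (IsFreeGroup.Generators K) with hE | ⟨⟨x0⟩⟩
  · refine ⟨1, K.one_mem, fun x hx => ?_⟩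
    have : e ⟨x, hx⟩ = e 1 := Subsingleton.elim _ _
    have := e.injective this
    have : x = 1 := congrArg Subtype.val this
    rw [this]; exact Subgroup.one_mem _
  · refine ⟨(e.symm (FreeGroup.of x0)).1, (e.symm (FreeGroup.of x0)).2, fun x hx => ?_⟩
    have key : ∀ f : FreeGroup (IsFreeGroup.Generators K), ∃ n : ℤ, FreeGroup.of x0 ^ n = f := by
      intro f
      induction f using FreeGroup.induction_on with
      | C1 => exact ⟨0, by simp⟩
      | of y => exact ⟨1, by rw [Subsingleton.elim y x0]; simp⟩
      | inv_of y _ => exact ⟨-1, by rw [Subsingleton.elim y x0]; simp⟩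
      | mul a b ha hb =>
        obtain ⟨n, rfl⟩ := ha
        obtain ⟨m, rfl⟩ := hb
        exact ⟨n + m, zpow_add _ _ _⟩
    obtain ⟨n, hn⟩ := key (e ⟨x, hx⟩)
    refine Subgroup.mem_zpowers_iff.2 ⟨n, ?_⟩
    have : e.symm (FreeGroup.of x0) ^ n = ⟨x, hx⟩ := by
      rw [← _root_.map_zpow, hn, MulEquiv.symm_apply_apply]
    have := congrArg Subtype.val this
    simpa using this

lemma mem_zpowers_of_comm {g v : FreeGroup α} (hv : Prim v) (h : g * v = v * g) :
    g ∈ Subgroup.zpowers v := by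
  let K := Subgroup.closure ({g, v} : Set (FreeGroup α))
  have hK : ∀ x ∈ K, ∀ y ∈ K, x * y = y * x := by
    intro x hx y hy
    have hc : ∀ a ∈ ({g, v} : Set (FreeGroup α)), ∀ b ∈ ({g, v} : Set (FreeGroup α)),
        a * b = b * a := by
      rintro a (rfl | rfl) b (rfl | rfl) <;> simp [h]
    letI := Subgroup.closureCommGroupOfComm hc
    have := mul_comm (⟨x, hx⟩ : K) ⟨y, hy⟩
    exact congrArg Subtype.val this
  obtain ⟨t, ht, hall⟩ := cyclic_of_comm K hK
  obtain ⟨a, ha⟩ := Subgroup.mem_zpowers_iff.1 (hall g (Subgroup.subset_closure (by simp)))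
  obtain ⟨b, hb⟩ := Subgroup.mem_zpowers_iff.1 (hall v (Subgroup.subset_closure (by simp)))
  have hb0 : b ≠ 0 := by rintro rfl; exact hv.1 (by rw [← hb]; simp)
  have hb1 : b.natAbs < 2 := by
    by_contra hcon
    rcases Int.natAbs_eq b with h1 | h1
    · exact hv.2 ⟨t, b.natAbs, by omega, by rw [← hb, ← zpow_natCast, ← h1]⟩
    · refine hv.2 ⟨t⁻¹, b.natAbs, by omega, ?_⟩
      rw [← hb, ← zpow_natCast, inv_zpow', ← h1]
  have : b = 1 ∨ b = -1 := by omega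
  rcases this with rfl | rfl
  · rw [zpow_one] at hb; rw [← ha, hb]; exact Subgroup.mem_zpowers_iff.2 ⟨a, rfl⟩
  · refine Subgroup.mem_zpowers_iff.2 ⟨-a, ?_⟩
    rw [← hb, ← zpow_mul, ← ha]; congr 1; ring

lemma mem_zpowers_of_comm_pow {g v : FreeGroup α} (hv : Prim v) {j : ℕ}
    (h : g * v ^ (j + 1) = v ^ (j + 1) * g) : g ∈ Subgroup.zpowers v := by
  apply mem_zpowers_of_comm hv
  have h1 : (g * v * g⁻¹) ^ (j + 1) = v ^ (j + 1) := by rw [conj_pow, h]; group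
  have h2 := IsMulTorsionFree.pow_left_injective (M := FreeGroup α) (n := j + 1) (by omega) h1
  calc g * v = (g * v * g⁻¹) * g := by group
    _ = v * g := by rw [h2]

lemma root_unique {u v : FreeGroup α} (hu : Prim u) (hv : Prim v) {j m : ℕ}
    (h : u ^ (j + 1) = v ^ (m + 1)) : u = v ∧ j = m := by
  have h1 : u ∈ Subgroup.zpowers v := mem_zpowers_of_comm_pow hv (j := m) (by
    rw [← h, ← pow_succ, ← pow_succ'])
  have h2 : v ∈ Subgroup.zpowers u := mem_zpowers_of_comm_pow hu (j := j) (by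
    rw [h, ← pow_succ, ← pow_succ'])
  obtain ⟨a, ha⟩ := Subgroup.mem_zpowers_iff.1 h1
  have hinj : Function.Injective fun n : ℤ => v ^ n := injective_zpow_iff_not_isOfFinOrder.2 (by
    rw [isOfFinOrder_iff_pow_eq_one]
    rintro ⟨n, hn, h3⟩
    exact hv.1 (IsMulTorsionFree.pow_left_injective (M := FreeGroup α) (n := n) (by omega)
      (by simpa using h3)))
  have ha0 : a ≠ 0 := by rintro rfl; exact hu.1 (by rw [← ha]; simp)
  have ha1 : a.natAbs < 2 := by
    by_contra hcon
    rcases Int.natAbs_eq a with h1 | h1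
    · exact hu.2 ⟨v, a.natAbs, by omega, by rw [← ha, ← zpow_natCast, ← h1]⟩
    · refine hu.2 ⟨v⁻¹, a.natAbs, by omega, ?_⟩
      rw [← ha, ← zpow_natCast, inv_zpow', ← h1]
  have h3 : (a * ((j + 1 : ℕ) : ℤ)) = ((m + 1 : ℕ) : ℤ) := by
    apply hinj
    simp only
    rw [zpow_mul, ha, zpow_natCast, zpow_natCast, h]
  have h4 : a = 1 := by
    have : a = 1 ∨ a = -1 := by omega
    rcases this with h | h
    · exact h
    · rw [h] at h3; push_cast at h3; omega
  subst h4
  refine ⟨by rw [← ha]; simp, ?_⟩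
  push_cast at h3; omega

lemma rotate_inj_aux {V : List (α × Bool)} (hV : IsCyclicallyReduced V)
    (hP : Prim (FreeGroup.mk V)) (j : ℕ) {i i' : ℕ} (hii : i < i') (hi' : i' < V.length)
    (h : (wpow V (j + 1)).rotate i = (wpow V (j + 1)).rotate i') : False := by
  set X := wpow V (j + 1) with hX
  have hXl : V.length ≤ X.length := by rw [hX, length_wpow]; nlinarith
  have hrot : ∀ n ≤ X.length, FreeGroup.mk (X.rotate n) =
      (FreeGroup.mk (X.take n))⁻¹ * FreeGroup.mk X * FreeGroup.mk (X.take n) := by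
    intro n hn
    rw [List.rotate_eq_drop_append_take hn, mk_append]
    conv_rhs => rw [← List.take_append_drop n X, mk_append]
    simp only [List.take_append_drop]
    group
  have h1 := congrArg FreeGroup.mk h
  rw [hrot i (by omega), hrot i' (by omega)] at h1
  set y := (X.take i').drop i with hy
  have hsplit : X.take i' = X.take i ++ y := by
    conv_lhs => rw [← List.take_append_drop i (X.take i')]
    rw [List.take_take, min_eq_left hii.le]
  rw [hsplit, mk_append, hX, mk_wpow] at h1
  rw [← hX] at h1
  set A := FreeGroup.mk (X.take i) with hA
  set b := FreeGroup.mk y with hb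
  set v := FreeGroup.mk V with hv
  have h2 : (A * b * A⁻¹) ∈ Subgroup.zpowers v := mem_zpowers_of_comm_pow hP (j := j) (by
    have : A * b * (A⁻¹ * v ^ (j + 1) * A) * A⁻¹ = v ^ (j + 1) * (A * b * A⁻¹) := by
      rw [h1]; group
    rw [← this]; group)
  obtain ⟨m, hm⟩ := Subgroup.mem_zpowers_iff.1 h2
  have hyr : IsReduced y := (CR_wpow hV (j + 1)).1.infix
    ((List.drop_suffix _ _).isInfix.trans (List.take_prefix _ _).isInfix)
  have hyl : y.length = i' - i := by
    rw [hy, List.length_drop, List.length_take]; omega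
  have hnb : b.norm = i' - i := by
    rw [hb, FreeGroup.norm, toWord_mk, hyr.reduce_eq, hyl]
  have hbm : b = A⁻¹ * v ^ m * A := by rw [hm]; group
  have key : ∀ n : ℕ, V.length * n ≤ (A⁻¹ * v ^ n * A).norm := by
    intro n
    have := norm_conj_ge (g := A⁻¹) (CR_wpow hV n)
    rw [length_wpow, mk_wpow, inv_inv] at this
    rw [mul_comm]; exact this
  have hm0 : m.natAbs = 0 := by
    have : V.length * m.natAbs ≤ b.norm := by
      rcases Int.natAbs_eq m with h3 | h3
      · have := key m.natAbs
        rwa [← zpow_natCast, ← h3, ← hbm] at this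
      · have := key m.natAbs
        rw [← FreeGroup.norm_inv_eq (x := b)]
        have e : b⁻¹ = A⁻¹ * v ^ m.natAbs * A := by
          rw [hbm, ← zpow_natCast, show ((m.natAbs : ℕ) : ℤ) = -m by omega]; group
        rwa [e]
    rw [hnb] at this
    by_contra hcon
    have : V.length * 1 ≤ V.length * m.natAbs := Nat.mul_le_mul_left _ (by omega)
    omega
  have hm1 : m = 0 := by omega
  rw [hm1] at hbm
  have : b = 1 := by rw [hbm]; group
  rw [this, FreeGroup.norm_one] at hnb
  omega

lemma rotate_inj {V : List (α × Bool)} (hV : IsCyclicallyReduced V)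
    (hP : Prim (FreeGroup.mk V)) (j : ℕ) {i i' : ℕ} (hi : i < V.length) (hi' : i' < V.length)
    (h : (wpow V (j + 1)).rotate i = (wpow V (j + 1)).rotate i') : i = i' := by
  rcases lt_trichotomy i i' with h1 | h1 | h1
  · exact (rotate_inj_aux hV hP j h1 hi' h).elim
  · exact h1
  · exact (rotate_inj_aux hV hP j h1 hi h.symm).elim

lemma rotate_lt {V : List (α × Bool)} (hV : V ≠ []) (j n : ℕ) :
    ∃ i < V.length, (wpow V (j + 1)).rotate n = (wpow V (j + 1)).rotate i := by
  have hp : 0 < V.length := List.length_pos_iff.2 hV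
  have hrV : (wpow V (j + 1)).rotate V.length = wpow V (j + 1) := by
    have h1 : wpow V (j + 1) = V ++ wpow V j := by
      simp [wpow, List.replicate_succ]
    have h2 : wpow V (j + 1) = wpow V j ++ V := by
      simp [wpow, List.replicate_succ']
    conv_lhs => rw [h1, List.rotate_append_length_eq]
    exact h2.symm
  refine ⟨n % V.length, Nat.mod_lt _ hp, ?_⟩
  conv_lhs => rw [← Nat.mod_add_div n V.length]
  have hall : ∀ k, (wpow V (j + 1)).rotate (V.length * k) = wpow V (j + 1) := by
    intro k
    induction k with
    | zero => simp
    | succ k ih => rw [Nat.mul_succ, ← List.rotate_rotate, ih, hrV]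
  rw [Nat.add_comm (n % V.length), ← List.rotate_rotate, hall]

lemma conj_mk_rotate (w : List (α × Bool)) (n : ℕ) :
    ∃ g, FreeGroup.mk (w.rotate n) = g * FreeGroup.mk w * g⁻¹ := by
  induction n generalizing w with
  | zero => exact ⟨1, by simp⟩
  | succ n ih =>
    cases w with
    | nil => exact ⟨1, by simp⟩
    | cons x w =>
      rw [List.rotate_cons_succ]
      obtain ⟨g, hg⟩ := ih (w ++ [x])
      refine ⟨g * (FreeGroup.mk [x])⁻¹, ?_⟩
      rw [hg, mk_append, show x :: w = [x] ++ w from rfl, mk_append]; group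

end FG

end Fred

end

noncomputable section

set_option linter.unusedSectionVars false

open Filter Topology
open scoped Matrix

namespace Fred

namespace Par

variable (p : Par)

lemma adm_iff (i : Let) (w : List Let) : p.sys.Adm i w ↔ FreeGroup.IsReduced (i :: w) := by
  induction w generalizing i with
  | nil => simp [Sys.Adm]
  | cons j w ih => rw [Sys.Adm, ih, FreeGroup.isReduced_cons_cons]; rfl

lemma r_pos (i : Let) : 0 < p.sys.r i := p.sys.hr i

/-- Cone over a disc. -/
def Cone (j : Let) (v : Fin 2 → ℝ) : Prop := |v 0 - p.z j * v 1| ≤ p.sys.r j * |v 1|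

/-- Width of the fundamental cone. -/
def wid (j : Let) : ℝ := (p.c - 1) * p.sys.r j

lemma wid_pos (j : Let) : 0 < p.wid j := mul_pos (by linarith [p.hc]) (p.r_pos j)

/-- The central cone. -/
def CJ (v : Fin 2 → ℝ) : Prop := ∀ j, |v 0| < p.wid j * |v 1|

lemma abs_z (j : Let) : |p.z j| = p.wid j + p.sys.r j := by
  have hc : 0 < p.c := by linarith [p.hc]
  have h1 : |p.z j| = p.c * p.sys.r j := by
    show |-(sg j.2 * p.c / (p.kap j.1 * p.s))| = p.c * (1 / (|p.kap j.1| * p.s))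
    rw [abs_neg, abs_div, abs_mul, abs_mul, abs_sg, abs_of_pos hc, abs_of_pos p.hs]; ring
  rw [h1, wid]; ring

lemma cone_step {j : Let} {v : Fin 2 → ℝ} (h : p.sys.r j * |v 1| ≤ |v 0 + p.z j * v 1|) :
    p.Cone j (p.M j *ᵥ v) := by
  have hs := p.hs
  have hk := p.kap_ne j.1
  have hk' := abs_pos.2 hk
  have h1 := sg_sq j.2
  have e0 : (p.M j *ᵥ v) 0 - p.z j * (p.M j *ᵥ v) 1 = sg j.2 * v 1 / (p.kap j.1 * p.s) := by
    simp [M, z, Matrix.mulVec, dotProduct, Fin.sum_univ_two]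
    field_simp
    linear_combination (-(v 0 * p.kap j.1 * p.c * p.s)) * h1 + (sg j.2 * v 1 ) * p.hcs
  have e1 : (p.M j *ᵥ v) 1 = -(sg j.2 * (p.kap j.1 * p.s)) * (v 0 + p.z j * v 1) := by
    simp [M, z, Matrix.mulVec, dotProduct, Fin.sum_univ_two]
    field_simp
    linear_combination (-(v 1 * p.c)) * h1
  have hr : p.sys.r j = 1 / (|p.kap j.1| * p.s) := rfl
  have hrk : p.sys.r j * (|p.kap j.1| * p.s) = 1 := by rw [hr]; field_simp
  unfold Cone
  rw [e0, e1]
  simp only [abs_div, abs_mul, abs_neg, abs_sg, abs_of_pos hs, one_mul]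
  rw [← mul_assoc, hrk, one_mul]
  refine le_trans (le_of_eq ?_) h
  rw [hr]; ring

lemma cone_CJ {j : Let} {v : Fin 2 → ℝ} (h : p.CJ v) : p.Cone j (p.M j *ᵥ v) := by
  apply cone_step
  have h1 := h j
  have h2 : |p.z j * v 1| ≤ |v 0 + p.z j * v 1| + |v 0| := by
    have := abs_sub (v 0 + p.z j * v 1) (v 0)
    simpa using this
  rw [abs_mul, abs_z] at h2
  nlinarith

lemma cone_adm {i j : Let} (hij : adm i j) {v : Fin 2 → ℝ} (h : p.Cone i v) :
    p.Cone j (p.M j *ᵥ v) := by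
  apply cone_step
  unfold Cone at h
  have hs := p.hs
  have hki := p.kap_ne i.1
  have hkj := p.kap_ne j.1
  have hki' := abs_pos.2 hki
  have hkj' := abs_pos.2 hkj
  have hc : 0 < p.c := by linarith [p.hc]
  have hz : |p.z i + p.z j| = p.sys.r j * (p.c * |p.om i j|) := by
    have h1 := sg_sq j.2
    have : p.z i + p.z j = -(sg j.2 * (1 / (p.kap j.1 * p.s)) * (p.c * p.om i j)) := by
      simp only [z, om]
      field_simp
      linear_combination (p.kap j.1 * sg i.2) * h1
    rw [this, abs_neg, abs_mul, abs_mul, abs_sg, abs_mul p.c, abs_of_pos hc, abs_div, abs_mul,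
      abs_of_pos hs, abs_one, one_mul]; rfl
  have hk := p.adm_key hij
  have hr : p.sys.r j * (1 + |p.kap j.1 / p.kap i.1|) = p.sys.r j + p.sys.r i := by
    show 1 / (|p.kap j.1| * p.s) * (1 + |p.kap j.1 / p.kap i.1|)
      = 1 / (|p.kap j.1| * p.s) + 1 / (|p.kap i.1| * p.s)
    rw [abs_div]; field_simp
  have hlt : p.sys.r j + p.sys.r i ≤ |p.z i + p.z j| := by
    rw [hz, ← hr]; exact mul_le_mul_of_nonneg_left hk.le (p.r_pos j).le
  have h2 : |(p.z i + p.z j) * v 1| ≤ |v 0 + p.z j * v 1| + |v 0 - p.z i * v 1| := by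
    have := abs_sub (v 0 + p.z j * v 1) (v 0 - p.z i * v 1)
    refine le_trans (le_of_eq ?_) this
    congr 1; ring
  rw [abs_mul] at h2
  have := mul_le_mul_of_nonneg_right hlt (abs_nonneg (v 1))
  linarith

lemma cone_word {i : Let} {w : List Let} (hw : p.sys.Adm i w) {v : Fin 2 → ℝ} (h : p.Cone i v) :
    p.Cone (Sys.last i w) (p.Mw w *ᵥ v) := by
  induction w generalizing i v with
  | nil => simpa [Mw, Sys.last] using h
  | cons j w ih =>
    rw [Mw, ← Matrix.mulVec_mulVec]
    exact ih hw.2 (p.cone_adm hw.1 h)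

lemma cone_disj {j : Let} {v : Fin 2 → ℝ} (h : p.CJ v) (h' : p.Cone j v) : False := by
  have h1 := h j
  unfold Cone at h'
  have h2 : |p.z j * v 1| ≤ |v 0| + |v 0 - p.z j * v 1| := by
    have := abs_sub (v 0) (v 0 - p.z j * v 1)
    simpa using this
  rw [abs_mul, abs_z] at h2
  nlinarith

lemma rho_CJ {g : FreeGroup Bool} (hg : g ≠ 1) {v : Fin 2 → ℝ} (h : p.CJ v) :
    ¬ p.CJ ((p.rho g).1 *ᵥ v) := by
  have hr : FreeGroup.IsReduced (g⁻¹).toWord := FreeGroup.isReduced_toWord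
  have hM := p.Mw_eq (g⁻¹).toWord
  rw [FreeGroup.mk_toWord, map_inv, inv_inv] at hM
  rw [← hM]
  have hne : (g⁻¹).toWord ≠ [] := fun h0 => hg (by rw [FreeGroup.toWord_eq_nil_iff] at h0; simpa using h0)
  revert hr hne
  generalize (g⁻¹).toWord = w
  intro hr hne
  cases w with
  | nil => exact absurd rfl hne
  | cons j w =>
    intro h2
    rw [Mw, ← Matrix.mulVec_mulVec] at h2
    exact p.cone_disj h2 (p.cone_word ((p.adm_iff j w).2 hr) (p.cone_CJ h))

lemma rho_injective : Function.Injective p.rho := by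
  rw [injective_iff_map_eq_one]
  intro g hg
  by_contra hne
  have hv : p.CJ ![0, 1] := fun j => by simpa using p.wid_pos j
  have := p.rho_CJ hne hv
  rw [hg] at this
  apply this
  simpa using hv

/-- Entry sum. -/
def T (A : Matrix (Fin 2) (Fin 2) ℝ) : ℝ := |A 0 0| + |A 0 1| + |A 1 0| + |A 1 1|

lemma T_pos {A : Matrix (Fin 2) (Fin 2) ℝ} (h : A.det = 1) : 0 < T A := by
  unfold T
  rw [Matrix.det_fin_two] at h
  by_contra hn
  have h0 := abs_nonneg (A 0 0)
  have h1 := abs_nonneg (A 0 1)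
  have h2 := abs_nonneg (A 1 0)
  have h3 := abs_nonneg (A 1 1)
  have e0 : A 0 0 = 0 := abs_eq_zero.1 (by linarith)
  have e1 : A 0 1 = 0 := abs_eq_zero.1 (by linarith)
  rw [e0, e1] at h; norm_num at h

/-- Truncated central cone. -/
def BJ : Set (Fin 2 → ℝ) := {v | p.CJ v ∧ |v 1| < 1 ∧ |v 0| < 1}

lemma isOpen_BJ : IsOpen p.BJ := by
  have h1 : p.BJ = (⋂ j, {v : Fin 2 → ℝ | |v 0| < p.wid j * |v 1|}) ∩
      ({v | |v 1| < 1} ∩ {v | |v 0| < 1}) := by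
    ext v; simp [BJ, CJ]
  rw [h1]
  refine IsOpen.inter (isOpen_iInter_of_finite fun j => isOpen_lt (by fun_prop) (by fun_prop)) ?_
  exact (isOpen_lt (by fun_prop) (by fun_prop)).inter (isOpen_lt (by fun_prop) (by fun_prop))

lemma nonempty_BJ : p.BJ.Nonempty := by
  refine ⟨![0, 1/2], fun j => ?_, ?_, ?_⟩
  · have := p.wid_pos j
    simp
    positivity
  · simp [abs_of_pos]; norm_num
  · simp

/-- Scaled linear map. -/
def scl (g : FreeGroup Bool) : (Fin 2 → ℝ) →ₗ[ℝ] (Fin 2 → ℝ) :=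
  (T (p.rho g).1)⁻¹ • Matrix.toLin' (p.rho g).1

lemma CJ_smul {v : Fin 2 → ℝ} {t : ℝ} (ht : t ≠ 0) : p.CJ (t • v) ↔ p.CJ v := by
  have ht' := abs_pos.2 ht
  unfold CJ
  refine forall_congr' fun j => ?_
  simp only [Pi.smul_apply, smul_eq_mul, abs_mul]
  rw [mul_left_comm, mul_lt_mul_iff_right₀ ht']

lemma scl_disj {g h : FreeGroup Bool} (hgh : g ≠ h) :
    Disjoint (p.scl g '' p.BJ) (p.scl h '' p.BJ) := by
  rw [Set.disjoint_left]
  rintro _ ⟨v, hv, rfl⟩ ⟨u, hu, he⟩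
  have hg := inv_ne_zero (T_pos (p.rho g).2).ne'
  have hh := inv_ne_zero (T_pos (p.rho h).2).ne'
  simp only [scl, LinearMap.smul_apply, Matrix.toLin'_apply] at he
  have hne : g⁻¹ * h ≠ 1 := fun h0 => hgh (by rw [inv_mul_eq_one] at h0; exact h0)
  apply p.rho_CJ hne hu.1
  rw [map_mul, map_inv, Matrix.SpecialLinearGroup.coe_mul, ← Matrix.mulVec_mulVec,
    ← p.CJ_smul hh, ← Matrix.mulVec_smul, he, Matrix.mulVec_smul, p.CJ_smul hg,
    Matrix.mulVec_mulVec, ← Matrix.SpecialLinearGroup.coe_mul, inv_mul_cancel]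
  simpa using hv.1

lemma scl_ball (g : FreeGroup Bool) : p.scl g '' p.BJ ⊆ Metric.closedBall 0 1 := by
  rintro _ ⟨v, hv, rfl⟩
  have hT := T_pos (p.rho g).2
  rw [mem_closedBall_zero_iff, pi_norm_le_iff_of_nonneg zero_le_one]
  obtain ⟨-, h1, h0⟩ := hv
  intro x
  simp only [scl, LinearMap.smul_apply, Matrix.toLin'_apply, Pi.smul_apply, smul_eq_mul,
    Real.norm_eq_abs, abs_mul, abs_inv, abs_of_pos hT]
  rw [inv_mul_le_iff₀ hT, mul_one]
  simp only [Matrix.mulVec, dotProduct, Fin.sum_univ_two]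
  refine (abs_add_le _ _).trans ?_
  rw [abs_mul, abs_mul]
  have e0 := mul_le_of_le_one_right (abs_nonneg ((p.rho g).1 x 0)) h0.le
  have e1 := mul_le_of_le_one_right (abs_nonneg ((p.rho g).1 x 1)) h1.le
  unfold T
  have a0 := abs_nonneg ((p.rho g).1 0 0)
  have a1 := abs_nonneg ((p.rho g).1 0 1)
  have a2 := abs_nonneg ((p.rho g).1 1 0)
  have a3 := abs_nonneg ((p.rho g).1 1 1)
  fin_cases x <;> simp only [Fin.zero_eta, Fin.mk_one] at e0 e1 ⊢ <;> linarith

lemma scl_det (g : FreeGroup Bool) : LinearMap.det (p.scl g) = (T (p.rho g).1)⁻¹ ^ 2 := by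
  rw [scl, LinearMap.det_smul, LinearMap.det_toLin', (p.rho g).2]; simp

open MeasureTheory in
theorem summable_T : Summable fun g : FreeGroup Bool => (T (p.rho g).1)⁻¹ ^ 2 := by
  have hvol : ∀ g, volume (p.scl g '' p.BJ) =
      ENNReal.ofReal ((T (p.rho g).1)⁻¹ ^ 2) * volume p.BJ := fun g => by
    rw [Measure.addHaar_image_linearMap, scl_det, abs_of_nonneg (by positivity)]
  have hmeas : ∀ g, MeasurableSet (p.scl g '' p.BJ) := fun g => by
    have hdet : LinearMap.det (p.scl g) ≠ 0 := by
      rw [scl_det]; exact pow_ne_zero _ (inv_ne_zero (T_pos (p.rho g).2).ne')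
    have hinj : Function.Injective (p.scl g) :=
      (LinearMap.equivOfDetNeZero _ hdet).injective
    exact p.isOpen_BJ.measurableSet.image_of_continuousOn_injOn
      (LinearMap.continuous_of_finiteDimensional _).continuousOn hinj.injOn
  have h1 : ∑' g, volume (p.scl g '' p.BJ) ≤ volume (Metric.closedBall (0 : Fin 2 → ℝ) 1) := by
    refine (tsum_meas_le_meas_iUnion_of_disjoint volume hmeas fun g h hgh => p.scl_disj hgh).trans ?_
    exact measure_mono (Set.iUnion_subset fun g => p.scl_ball g)
  have h2 : ∑' g, ENNReal.ofReal ((T (p.rho g).1)⁻¹ ^ 2) * volume p.BJ ≠ ⊤ := by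
    simp_rw [← hvol]
    exact (h1.trans_lt (isCompact_closedBall _ _).measure_lt_top).ne
  rw [ENNReal.tsum_mul_right] at h2
  have h3 : volume p.BJ ≠ 0 := (p.isOpen_BJ.measure_pos volume p.nonempty_BJ).ne'
  have h4 : ∑' g, ENNReal.ofReal ((T (p.rho g).1)⁻¹ ^ 2) ≠ ⊤ := fun h => by
    rw [h, ENNReal.top_mul h3] at h2; exact h2 rfl
  exact (ENNReal.summable_toReal h4).congr fun g => ENNReal.toReal_ofReal (by positivity)

end Par

end Fred

end

noncomputable section

set_option linter.unusedSectionVars false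

open Filter Topology
open scoped Matrix

namespace Fred

namespace Par

variable (p : Par)

lemma norm_phi_le_theta {q0 : ℝ} (hq0 : 1 < q0) (hq : ∀ i j, p.sys.adm i j → q0 ≤ p.sys.q i j)
    {i : Let} {w : List Let} (h : p.sys.Adm i w) (hw : w ≠ []) {u : ℂ} (hu : ‖u‖ ≤ 1) :
    ‖p.sys.phi i w u‖ ≤ q0⁻¹ := by
  induction w generalizing i u with
  | nil => exact absurd rfl hw
  | cons j w ih =>
    cases w with
    | nil =>
      show ‖p.sys.phi1 i j u‖ ≤ q0⁻¹
      unfold Sys.phi1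
      rw [norm_div, Complex.norm_real, Real.norm_eq_abs, p.sys.he, one_div]
      have h1 := hq i j h.1
      have h2 := p.sys.norm_le_AB h.1 hu
      have h3 := Complex.re_le_norm ((p.sys.A i j : ℂ) + p.sys.B i j * u)
      refine inv_anti₀ (by linarith) (h1.trans (le_trans ?_ h3))
      exact h2
    | cons k w => exact ih h.2 (by simp) (p.sys.norm_phi1_lt h.1 hu).le

lemma N_bound {q0 : ℝ} (hq0 : 1 < q0) (hq : ∀ i j, p.sys.adm i j → q0 ≤ p.sys.q i j)
    {i : Let} {w : List Let} (h : p.sys.Adm i w) (hw : w ≠ []) :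
    T (p.sys.N i w) * (1 - q0⁻¹) ≤ 4 * |(p.sys.N i w).trace| := by
  have hθ : 0 < 1 - q0⁻¹ := sub_pos.2 (inv_lt_one_of_one_lt₀ hq0)
  have hθ1 : 0 < q0⁻¹ := inv_pos.2 (by linarith)
  set n := p.sys.N i w with hn
  have key : ∀ x : ℝ, |x| ≤ 1 → |n 0 0 * x + n 0 1| ≤ q0⁻¹ * |n 1 0 * x + n 1 1| ∧
      n 1 0 * x + n 1 1 ≠ 0 := by
    intro x hx
    have hx' : ‖(x : ℂ)‖ ≤ 1 := by rw [Complex.norm_real]; exact hx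
    obtain ⟨h1, h2⟩ := p.sys.N_apply h hx'
    have h3 := p.sys.den_ne h hx'
    have h4 := p.norm_phi_le_theta hq0 hq h hw hx'
    rw [← h2] at h1 h3
    constructor
    · have h5 : ‖((n 0 0 * x + n 0 1 : ℝ) : ℂ)‖ ≤ q0⁻¹ * ‖((n 1 0 * x + n 1 1 : ℝ) : ℂ)‖ := by
        push_cast
        rw [h1, norm_mul, mul_comm]
        exact mul_le_mul_of_nonneg_right h4 (norm_nonneg _)
      rwa [Complex.norm_real, Complex.norm_real] at h5
    · exact_mod_cast h3
  have hlt : |n 1 0| < |n 1 1| := by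
    by_contra hge
    rw [not_lt] at hge
    by_cases h0 : n 1 0 = 0
    · have : n 1 1 = 0 := by rw [h0, abs_zero] at hge; exact abs_eq_zero.1 (le_antisymm hge (abs_nonneg _))
      exact (key 0 (by simp)).2 (by simp [this])
    · refine (key (-(n 1 1) / n 1 0) ?_).2 ?_
      · rw [abs_div, abs_neg]; exact div_le_one_of_le₀ hge (abs_nonneg _)
      · field_simp; ring
  have k0 := (key 0 (by simp)).1
  have k1 := (key 1 (by simp)).1
  have k2 := (key (-1) (by simp)).1
  simp only [mul_zero, zero_add, mul_one, mul_neg] at k0 k1 k2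
  have h5 : |n 1 0 + n 1 1| + |-n 1 0 + n 1 1| = 2 * |n 1 1| := by
    rcases abs_cases (n 1 0) with h | h <;> rcases abs_cases (n 1 1) with h' | h' <;>
      rcases abs_cases (n 1 0 + n 1 1) with h1 | h1 <;> rcases abs_cases (-n 1 0 + n 1 1) with h2 | h2 <;>
      linarith
  have h6 : 2 * |n 0 0| ≤ |n 0 0 + n 0 1| + |-n 0 0 + n 0 1| := by
    have := abs_sub (n 0 0 + n 0 1) (-n 0 0 + n 0 1)
    rw [show n 0 0 + n 0 1 - (-n 0 0 + n 0 1) = 2 * n 0 0 by ring, abs_mul, abs_two] at this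
    exact this
  have h7 : |n 0 0| ≤ q0⁻¹ * |n 1 1| := by nlinarith
  have h8 : |n 1 1| ≤ |n.trace| + |n 0 0| := by
    rw [Matrix.trace_fin_two]
    have := abs_sub (n 0 0 + n 1 1) (n 0 0)
    simpa using this
  have h9 : |n 1 1| * (1 - q0⁻¹) ≤ |n.trace| := by nlinarith
  have h10 : T n ≤ 4 * |n 1 1| := by
    unfold T
    have : q0⁻¹ * |n 1 1| ≤ |n 1 1| := by nlinarith [abs_nonneg (n 1 1)]
    linarith
  nlinarith

lemma T_nonneg (A : Matrix (Fin 2) (Fin 2) ℝ) : 0 ≤ T A := by unfold T; positivity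

lemma T_mul (A B : Matrix (Fin 2) (Fin 2) ℝ) : T (A * B) ≤ T A * T B := by
  have e : ∀ x y, |(A * B) x y| ≤ |A x 0| * |B 0 y| + |A x 1| * |B 1 y| := fun x y => by
    rw [Matrix.mul_apply, Fin.sum_univ_two, ← abs_mul, ← abs_mul]; exact abs_add_le _ _
  have h1 := e 0 0
  have h2 := e 0 1
  have h3 := e 1 0
  have h4 := e 1 1
  unfold T
  have : 0 ≤ |A 0 0| * |B 1 0| + |A 0 0| * |B 1 1| + |A 0 1| * |B 0 0| + |A 0 1| * |B 0 1| +
    |A 1 0| * |B 1 0| + |A 1 0| * |B 1 1| + |A 1 1| * |B 0 0| + |A 1 1| * |B 0 1| := by positivity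
  linarith

lemma T_smul (t : ℝ) (A : Matrix (Fin 2) (Fin 2) ℝ) : T (t • A) = |t| * T A := by
  simp [T, abs_mul]; ring

lemma T_inv (A : Matrix.SpecialLinearGroup (Fin 2) ℝ) : T (A⁻¹).1 = T A.1 := by
  rw [Matrix.SpecialLinearGroup.coe_inv, Matrix.adjugate_fin_two]
  simp [T]; ring

/-- Nonempty cyclically reduced words. -/
abbrev CRW : Type := {w : List Let // FreeGroup.IsCyclicallyReduced w ∧ w ≠ []}

lemma word_facts : ∃ δ C : ℝ, 0 < δ ∧ 0 < C ∧ ∀ w : List Let, FreeGroup.IsCyclicallyReduced w →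
    w ≠ [] → δ * w.length ≤ p.len w ∧
      |(p.rho (FreeGroup.mk w)).1.trace| = Real.exp (p.len w / 2) + (Real.exp (p.len w / 2))⁻¹ ∧
      T (p.rho (FreeGroup.mk w)).1 ≤ C * Real.exp (p.len w / 2) := by
  obtain ⟨q1, hq1, hqq⟩ := p.exists_q0
  obtain ⟨q0, hq0, hm⟩ := p.word_main
  have hθ : 0 < 1 - q1⁻¹ := sub_pos.2 (inv_lt_one_of_one_lt₀ hq1)
  obtain ⟨D, hD⟩ : ∃ D : ℝ, ∀ i, T (p.H i) * T (p.Hi i) ≤ D := by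
    obtain ⟨x, hx⟩ := Finite.exists_max fun i => T (p.H i) * T (p.Hi i)
    exact ⟨_, hx⟩
  have hD0 : 0 ≤ D := (mul_nonneg (T_nonneg _) (T_nonneg _)).trans (hD (true, true))
  refine ⟨2 * Real.log q0, D * (8 / (1 - q1⁻¹)) + 1, by have := Real.log_pos hq0; positivity,
    by positivity, fun w hw hne => ?_⟩
  obtain ⟨i, hl, ha⟩ := (p.closed_iff hne).2 hw
  obtain ⟨lam, h1, h2, h3, h4, h5, -⟩ := hm i w ha hne hl
  have hlam : 1 < lam := lt_of_lt_of_le (one_lt_pow₀ hq0 (by simpa using hne)) h1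
  have hl0 : 0 < lam := by linarith
  have hlen : p.len w = 2 * Real.log lam := by rw [len, geodLength, h2]
  have hexp : Real.exp (p.len w / 2) = lam := by
    rw [hlen, mul_div_cancel_left₀ _ two_ne_zero, Real.exp_log hl0]
  rw [hexp]
  refine ⟨?_, h3, ?_⟩
  · have := Real.log_le_log (by positivity) h1
    rw [Real.log_pow] at this
    rw [hlen]; nlinarith
  · have hb := p.N_bound hq1 hqq ha hne
    obtain ⟨t, ht, hM⟩ := p.Mw_closed hl
    have e1 : T (p.rho (FreeGroup.mk w)).1 = T (p.H i * p.sys.N i w * p.Hi i) := by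
      rw [← T_inv, ← Mw_eq, hM, T_smul, ht, one_mul]
    have e2 := T_mul (p.H i * p.sys.N i w) (p.Hi i)
    have e3 := T_mul (p.H i) (p.sys.N i w)
    have e4 := mul_le_mul_of_nonneg_right e3 (T_nonneg (p.Hi i))
    have hinv : lam⁻¹ ≤ lam := (inv_lt_one_of_one_lt₀ hlam).le.trans hlam.le
    have e5 : T (p.sys.N i w) ≤ 8 / (1 - q1⁻¹) * lam := by
      rw [div_mul_eq_mul_div, le_div_iff₀ hθ]
      refine hb.trans ?_
      rw [h5, abs_of_pos (by positivity)]; linarith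
    rw [e1]
    calc _ ≤ T (p.H i) * T (p.sys.N i w) * T (p.Hi i) := e2.trans e4
      _ = (T (p.H i) * T (p.Hi i)) * T (p.sys.N i w) := by ring
      _ ≤ D * (8 / (1 - q1⁻¹) * lam) := mul_le_mul (hD i) e5 (T_nonneg _) hD0
      _ ≤ _ := by nlinarith

theorem summable_exp_len : Summable fun w : CRW => Real.exp (-p.len w.1) := by
  obtain ⟨δ, C, hδ, hC, h⟩ := p.word_facts
  have hinj : Function.Injective fun w : CRW => FreeGroup.mk w.1 := fun w w' he =>
    Subtype.ext (FG.eq_of_reduced w.2.1.1 w'.2.1.1 he)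
  have h1 := (p.summable_T.comp_injective hinj).mul_left (C ^ 2)
  refine Summable.of_nonneg_of_le (fun _ => (Real.exp_pos _).le) (fun w => ?_) h1
  obtain ⟨-, -, h2⟩ := h w.1 w.2.1 w.2.2
  have hT : 0 < T (p.rho (FreeGroup.mk w.1)).1 := T_pos (p.rho _).2
  have h3 : Real.exp (-p.len w.1) = (Real.exp (p.len w.1 / 2))⁻¹ ^ 2 := by
    rw [← Real.exp_neg, ← Real.exp_nat_mul]; congr 1; push_cast; ring
  simp only [Function.comp]
  rw [h3, ← mul_pow]
  refine pow_le_pow_left₀ (by positivity) ?_ 2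
  rw [← div_eq_mul_inv, le_div_iff₀ hT, inv_mul_le_iff₀ (Real.exp_pos _), mul_comm]
  exact h2

end Par

end Fred

end

noncomputable section

set_option linter.unusedSectionVars false

open Filter Topology
open scoped Matrix

namespace Fred

namespace Par

variable (p : Par)

/-- Cyclically reduced. -/
abbrev CR (w : List Let) : Prop := FreeGroup.IsCyclicallyReduced w

lemma geodLength_of_trace {w : List Let} (hw : CR w) (hne : w ≠ [])
    {γ : Matrix.SpecialLinearGroup (Fin 2) ℝ} {l : ℝ} (hl : 0 ≤ l)
    (h : |γ.1.trace| = Real.exp (l / 2) + (Real.exp (l / 2))⁻¹) : geodLength γ = l := by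
  have h1 : 1 ≤ Real.exp (l / 2) := Real.one_le_exp (by linarith)
  rw [geodLength, spectralRad_eq γ.2 h1 h, Real.log_exp]; ring

lemma len_nonneg {w : List Let} (hw : CR w) (hne : w ≠ []) : 0 ≤ p.len w := by
  obtain ⟨δ, C, hδ, hC, h⟩ := p.word_facts
  exact le_trans (by positivity) (h w hw hne).1

lemma trace_len {w : List Let} (hw : CR w) (hne : w ≠ []) :
    |(p.rho (FreeGroup.mk w)).1.trace| = Real.exp (p.len w / 2) + (Real.exp (p.len w / 2))⁻¹ := by
  obtain ⟨δ, C, hδ, hC, h⟩ := p.word_facts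
  exact (h w hw hne).2.1

lemma trace_conj (γ g : Matrix.SpecialLinearGroup (Fin 2) ℝ) :
    (g * γ * g⁻¹).1.trace = γ.1.trace := by
  rw [Matrix.SpecialLinearGroup.coe_mul, Matrix.trace_mul_comm, ← Matrix.SpecialLinearGroup.coe_mul,
    ← mul_assoc, inv_mul_cancel, one_mul]

lemma geodLength_conj {w : List Let} (hw : CR w) (hne : w ≠ [])
    (g : Matrix.SpecialLinearGroup (Fin 2) ℝ) :
    geodLength (g * p.rho (FreeGroup.mk w) * g⁻¹) = p.len w := by
  apply geodLength_of_trace hw hne (p.len_nonneg hw hne)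
  rw [trace_conj, p.trace_len hw hne]

lemma len_rotate {w : List Let} (hw : CR w) (hne : w ≠ []) (n : ℕ) :
    p.len (w.rotate n) = p.len w := by
  obtain ⟨g, hg⟩ := FG.conj_mk_rotate w n
  conv_lhs => rw [len, hg, map_mul, map_mul, map_inv]
  exact p.geodLength_conj hw hne _

lemma trace_pow (A : Matrix (Fin 2) (Fin 2) ℝ) (hdet : A.det = 1) {x : ℝ} (hx : x ≠ 0)
    (htr : A.trace = x + x⁻¹) (k : ℕ) : (A ^ k).trace = x ^ k + x⁻¹ ^ k := by
  have hCH : A * A = A.trace • A - 1 := by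
    rw [Matrix.det_fin_two] at hdet
    ext i j
    fin_cases i <;> fin_cases j <;>
      simp [Matrix.mul_apply, Fin.sum_univ_two, Matrix.trace_fin_two] <;>
      first | linear_combination -hdet | ring
  have key : ∀ k, (A ^ k).trace = x ^ k + x⁻¹ ^ k ∧ (A ^ (k + 1)).trace = x ^ (k + 1) + x⁻¹ ^ (k + 1) := by
    intro k
    induction k with
    | zero => simp [Matrix.trace_one, htr]; norm_num
    | succ k ih =>
      refine ⟨ih.2, ?_⟩
      have h1 : A ^ (k + 1 + 1) = A.trace • A ^ (k + 1) - A ^ k := by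
        rw [pow_succ, pow_succ, mul_assoc, hCH, mul_sub, mul_one, Matrix.mul_smul]
      rw [h1, Matrix.trace_sub, Matrix.trace_smul, ih.1, ih.2, htr, smul_eq_mul]
      have hxx : x * x⁻¹ = 1 := mul_inv_cancel₀ hx
      linear_combination (x ^ k + x⁻¹ ^ k) * hxx
  exact (key k).1

lemma wpow_ne {V : List Let} (hV : V ≠ []) (k : ℕ) : FG.wpow V (k + 1) ≠ [] := by
  rw [← List.length_pos_iff, FG.length_wpow]
  have := List.length_pos_iff.2 hV
  positivity

lemma len_wpow {V : List Let} (hV : CR V) (hne : V ≠ []) (k : ℕ) :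
    p.len (FG.wpow V (k + 1)) = (k + 1) * p.len V := by
  have h1 := p.trace_len hV hne
  have h0 := p.len_nonneg hV hne
  set l := p.len V
  have hpos := Real.exp_pos (l / 2)
  obtain ⟨t, ht, htt⟩ : ∃ t : ℝ, |t| = 1 ∧ (p.rho (FreeGroup.mk V)).1.trace
      = t * Real.exp (l / 2) + (t * Real.exp (l / 2))⁻¹ := by
    rcases abs_choice (p.rho (FreeGroup.mk V)).1.trace with h | h
    · exact ⟨1, by simp, by rw [one_mul, ← h1, h]⟩
    · refine ⟨-1, by simp, ?_⟩
      rw [mul_inv, show ((-1 : ℝ))⁻¹ = -1 by norm_num]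
      linarith
  have ht0 : t ≠ 0 := by rintro rfl; simp at ht
  have h2 := trace_pow (p.rho (FreeGroup.mk V)).1 (p.rho _).2 (mul_ne_zero ht0 hpos.ne') htt (k + 1)
  have h3 : (p.rho (FreeGroup.mk (FG.wpow V (k + 1)))).1 = (p.rho (FreeGroup.mk V)).1 ^ (k + 1) := by
    rw [FG.mk_wpow, map_pow, Matrix.SpecialLinearGroup.coe_pow]
  have htt2 : t * t = 1 := by rw [← abs_mul_abs_self, ht]; norm_num
  have htinv : t⁻¹ = t := by rw [inv_eq_iff_eq_inv, eq_comm]; exact (eq_inv_of_mul_eq_one_left htt2).symm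
  have hk : ((k : ℝ) + 1) * l / 2 = ((k + 1 : ℕ) : ℝ) * (l / 2) := by push_cast; ring
  apply geodLength_of_trace hV hne (by positivity)
  rw [h3, h2, mul_inv, htinv, mul_pow, mul_pow, ← mul_add, abs_mul, abs_pow, ht, one_pow, one_mul,
    hk, Real.exp_nat_mul, inv_pow, abs_of_pos (by positivity)]

/-- The image group. -/
abbrev Gam : Subgroup (Matrix.SpecialLinearGroup (Fin 2) ℝ) := p.rho.range

lemma prim_iff (g : FreeGroup Bool) : IsPrimitive p.Gam (p.rho g) ↔ FG.Prim g := by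
  constructor
  · rintro ⟨-, h1, h2⟩
    refine ⟨fun h => h1 (by rw [h, map_one]), ?_⟩
    rintro ⟨b, k, hk, he⟩
    exact h2 ⟨p.rho b, ⟨b, rfl⟩, k, hk, by rw [he, map_pow]⟩
  · rintro ⟨h1, h2⟩
    refine ⟨⟨g, rfl⟩, fun h => h1 (p.rho_injective (by rw [h, map_one])), ?_⟩
    rintro ⟨_, ⟨b, rfl⟩, k, hk, he⟩
    exact h2 ⟨b, k, hk, p.rho_injective (by rw [he, map_pow])⟩

lemma conjRel_equiv (Γ : Subgroup (Matrix.SpecialLinearGroup (Fin 2) ℝ)) :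
    Equivalence (ConjRel Γ) where
  refl x := ⟨1, Γ.one_mem, by simp⟩
  symm := by
    rintro x y ⟨g, hg, he⟩
    exact ⟨g⁻¹, Γ.inv_mem hg, by rw [he]; group⟩
  trans := by
    rintro x y z ⟨g, hg, he⟩ ⟨h, hh, he'⟩
    exact ⟨h * g, Γ.mul_mem hh hg, by rw [he', he]; group⟩

lemma quot_eq {Γ : Subgroup (Matrix.SpecialLinearGroup (Fin 2) ℝ)}
    {x y : {γ : Matrix.SpecialLinearGroup (Fin 2) ℝ // IsPrimitive Γ γ}}
    (h : Quot.mk (ConjRel Γ) x = Quot.mk (ConjRel Γ) y) : ConjRel Γ x y :=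
  (conjRel_equiv Γ).eqvGen_iff.1 (Quot.eqvGen_exact h)

/-- Class of a primitive element of the free group. -/
def cls (g : FreeGroup Bool) (hg : FG.Prim g) : PrimConjClasses p.Gam :=
  Quot.mk _ ⟨p.rho g, (p.prim_iff g).2 hg⟩

lemma cls_eq_iff {g h : FreeGroup Bool} (hg : FG.Prim g) (hh : FG.Prim h) :
    p.cls g hg = p.cls h hh ↔ ∃ x, h = x * g * x⁻¹ := by
  constructor
  · intro he
    obtain ⟨_, ⟨x, rfl⟩, h1⟩ := quot_eq he
    exact ⟨x, p.rho_injective (by rw [map_mul, map_mul, map_inv]; exact h1)⟩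
  · rintro ⟨x, rfl⟩
    exact Quot.sound ⟨p.rho x, ⟨x, rfl⟩, by simp only [map_mul, map_inv]⟩

lemma exists_rep (c : PrimConjClasses p.Gam) : ∃ V : List Let, CR V ∧ V ≠ [] ∧
    ∃ h : FG.Prim (FreeGroup.mk V), p.cls (FreeGroup.mk V) h = c := by
  obtain ⟨⟨γ, hγ⟩, rfl⟩ := Quot.exists_rep c
  obtain ⟨g, rfl⟩ := hγ.1
  have hP := (p.prim_iff g).1 hγ
  obtain ⟨h, V, hV, he, -⟩ := FG.exists_CR g
  have hPV : FG.Prim (FreeGroup.mk V) := by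
    have := hP.conj h⁻¹
    rwa [he, show h⁻¹ * (h * FreeGroup.mk V * h⁻¹) * h⁻¹⁻¹ = FreeGroup.mk V by group] at this
  refine ⟨V, hV, ?_, hPV, ?_⟩
  · rintro rfl
    exact hPV.1 FreeGroup.one_eq_mk.symm
  · exact (p.cls_eq_iff hPV hP).2 ⟨h, he⟩

/-- Representative word. -/
def V (c : PrimConjClasses p.Gam) : List Let := (p.exists_rep c).choose

lemma V_CR (c : PrimConjClasses p.Gam) : CR (p.V c) := (p.exists_rep c).choose_spec.1
lemma V_ne (c : PrimConjClasses p.Gam) : p.V c ≠ [] := (p.exists_rep c).choose_spec.2.1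
lemma V_prim (c : PrimConjClasses p.Gam) : FG.Prim (FreeGroup.mk (p.V c)) :=
  (p.exists_rep c).choose_spec.2.2.choose
lemma V_cls (c : PrimConjClasses p.Gam) : p.cls (FreeGroup.mk (p.V c)) (p.V_prim c) = c :=
  (p.exists_rep c).choose_spec.2.2.choose_spec

lemma classLength_eq (c : PrimConjClasses p.Gam) : classLength p.Gam c = p.len (p.V c) := by
  have : {r : ℝ | ∃ γ : {γ : Matrix.SpecialLinearGroup (Fin 2) ℝ // IsPrimitive p.Gam γ},
      Quot.mk (ConjRel p.Gam) γ = c ∧ r = geodLength γ.1} = {p.len (p.V c)} := by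
    ext r
    simp only [Set.mem_setOf_eq, Set.mem_singleton_iff]
    constructor
    · rintro ⟨γ, h1, rfl⟩
      rw [← p.V_cls c] at h1
      obtain ⟨g, hg, he⟩ := quot_eq h1.symm
      rw [he]
      exact p.geodLength_conj (p.V_CR c) (p.V_ne c) g
    · rintro rfl
      exact ⟨_, p.V_cls c, rfl⟩
  rw [classLength, this, csInf_singleton]

/-- The parametrisation of cyclically reduced words. -/
def Phi (x : Σ y : PrimConjClasses p.Gam × ℕ, Fin (p.V y.1).length) : CRW :=
  ⟨(FG.wpow (p.V x.1.1) (x.1.2 + 1)).rotate x.2,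
    FG.CR_rotate (FG.CR_wpow (p.V_CR _) _) _, by
      have := wpow_ne (p.V_ne x.1.1) x.1.2
      simpa using this⟩

lemma Phi_len (x : Σ y : PrimConjClasses p.Gam × ℕ, Fin (p.V y.1).length) :
    p.len (p.Phi x).1 = (x.1.2 + 1) * p.len (p.V x.1.1) := by
  show p.len ((FG.wpow (p.V x.1.1) (x.1.2 + 1)).rotate x.2) = _
  rw [p.len_rotate (FG.CR_wpow (p.V_CR _) _) (wpow_ne (p.V_ne _) _),
    p.len_wpow (p.V_CR _) (p.V_ne _)]

lemma Phi_length (x : Σ y : PrimConjClasses p.Gam × ℕ, Fin (p.V y.1).length) :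
    (p.Phi x).1.length = (x.1.2 + 1) * (p.V x.1.1).length := by
  show ((FG.wpow (p.V x.1.1) (x.1.2 + 1)).rotate x.2).length = _
  rw [List.length_rotate, FG.length_wpow]

lemma Phi_bij : Function.Bijective p.Phi := by
  constructor
  · rintro ⟨⟨c, j⟩, i⟩ ⟨⟨c', j'⟩, i'⟩ he
    have he1 : (FG.wpow (p.V c) (j + 1)).rotate i = (FG.wpow (p.V c') (j' + 1)).rotate i' :=
      congrArg Subtype.val he
    obtain ⟨g, hg⟩ := FG.conj_mk_rotate (FG.wpow (p.V c) (j + 1)) i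
    obtain ⟨g', hg'⟩ := FG.conj_mk_rotate (FG.wpow (p.V c') (j' + 1)) i'
    rw [he1, hg', FG.mk_wpow, FG.mk_wpow, ← conj_pow, ← conj_pow] at hg
    obtain ⟨h1, h2⟩ := FG.root_unique ((p.V_prim c').conj g') ((p.V_prim c).conj g) hg
    have hc : c = c' := by
      rw [← p.V_cls c, ← p.V_cls c', cls_eq_iff]
      refine ⟨g'⁻¹ * g, ?_⟩
      have : g'⁻¹ * (g' * FreeGroup.mk (p.V c') * g'⁻¹) * g' = FreeGroup.mk (p.V c') := by group
      rw [← this, h1]; group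
    subst hc
    subst h2
    have := FG.rotate_inj (p.V_CR c) (p.V_prim c) j' i.2 i'.2 he1
    have := Fin.ext this
    rw [this]
  · rintro ⟨w, hw, hne⟩
    have hmk : FreeGroup.mk w ≠ 1 := fun h => hne
      (FG.eq_of_reduced hw.1 (by simp) (by rw [h, FreeGroup.one_eq_mk]))
    obtain ⟨v, k, hv, hk⟩ := FG.exists_root hmk
    have h1 := p.V_cls (p.cls v hv)
    set c := p.cls v hv
    obtain ⟨x, hx⟩ := (p.cls_eq_iff (p.V_prim c) hv).1 h1
    obtain ⟨n, hn⟩ := FG.rotated_of_conj (g := x) (FG.CR_wpow (p.V_CR c) (k + 1)) hw (by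
      rw [FG.mk_wpow, ← conj_pow, ← hx, hk])
    obtain ⟨i, hi, hi'⟩ := FG.rotate_lt (p.V_ne c) k n
    exact ⟨⟨(c, k), ⟨i, hi⟩⟩, Subtype.ext (by
      show (FG.wpow (p.V c) (k + 1)).rotate i = w
      rw [← hi', hn])⟩

end Par

end Fred

end

noncomputable section

set_option linter.unusedSectionVars false

open Filter Topology
open scoped Matrix

namespace Fred

namespace Par

variable (p : Par)

/-- Summand attached to a cyclically reduced word. -/
def fw (s : ℂ) (w : CRW) : ℂ :=
  Complex.exp (-(s * p.len w.1)) / (1 - Complex.exp (-(p.len w.1))) / (w.1.length : ℂ)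

/-- The logarithm of the zeta function. -/
def E (s : ℂ) : ℂ := ∑' w : CRW, p.fw s w

lemma exists_delta : ∃ δ : ℝ, 0 < δ ∧ ∀ w : CRW, δ ≤ p.len w.1 := by
  obtain ⟨δ, C, hδ, hC, h⟩ := p.word_facts
  refine ⟨δ, hδ, fun w => ?_⟩
  have h1 := (h w.1 w.2.1 w.2.2).1
  have h2 : (1 : ℝ) ≤ w.1.length := by
    exact_mod_cast List.length_pos_iff.2 w.2.2
  nlinarith

lemma norm_exp_len (s : ℂ) (l : ℝ) : ‖Complex.exp (-(s * l))‖ = Real.exp (-(s.re * l)) := by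
  rw [Complex.norm_exp]; simp

lemma fw_bound : ∃ C : ℝ, ∀ (s : ℂ) (w : CRW), 1 ≤ s.re → ‖p.fw s w‖ ≤ C * Real.exp (-p.len w.1) := by
  obtain ⟨δ, hδ, h⟩ := p.exists_delta
  refine ⟨(1 - Real.exp (-δ))⁻¹, fun s w hs => ?_⟩
  have hl := h w
  have hd : 0 < 1 - Real.exp (-δ) := sub_pos.2 (Real.exp_lt_one_iff.2 (by linarith))
  have h2 : (1 : ℝ) ≤ w.1.length := by
    exact_mod_cast List.length_pos_iff.2 w.2.2
  have h3 : 1 - Real.exp (-δ) ≤ ‖1 - Complex.exp (-(p.len w.1))‖ := by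
    rw [← Complex.ofReal_neg, ← Complex.ofReal_exp, ← Complex.ofReal_one, ← Complex.ofReal_sub,
      Complex.norm_real]
    refine le_trans ?_ (le_abs_self _)
    have := Real.exp_le_exp.2 (neg_le_neg hl)
    linarith
  unfold fw
  rw [norm_div, norm_div, norm_exp_len, Complex.norm_natCast]
  have h4 : Real.exp (-(s.re * p.len w.1)) ≤ Real.exp (-p.len w.1) := by
    apply Real.exp_le_exp.2
    nlinarith
  refine (div_le_self (by positivity) h2).trans ?_
  rw [mul_comm (1 - Real.exp (-δ))⁻¹, ← div_eq_mul_inv]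
  exact div_le_div₀ (Real.exp_pos _).le h4 hd h3

lemma summable_fw {s : ℂ} (hs : 1 ≤ s.re) : Summable (p.fw s) := by
  obtain ⟨C, hC⟩ := p.fw_bound
  exact Summable.of_norm_bounded (p.summable_exp_len.mul_left C) fun w => hC s w hs

lemma differentiableOn_E : DifferentiableOn ℂ p.E {s | 1 < s.re} := by
  obtain ⟨C, hC⟩ := p.fw_bound
  refine Complex.differentiableOn_tsum_of_summable_norm (p.summable_exp_len.mul_left C) ?_
    (isOpen_lt continuous_const Complex.continuous_re) fun w s hs => hC s w (le_of_lt hs)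
  intro w
  unfold fw
  fun_prop

/-- Triple-sum term. -/
def tri (s : ℂ) (x : (PrimConjClasses p.Gam × ℕ) × ℕ) : ℂ :=
  Complex.exp (-(s + x.2) * p.len (p.V x.1.1)) ^ (x.1.2 + 1) / ((x.1.2 : ℂ) + 1)

/-- Representative as a cyclically reduced word. -/
def VW (c : PrimConjClasses p.Gam) : CRW := ⟨p.V c, p.V_CR c, p.V_ne c⟩

lemma VW_inj : Function.Injective p.VW := by
  intro c c' he
  have he1 : p.V c = p.V c' := congrArg Subtype.val he
  have h3 : FreeGroup.mk (p.V c') = 1 * FreeGroup.mk (p.V c) * 1⁻¹ := by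
    rw [he1, one_mul, inv_one, mul_one]
  have h2 := (p.cls_eq_iff (p.V_prim c) (p.V_prim c')).2 ⟨1, h3⟩
  rw [p.V_cls c, p.V_cls c'] at h2
  exact h2

lemma summable_V : Summable fun c : PrimConjClasses p.Gam => Real.exp (-p.len (p.V c)) := by
  have h := p.summable_exp_len.comp_injective p.VW_inj
  simp only [Function.comp_def] at h
  exact h

lemma norm_tri_le {δ : ℝ} (hδ : 0 < δ) (h : ∀ w : CRW, δ ≤ p.len w.1) {s : ℂ} (hs : 1 ≤ s.re)
    (x : (PrimConjClasses p.Gam × ℕ) × ℕ) : ‖p.tri s x‖ ≤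
      Real.exp (-p.len (p.V x.1.1)) * Real.exp (-δ) ^ x.1.2 * Real.exp (-δ) ^ x.2 := by
  obtain ⟨⟨c, j⟩, k⟩ := x
  have hl : δ ≤ p.len (p.V c) := h ⟨p.V c, p.V_CR c, p.V_ne c⟩
  unfold tri
  simp only
  set l := p.len (p.V c)
  have h1 : (1 : ℝ) ≤ ‖((j : ℂ) + 1)‖ := by
    have : ((j : ℂ) + 1) = ((j + 1 : ℕ) : ℂ) := by push_cast; rfl
    rw [this, Complex.norm_natCast]; push_cast
    have : (0 : ℝ) ≤ j := j.cast_nonneg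
    linarith
  rw [norm_div, norm_pow]
  refine (div_le_self (by positivity) h1).trans ?_
  rw [Complex.norm_exp, ← Real.exp_nat_mul, ← Real.exp_nat_mul, ← Real.exp_nat_mul, ← Real.exp_add,
    ← Real.exp_add]
  apply Real.exp_le_exp.2
  have hre : (-(s + k) * (l : ℂ)).re = -(s.re + k) * l := by simp
  rw [hre]
  push_cast
  have hj : (0 : ℝ) ≤ j := j.cast_nonneg
  have hk : (0 : ℝ) ≤ k := k.cast_nonneg
  have hl0 : 0 < l := by linarith
  have e1 : (1 + (j : ℝ) + k) ≤ (s.re + k) * (j + 1) := by nlinarith [mul_nonneg hj hk]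
  have e2 := mul_le_mul_of_nonneg_right e1 hl0.le
  nlinarith

lemma summable_tri {s : ℂ} (hs : 1 ≤ s.re) : Summable (p.tri s) := by
  obtain ⟨δ, hδ, h⟩ := p.exists_delta
  have hg : Summable fun n : ℕ => Real.exp (-δ) ^ n :=
    summable_geometric_of_lt_one (Real.exp_pos _).le (Real.exp_lt_one_iff.2 (by linarith))
  have h1 := p.summable_V.mul_of_nonneg hg (fun _ => (Real.exp_pos _).le) (fun _ => by positivity)
  have h2 := h1.mul_of_nonneg hg (fun _ => by positivity) (fun _ => by positivity)
  exact Summable.of_norm_bounded h2 fun x => p.norm_tri_le hδ h hs x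

lemma V_len_pos (c : PrimConjClasses p.Gam) : 0 < p.len (p.V c) := by
  obtain ⟨δ, hδ, h⟩ := p.exists_delta
  exact lt_of_lt_of_le hδ (h ⟨p.V c, p.V_CR c, p.V_ne c⟩)

lemma norm_exp_lt {s : ℂ} (hs : 0 < s.re) (k : ℕ) {l : ℝ} (hl : 0 < l) :
    ‖Complex.exp (-(s + k) * l)‖ < 1 := by
  rw [Complex.norm_exp, show (-(s + k) * (l : ℂ)).re = -(s.re + k) * l by simp]
  apply Real.exp_lt_one_iff.2
  have hk : (0 : ℝ) ≤ k := k.cast_nonneg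
  nlinarith

lemma E_eq {s : ℂ} (hs : 1 ≤ s.re) : p.E s = ∑' x, p.tri s x := by
  have h1 : p.E s = ∑' x, p.fw s (p.Phi x) :=
    ((Equiv.ofBijective _ p.Phi_bij).tsum_eq (p.fw s)).symm
  have hsum : Summable fun x => p.fw s (p.Phi x) :=
    (Equiv.ofBijective _ p.Phi_bij).summable_iff.2 (p.summable_fw hs)
  rw [h1, hsum.tsum_sigma, (p.summable_tri hs).tsum_prod]
  refine tsum_congr fun y => ?_
  obtain ⟨c, j⟩ := y
  have hl := p.V_len_pos c
  have hlen : ((p.V c).length : ℂ) ≠ 0 := by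
    exact_mod_cast (List.length_pos_iff.2 (p.V_ne c)).ne'
  rw [tsum_fintype]
  simp only [fw, Phi_len, Phi_length, tri]
  rw [Finset.sum_const, Finset.card_univ, Fintype.card_fin, nsmul_eq_mul]
  set l := p.len (p.V c)
  set x : ℂ := Complex.exp (-(((j : ℂ) + 1) * l)) with hx
  have hx1 : ‖x‖ < 1 := by
    have : x = Complex.exp (-((j + 1 : ℂ) + (0 : ℕ)) * l) := by rw [hx]; congr 1; push_cast; ring
    rw [this]
    exact norm_exp_lt (by simp; positivity) 0 hl
  have hgeo := (hasSum_geometric_of_norm_lt_one hx1).mul_left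
    (Complex.exp (-(s * (((j : ℂ) + 1) * l))) / ((j : ℂ) + 1))
  have hterm : ∀ k : ℕ, Complex.exp (-(s + k) * l) ^ (j + 1) / ((j : ℂ) + 1) =
      Complex.exp (-(s * (((j : ℂ) + 1) * l))) / ((j : ℂ) + 1) * x ^ k := fun k => by
    rw [hx, ← Complex.exp_nat_mul, ← Complex.exp_nat_mul, div_mul_eq_mul_div, ← Complex.exp_add]
    congr 2; push_cast; ring
  simp only [hterm]
  rw [hgeo.tsum_eq]
  push_cast
  have hj : ((j : ℂ) + 1) ≠ 0 := Nat.cast_add_one_ne_zero j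
  rw [← hx]
  field_simp

theorem selberg_eq {s : ℂ} (hs : 1 < s.re) :
    Multipliable (selbergTerm p.Gam s) ∧
      ∏' x, selbergTerm p.Gam s x = Complex.exp (-p.E s) := by
  let e : (PrimConjClasses p.Gam × ℕ) × ℕ ≃ (PrimConjClasses p.Gam × ℕ) × ℕ :=
    { toFun := fun x => ((x.1.1, x.2), x.1.2)
      invFun := fun x => ((x.1.1, x.2), x.1.2)
      left_inv := fun _ => rfl
      right_inv := fun _ => rfl }
  have hs1 : Summable fun x => p.tri s (e x) := e.summable_iff.2 (p.summable_tri hs.le)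
  have hin : ∀ y : PrimConjClasses p.Gam × ℕ,
      HasSum (fun j => p.tri s (e (y, j))) (-Complex.log (selbergTerm p.Gam s y)) := by
    rintro ⟨c, k⟩
    have hz : ‖Complex.exp (-(s + k) * p.len (p.V c))‖ < 1 :=
      norm_exp_lt (by linarith) k (p.V_len_pos c)
    have := Complex.hasSum_taylorSeries_neg_log' hz
    simp only [selbergTerm, classLength_eq]
    exact this
  have hout := hs1.hasSum.prod_fiberwise hin
  have hE : ∑' x, p.tri s (e x) = p.E s := by rw [e.tsum_eq (p.tri s), p.E_eq hs.le]
  rw [hE] at hout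
  have hlog : HasSum (fun y => Complex.log (selbergTerm p.Gam s y)) (-p.E s) := by
    simpa using hout.neg
  have hne : ∀ y, selbergTerm p.Gam s y ≠ 0 := by
    rintro ⟨c, k⟩ h0
    have hz : ‖Complex.exp (-(s + k) * p.len (p.V c))‖ < 1 :=
      norm_exp_lt (by linarith) k (p.V_len_pos c)
    have h0' : 1 - Complex.exp (-(s + k) * p.len (p.V c)) = 0 := by
      simpa [selbergTerm, classLength_eq] using h0
    rw [← sub_eq_zero.1 h0'] at hz
    simp at hz
  have := Complex.hasProd_of_hasSum_log hne hlog
  exact ⟨this.multipliable, this.tprod_eq⟩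

end Par

end Fred

end

noncomputable section

set_option linter.unusedSectionVars false

open Filter Topology
open scoped Matrix

namespace Fred

namespace Par

variable (p : Par)

open Classical in
lemma hasSum_E {s : ℂ} (hs : 1 ≤ s.re) :
    HasSum (fun n : ℕ => mtr (p.sys.mat s) (n + 1) / ((n : ℂ) + 1)) (p.E s) := by
  obtain ⟨q0, hq0, hm⟩ := p.word_main
  let f : List Let → ℂ := fun w =>
    Complex.exp (-(s * p.len w)) / (1 - Complex.exp (-(p.len w)))
  let F : List Let → ℂ := fun w => if CR w ∧ w ≠ [] then f w / w.length else 0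
  have h1 : HasSum F (p.E s) := by
    have h0 := (p.summable_fw hs).hasSum
    have h2 : HasSum ((fun w : List Let => f w / w.length) ∘
        ((↑) : {w : List Let | CR w ∧ w ≠ []} → List Let)) (p.E s) := h0
    rw [hasSum_subtype_iff_indicator] at h2
    convert! h2 using 1
    ext w
    simp [F, Set.indicator_apply]
  have h2 := (Equiv.sigmaFiberEquiv (fun w : List Let => w.length)).hasSum_iff.2 h1
  have h3 : HasSum (fun n => ∑ w ∈ Sys.lists Let n, F w) (p.E s) := by
    refine h2.sigma fun n => ?_
    have h4 : HasSum (Set.indicator {w : List Let | w.length = n} F) (∑ w ∈ Sys.lists Let n, F w) := by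
      have : ∑ w ∈ Sys.lists Let n, F w =
          ∑ w ∈ Sys.lists Let n, Set.indicator {w : List Let | w.length = n} F w := by
        refine Finset.sum_congr rfl fun w hw => ?_
        rw [Sys.mem_lists] at hw
        rw [Set.indicator_of_mem]; exact hw
      rw [this]
      refine hasSum_sum_of_ne_finset_zero fun w hw => ?_
      rw [Sys.mem_lists] at hw
      rw [Set.indicator_of_notMem]; exact hw
    exact hasSum_subtype_iff_indicator.2 h4
  rw [← hasSum_nat_add_iff' 1] at h3
  have h0 : ∑ i ∈ Finset.range 1, ∑ w ∈ Sys.lists Let i, F w = 0 := by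
    simp [Sys.lists, F]
  rw [h0, sub_zero] at h3
  refine h3.congr_fun ?_ |> fun h => h
  intro n
  rw [p.sys.mtr_mat s n f (fun i w hw hl ha => by
    have hne : w ≠ [] := by rintro rfl; simp at hw
    obtain ⟨lam, -, -, -, -, -, h⟩ := hm i w ha hne hl
    exact h s), Finset.sum_div]
  refine Finset.sum_congr rfl fun w hw => ?_
  rw [Sys.mem_lists] at hw
  have hne : w ≠ [] := by rintro rfl; simp at hw
  simp only [F, p.closed_iff hne, hne, hw]
  by_cases hc : FreeGroup.IsCyclicallyReduced w <;> simp [hc, hne]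

theorem FD_eq {s : ℂ} (hs : 1 < s.re) : FD (p.sys.mat s) = Complex.exp (-p.E s) := by
  obtain ⟨R, hR⟩ := p.sys.exists_l1_lt_one
  have hU : IsOpen {s : ℂ | 1 < s.re} := isOpen_lt continuous_const Complex.continuous_re
  have ha : AnalyticOnNhd ℂ (fun s => FD (p.sys.mat s)) {s : ℂ | 1 < s.re} :=
    p.sys.differentiable_FD.differentiableOn.analyticOnNhd hU
  have hb : AnalyticOnNhd ℂ (fun s => Complex.exp (-p.E s)) {s : ℂ | 1 < s.re} :=
    (p.differentiableOn_E.neg.cexp).analyticOnNhd hU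
  have hpre : IsPreconnected {s : ℂ | 1 < s.re} := (convex_halfSpace_re_gt 1).isPreconnected
  let z0 : ℂ := ((max R 1 + 1 : ℝ) : ℂ)
  have hz0 : z0.re = max R 1 + 1 := Complex.ofReal_re _
  have hR0 := le_max_left R 1
  have hR1 := le_max_right R 1
  have hz : z0 ∈ {s : ℂ | 1 < s.re} := by
    show 1 < z0.re
    rw [hz0]; linarith
  refine ha.eqOn_of_preconnected_of_eventuallyEq hb hpre hz ?_ hs
  have e1 : ∀ᶠ s in 𝓝 z0, max R 1 < s.re :=
    (isOpen_lt continuous_const Complex.continuous_re).mem_nhds (by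
      show max R 1 < z0.re
      rw [hz0]; linarith)
  have e2 : ∀ᶠ s in 𝓝 z0, |s.im| < 1 :=
    (isOpen_lt (continuous_abs.comp Complex.continuous_im) continuous_const).mem_nhds (by
      show |z0.im| < 1
      rw [show z0.im = 0 from Complex.ofReal_im _]; simp)
  filter_upwards [e1, e2] with t h1 h2
  rw [FD_eq_exp (p.sys.summ_mat t) (hR t (by linarith) h2), (p.hasSum_E (by linarith)).tsum_eq]

/-- The parameters built from `ℓ` and `a`. -/
def ofLA (ℓ a : ℝ) (hl : 0 < ℓ) (ha : a ≠ 0)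
    (h : 2 * Real.cosh (ℓ / 2) ^ 2 + (a + a⁻¹) * Real.sinh (ℓ / 2) ^ 2 = -2 * Real.cosh (ℓ / 2)) :
    Par where
  c := Real.cosh (ℓ / 2)
  s := Real.sinh (ℓ / 2)
  a := a
  hc := Real.one_lt_cosh.2 (by positivity)
  hs := Real.sinh_pos_iff.2 (by positivity)
  hcs := Real.cosh_sq_sub_sinh_sq _
  ha := by
    by_contra hn
    have hpos : 0 < a := lt_of_le_of_ne (not_lt.1 hn) ha.symm
    have h1 := Real.cosh_pos (ℓ / 2)
    have h2 : 0 ≤ (a + a⁻¹) * Real.sinh (ℓ / 2) ^ 2 := by positivity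
    have h3 : 0 < 2 * Real.cosh (ℓ / 2) ^ 2 := by positivity
    linarith
  htr := h

lemma Gam_ofLA (ℓ a : ℝ) (hl : 0 < ℓ) (ha : a ≠ 0)
    (h : 2 * Real.cosh (ℓ / 2) ^ 2 + (a + a⁻¹) * Real.sinh (ℓ / 2) ^ 2 = -2 * Real.cosh (ℓ / 2)) :
    threeFunnelGroup ℓ a = (ofLA ℓ a hl ha h).Gam := by
  have h1 : (ofLA ℓ a hl ha h).gen false = S1 ℓ := by
    apply Subtype.ext
    simp [gen, G, S1, S1mat, ofLA, sg, kap]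
  have h2 : (ofLA ℓ a hl ha h).gen true = S2 ℓ a := by
    apply Subtype.ext
    simp [gen, G, S2, S2mat, ofLA, sg, kap, ha, div_eq_inv_mul]
  rw [Gam, rho, FreeGroup.range_lift_eq_closure, threeFunnelGroup]
  congr 1
  ext x
  simp only [Set.mem_insert_iff, Set.mem_singleton_iff, Set.mem_range, Bool.exists_bool, h1, h2]
  constructor
  · rintro (h | h)
    exacts [Or.inl h.symm, Or.inr h.symm]
  · rintro (h | h)
    exacts [Or.inl h.symm, Or.inr h.symm]

theorem part_one (s : ℂ) (hs : 1 < s.re) : Multipliable (selbergTerm p.Gam s) ∧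
    FD (p.sys.mat s) = ∏' x, selbergTerm p.Gam s x := by
  obtain ⟨h1, h2⟩ := p.selberg_eq hs
  exact ⟨h1, by rw [h2, p.FD_eq hs]⟩

theorem Z_unique {Z : ℂ → ℂ} (hZ : Differentiable ℂ Z)
    (h : ∀ s : ℂ, 1 < s.re → Z s = ∏' x, selbergTerm p.Gam s x) (s : ℂ) :
    Z s = FD (p.sys.mat s) := by
  have ha : AnalyticOnNhd ℂ Z Set.univ := hZ.differentiableOn.analyticOnNhd isOpen_univ
  have hb : AnalyticOnNhd ℂ (fun s => FD (p.sys.mat s)) Set.univ :=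
    p.sys.differentiable_FD.differentiableOn.analyticOnNhd isOpen_univ
  refine ha.eqOn_of_preconnected_of_eventuallyEq hb isPreconnected_univ (Set.mem_univ (2 : ℂ)) ?_
    (Set.mem_univ s)
  have e1 : ∀ᶠ s : ℂ in 𝓝 2, 1 < s.re :=
    (isOpen_lt continuous_const Complex.continuous_re).mem_nhds (by
      show 1 < (2 : ℂ).re
      norm_num)
  filter_upwards [e1] with t ht
  rw [h t ht, (p.part_one t ht).2]

end Par

end Fred

end

noncomputable section

set_option linter.unusedSectionVars false

open Filter Topology

namespace Fred
namespace Sys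

variable {L : Type*} [Fintype L] [DecidableEq L] (S : Sys L)

/-- The finite set of the zeroth modes. -/
def G0 : Finset (L × ℕ) := Finset.univ.image fun i => (i, 0)

lemma mem_G0 (p : L × ℕ) : p ∈ (G0 : Finset (L × ℕ)) ↔ p.2 = 0 := by
  obtain ⟨i, n⟩ := p
  simp [G0, eq_comm]

/-- Uniform bounds. -/
structure Bd (Λ δ N : ℝ) : Prop where
  hδ : 0 < δ
  hδ4 : δ ≤ 1 / 4
  hN : 0 ≤ N
  hN1 : 2 * N ≤ 1
  up : ∀ i j, S.adm i j → S.A i j ≤ Λ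
  lo : ∀ i j, S.adm i j → 1 ≤ δ * S.A i j
  ba : ∀ i j, S.adm i j → |S.B i j| ≤ δ * S.A i j

variable {S} {Λ δ N : ℝ} {σ : ℂ}

lemma Bd.pow_le (h : S.Bd Λ δ N) (hσ : ‖σ‖ ≤ N) {i j : L} (hij : S.adm i j) :
    S.A i j ^ (-(2 * σ.re)) ≤ Λ ^ (2 * N) := by
  have hA := S.A_pos hij
  have h1 := (abs_le.1 ((Complex.abs_re_le_norm σ).trans hσ)).1
  have hN := h.hN
  calc S.A i j ^ (-(2 * σ.re)) ≤ S.A i j ^ (2 * N) :=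
        Real.rpow_le_rpow_of_exponent_le hA.le (by linarith)
    _ ≤ Λ ^ (2 * N) := Real.rpow_le_rpow (by linarith) (h.up i j hij) (by linarith)

lemma Bd.qinv (h : S.Bd Λ δ N) {i j : L} (hij : S.adm i j) : (S.q i j)⁻¹ ≤ 2 * δ := by
  have hq := S.one_lt_q hij
  have h1 := h.lo i j hij
  have h2 := h.ba i j hij
  have h3 := h.hδ4
  have h4 := h.hδ
  have hA := S.A_pos hij
  rw [inv_le_iff_one_le_mul₀ (by linarith)]
  unfold q
  nlinarith

lemma Bd.ratio (h : S.Bd Λ δ N) (hσ : ‖σ‖ ≤ N) {i j : L} (hij : S.adm i j) :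
    (S.A i j / S.q i j) ^ (2 * ‖σ‖) ≤ 1 + 2 * δ := by
  have hq := S.one_lt_q hij
  have h1 := h.lo i j hij
  have h2 := h.ba i j hij
  have h3 := h.hδ4
  have h4 := h.hδ
  have h5 := h.hN1
  have hA := S.A_pos hij
  have hqA : S.q i j ≤ S.A i j := by unfold q; have := abs_nonneg (S.B i j); linarith
  calc (S.A i j / S.q i j) ^ (2 * ‖σ‖) ≤ (S.A i j / S.q i j) ^ (1 : ℝ) :=
        Real.rpow_le_rpow_of_exponent_le ((one_le_div (by linarith)).2 hqA) (by linarith)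
    _ = S.A i j / S.q i j := Real.rpow_one _
    _ ≤ 1 + 2 * δ := by
      rw [div_le_iff₀ (by linarith)]
      unfold q
      nlinarith

lemma Bd.colB_le (h : S.Bd Λ δ N) (hΛ : 1 ≤ Λ) (hσ : ‖σ‖ ≤ N) (i j : L) (n : ℕ) :
    S.colB σ i j n ≤ Λ ^ (2 * N) * (3 / 2 * (2 * δ) ^ n) := by
  have h3 := h.hδ4
  have h4 := h.hδ
  unfold colB
  split_ifs with hij
  · have hq := S.one_lt_q hij
    have hA := S.A_pos hij
    rw [← inv_pow]
    gcongr
    · exact h.pow_le hσ hij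
    · exact (h.ratio hσ hij).trans (by linarith)
    · exact h.qinv hij
  · positivity

lemma Bd.l1_le (h : S.Bd Λ δ N) (hΛ : 1 ≤ Λ) (hσ : ‖σ‖ ≤ N) :
    l1 (S.mat σ) ≤ Fintype.card L * (Fintype.card L * (Λ ^ (2 * N) * 3)) := by
  have h3 := h.hδ4
  have h4 := h.hδ
  refine (S.l1_mat_le σ).trans ?_
  have key : ∀ i j, ∑' n, S.colB σ i j n ≤ Λ ^ (2 * N) * 3 := by
    intro i j
    have hs : HasSum (fun n : ℕ => Λ ^ (2 * N) * (3 / 2 * (1 / 2 : ℝ) ^ n))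
        (Λ ^ (2 * N) * (3 / 2 * 2)) := (hasSum_geometric_two.mul_left _).mul_left _
    calc ∑' n, S.colB σ i j n ≤ ∑' n : ℕ, Λ ^ (2 * N) * (3 / 2 * (1 / 2 : ℝ) ^ n) := by
          refine (S.summable_colB σ i j).tsum_le_tsum (fun n => (h.colB_le hΛ hσ i j n).trans ?_)
            hs.summable
          gcongr
          linarith
      _ = Λ ^ (2 * N) * 3 := by rw [hs.tsum_eq]; norm_num
  calc _ ≤ ∑ _i : L, ∑ _j : L, Λ ^ (2 * N) * 3 :=
        Finset.sum_le_sum fun i _ => Finset.sum_le_sum fun j _ => key i j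
    _ = _ := by simp

lemma tsum_ent_succ_le (S : Sys L) (σ : ℂ) {i j : L} (h : S.adm i j) :
    ∑' m, (if m = 0 then 0 else ‖S.ent σ i j m 0‖) ≤
      S.A i j ^ (-(2 * σ.re)) * ((S.A i j / S.q i j) ^ (2 * ‖σ‖) - 1) := by
  have hb := S.base_hasSum ‖σ‖ h 0
  have hb0 : S.base ‖σ‖ i j 0 0 = 1 := by simp [base, rbc]
  have h1 : HasSum (fun m => if m = 0 then 0 else S.base ‖σ‖ i j m 0)
      ((S.A i j / S.q i j) ^ (2 * ‖σ‖) - 1) := by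
    have := hb.update 0 0
    simp only [hb0, pow_zero, inv_one, mul_one] at this
    have e : (fun m => if m = 0 then 0 else S.base ‖σ‖ i j m 0) =
        Function.update (fun m => S.base ‖σ‖ i j m 0) 0 0 := by
      ext m; by_cases hm : m = 0 <;> simp [hm]
    rw [e, show (S.A i j / S.q i j) ^ (2 * ‖σ‖) - 1 = 0 - 1 + (S.A i j / S.q i j) ^ (2 * ‖σ‖) by ring]
    exact this
  rw [← (h1.mul_left _).tsum_eq]
  have hle : ∀ m, (if m = 0 then 0 else ‖S.ent σ i j m 0‖) ≤
      S.A i j ^ (-(2 * σ.re)) * (if m = 0 then 0 else S.base ‖σ‖ i j m 0) := by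
    intro m
    split_ifs
    · simp
    · exact S.norm_ent_le le_rfl h m 0
  refine Summable.tsum_le_tsum hle ?_ (h1.mul_left _).summable
  refine Summable.of_nonneg_of_le (fun m => ?_) hle (h1.mul_left _).summable
  split_ifs <;> simp

lemma Bd.tail_le (h : S.Bd Λ δ N) (hΛ : 1 ≤ Λ) (hσ : ‖σ‖ ≤ N) :
    tail (S.mat σ) G0 ≤ Fintype.card L * (Fintype.card L * (Λ ^ (2 * N) * (12 * δ))) := by
  have h3 := h.hδ4
  have h4 := h.hδ
  have hs : HasSum (fun n : ℕ => Λ ^ (2 * N) * (6 * δ * (1 / 2 : ℝ) ^ n))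
        (Λ ^ (2 * N) * (6 * δ * 2)) := (hasSum_geometric_two.mul_left _).mul_left _
  have hle : ∀ i m j n, ‖S.mat σ (i, m) (j, n) - cut (S.mat σ) G0 (i, m) (j, n)‖ ≤
      ‖S.ent σ i j m n‖ := fun i m j n => norm_sub_cut_le (S.mat σ) G0 (i, m) (j, n)
  have hsm : ∀ i j n, Summable fun m =>
      ‖S.mat σ (i, m) (j, n) - cut (S.mat σ) G0 (i, m) (j, n)‖ := fun i j n =>
    Summable.of_nonneg_of_le (fun _ => norm_nonneg _) (fun m => hle i m j n) (S.summable_ent σ i j n)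
  have key := (summ_of_cols (fun x y => S.mat σ x y - cut (S.mat σ) G0 x y)
    (fun _ _ n => Λ ^ (2 * N) * (6 * δ * (1 / 2 : ℝ) ^ n)) hsm ?_ (fun _ _ => hs.summable)).2
  · refine key.trans (le_of_eq ?_)
    simp only [hs.tsum_eq, Finset.sum_const, Finset.card_univ, nsmul_eq_mul]
    ring
  · intro i j n
    have hΛp : 0 ≤ Λ ^ (2 * N) := by positivity
    rcases Nat.eq_zero_or_pos n with rfl | hn
    · by_cases hij : S.adm i j
      · have : ∀ m, ‖S.mat σ (i, m) (j, 0) - cut (S.mat σ) G0 (i, m) (j, 0)‖ =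
            if m = 0 then 0 else ‖S.ent σ i j m 0‖ := by
          intro m
          by_cases hm : m = 0 <;> simp [cut, mem_G0, hm, mat]
        simp_rw [this]
        refine (S.tsum_ent_succ_le σ hij).trans ?_
        have hA := S.A_pos hij
        have h5 := h.ratio hσ hij
        calc _ ≤ S.A i j ^ (-(2 * σ.re)) * (6 * δ) := by gcongr; linarith
          _ ≤ Λ ^ (2 * N) * (6 * δ) := by gcongr; exact h.pow_le hσ hij
          _ = _ := by simp
      · have : ∀ m, ‖S.mat σ (i, m) (j, 0) - cut (S.mat σ) G0 (i, m) (j, 0)‖ = 0 := by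
          intro m; simp [cut, mat, ent, hij]
        simp_rw [this, tsum_zero]
        positivity
    · refine ((hsm i j n).tsum_le_tsum (fun m => hle i m j n) (S.summable_ent σ i j n)).trans ?_
      refine (S.tsum_ent_le σ i j n).trans ((h.colB_le hΛ hσ i j n).trans ?_)
      obtain ⟨k, rfl⟩ : ∃ k, n = k + 1 := ⟨n - 1, by omega⟩
      have : (2 * δ) ^ k ≤ (1 / 2 : ℝ) ^ k := by gcongr; linarith
      refine mul_le_mul_of_nonneg_left ?_ hΛp
      rw [pow_succ, pow_succ]
      nlinarith

theorem Bd.FD_le (h : S.Bd Λ δ N) (hΛ : 1 ≤ Λ) (hσ : ‖σ‖ ≤ N) {M : ℝ} (hM : Λ ^ (2 * N) ≤ M) :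
    ‖FD (S.mat σ) - fdet (S.mat σ) G0‖ ≤
      (Fintype.card L * (Fintype.card L * (M * (12 * δ)))) *
        Real.exp (2 * (Fintype.card L * (Fintype.card L * (M * 3))) + 1) := by
  have h4 := h.hδ
  refine (FD_sub_le (S.summ_mat σ) G0).trans ?_
  have h1 := h.tail_le hΛ hσ
  have h2 := h.l1_le hΛ hσ
  have h0 : 0 ≤ Λ ^ (2 * N) := by positivity
  have hM0 := h0.trans hM
  gcongr
  · exact h1.trans (by gcongr)
  · exact h2.trans (by gcongr)

end Sys
end Fred

end

noncomputable section

set_option linter.unusedSectionVars false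

open Filter Topology

namespace Fred

lemma det_four (x p1 q1 p2 q2 : ℂ) (h : p1 * q2 = q1 * p2) :
    (!![1 - x, 0, -p1, -q1; 0, 1 - x, -q1, -p1; -p2, -q2, 1 - x, 0; -q2, -p2, 0, 1 - x] :
      Matrix (Fin 4) (Fin 4) ℂ).det =
      ((1 - x) ^ 2 - (p1 * p2 + q1 * q2)) ^ 2 - 4 * (p1 * p2) * (q1 * q2) := by
  simp [Matrix.det_succ_row_zero, Fin.sum_univ_succ, Fin.succAbove]
  linear_combination (-(p1 * q2) + q1 * p2) * h

/-- Enumeration of the zeroth modes. -/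
def en : Fin 4 → Let := ![(false, false), (false, true), (true, false), (true, true)]

lemma en_bij : Function.Bijective en := by
  constructor
  · intro a b; revert a b; decide
  · intro b; revert b; decide

/-- Enumeration of the zeroth modes as an equivalence. -/
def enE : Fin 4 ≃ (Sys.G0 : Finset (Let × ℕ)) :=
  Equiv.ofBijective (fun k => ⟨(en k, 0), (Sys.mem_G0 _).2 rfl⟩) (by
    constructor
    · intro a b hab
      apply en_bij.1
      have := congrArg (fun z => z.1.1) hab
      exact this
    · rintro ⟨⟨i, n⟩, hb⟩
      have hn : n = 0 := (Sys.mem_G0 _).1 hb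
      subst hn
      obtain ⟨k, hk⟩ := en_bij.2 i
      exact ⟨k, by simp [hk]⟩)

lemma fdet_G0 (A : Let × ℕ → Let × ℕ → ℂ) :
    fdet A Sys.G0 = (1 - Matrix.of fun k l : Fin 4 => A (en k, 0) (en l, 0)).det := by
  unfold fdet
  rw [← Matrix.det_submatrix_equiv_self enE]
  congr 1
  ext k l
  simp only [Matrix.submatrix_apply, Matrix.sub_apply, Matrix.one_apply, Matrix.of_apply,
    enE.injective.eq_iff]
  rfl

namespace Par

variable (p : Par)

/-- The positive parameter `r = -a`. -/
def rr : ℝ := -p.a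

lemma rr_pos : 0 < p.rr := neg_pos.2 p.ha

lemma rel_r : (p.c - 1) * (1 - p.rr) ^ 2 = 2 * p.rr := by
  have := p.rel_a
  unfold rr
  linear_combination this

lemma ent00 (σ : ℂ) (i j : Let) : p.sys.ent σ i j 0 0 =
    if adm i j then ((p.c * |p.om i j| : ℝ) : ℂ) ^ (-(2 * σ)) else 0 := by
  have : p.sys.ent σ i j 0 0 = if adm i j then (p.sys.e i j : ℂ) ^ 0 *
      ((p.c * |p.om i j| : ℝ) : ℂ) ^ (-(2 * σ + (0 : ℕ))) * (bc (2 * σ + (0 : ℕ)) 0 *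
        (-(p.sys.B i j : ℂ) / p.sys.A i j) ^ 0) else 0 := rfl
  rw [this]
  simp [bc]

lemma abs_om_ff (b : Bool) (x y : Bool) : |p.om (b, x) (b, y)| = if x = y then 2 else 0 := by
  have := p.kap_ne b
  cases x <;> cases y <;> simp [om, sg, this] <;> norm_num

lemma abs_om_ft (x y : Bool) : |p.om (false, x) (true, y)| =
    if x = y then |1 - p.rr| else 1 + p.rr := by
  have := p.rr_pos
  have h : p.a = -p.rr := by unfold rr; ring
  cases x <;> cases y <;> simp [om, sg, kap, h, sub_eq_add_neg] <;> linarith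

lemma abs_om_tf (x y : Bool) : |p.om (true, x) (false, y)| =
    if x = y then |1 - p.rr| / p.rr else (1 + p.rr) / p.rr := by
  have hr := p.rr_pos
  have h : p.a = -p.rr := by unfold rr; ring
  have e1 : 1 + -p.rr⁻¹ = -((1 - p.rr) / p.rr) := by field_simp; ring
  have e2 : 1 + p.rr⁻¹ = (1 + p.rr) / p.rr := by field_simp; ring
  have e3 : |(1 - p.rr) / p.rr| = |1 - p.rr| / p.rr := by rw [abs_div, abs_of_pos hr]
  have e4 : |(1 + p.rr) / p.rr| = (1 + p.rr) / p.rr := abs_of_pos (by positivity)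
  cases x <;> cases y <;>
    simp only [om, sg, kap, h, one_div, inv_neg, mul_one, one_mul, mul_neg, neg_neg, if_true,
      Bool.false_eq_true, if_false, e1, e2, abs_neg, e3, e4, neg_mul, reduceCtorEq]

/-- The three eigen-like quantities. -/
lemma fdet_eq (σ : ℂ) : fdet (p.sys.mat σ) Sys.G0 =
    ((1 - ((2 * p.c : ℝ) : ℂ) ^ (-(2 * σ))) ^ 2 -
      (((2 * p.c ^ 2 / (p.c - 1) : ℝ) : ℂ) ^ (-(2 * σ)) +
        ((4 * p.c ^ 2 + 2 * p.c ^ 2 / (p.c - 1) : ℝ) : ℂ) ^ (-(2 * σ)))) ^ 2 -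
      4 * ((2 * p.c ^ 2 / (p.c - 1) : ℝ) : ℂ) ^ (-(2 * σ)) *
        ((4 * p.c ^ 2 + 2 * p.c ^ 2 / (p.c - 1) : ℝ) : ℂ) ^ (-(2 * σ)) := by
  have hr := p.rr_pos
  have hc := p.hc
  have hrel := p.rel_r
  have hc1 : p.c - 1 ≠ 0 := by linarith
  set x := ((2 * p.c : ℝ) : ℂ) ^ (-(2 * σ)) with hx
  set p1 := ((p.c * |1 - p.rr| : ℝ) : ℂ) ^ (-(2 * σ)) with hp1
  set q1 := ((p.c * (1 + p.rr) : ℝ) : ℂ) ^ (-(2 * σ)) with hq1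
  set p2 := ((p.c * (|1 - p.rr| / p.rr) : ℝ) : ℂ) ^ (-(2 * σ)) with hp2
  set q2 := ((p.c * ((1 + p.rr) / p.rr) : ℝ) : ℂ) ^ (-(2 * σ)) with hq2
  have mulc : ∀ u v : ℝ, 0 ≤ u → 0 ≤ v →
      (u : ℂ) ^ (-(2 * σ)) * (v : ℂ) ^ (-(2 * σ)) = ((u * v : ℝ) : ℂ) ^ (-(2 * σ)) := by
    intro u v hu hv
    rw [← Complex.mul_cpow_ofReal_nonneg hu hv]; push_cast; rfl
  have hP : p1 * p2 = ((2 * p.c ^ 2 / (p.c - 1) : ℝ) : ℂ) ^ (-(2 * σ)) := by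
    rw [hp1, hp2, mulc _ _ (by positivity) (by positivity)]
    congr 2
    field_simp
    rw [sq_abs]
    linear_combination hrel
  have hQ : q1 * q2 = ((4 * p.c ^ 2 + 2 * p.c ^ 2 / (p.c - 1) : ℝ) : ℂ) ^ (-(2 * σ)) := by
    rw [hq1, hq2, mulc _ _ (by positivity) (by positivity)]
    congr 2
    field_simp
    linear_combination hrel
  have hPQ : p1 * q2 = q1 * p2 := by
    rw [hp1, hp2, hq1, hq2, mulc _ _ (by positivity) (by positivity),
      mulc _ _ (by positivity) (by positivity)]
    congr 2
    ring
  rw [← hP, ← hQ, ← det_four x p1 q1 p2 q2 hPQ, fdet_G0]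
  congr 1
  ext k l
  have hent : ∀ i j : Let, p.sys.mat σ (i, 0) (j, 0) =
    if adm i j then ((p.c * |p.om i j| : ℝ) : ℂ) ^ (-(2 * σ)) else 0 := p.ent00 σ
  have hx' : ((p.c * 2 : ℝ) : ℂ) ^ (-(2 * σ)) = x := by rw [mul_comm]
  simp only [Matrix.sub_apply, Matrix.of_apply, hent]
  fin_cases k <;> fin_cases l <;>
    simp only [en, adm, Matrix.one_apply, Fin.mk_one, Fin.zero_eta, Fin.reduceFinMk, Matrix.cons_val,
      Matrix.cons_val_zero, Matrix.cons_val_one, abs_om_ff, abs_om_ft, abs_om_tf, if_true,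
      Bool.false_eq_true, Bool.true_eq_false, reduceCtorEq, if_false, hx', ← hp1, ← hp2, ← hq1,
      ← hq2, forall_true_left, imp_self, imp_false, not_true_eq_false, not_false_eq_true,
      Fin.reduceEq, zero_sub, sub_zero, Matrix.of_apply, forall_const, false_imp_iff] <;>
    simp

end Par
end Fred

end

noncomputable section

set_option linter.unusedSectionVars false

open Filter Topology

namespace Fred
namespace Par

variable (p : Par)

lemma rr_le (hc : 2 ≤ p.c) : p.rr ≤ 4 ∧ 1 ≤ 4 * p.rr := by
  have h := p.rel_r
  have hr := p.rr_pos
  have h1 : (1 - p.rr) ^ 2 ≤ 2 * p.rr := by nlinarith [sq_nonneg (1 - p.rr)]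
  constructor <;> nlinarith

lemma abs_B (i j : Let) : |p.sys.B i j| = |p.kap j.1 / p.kap i.1| := by
  show |-(p.tau i j * sg j.2 * p.kap j.1 / |p.kap i.1|)| = _
  rw [abs_neg, abs_div, abs_mul, abs_mul, abs_tau, abs_sg, abs_abs, one_mul, one_mul, ← abs_div]

lemma bounds (hc : 2 ≤ p.c) {i j : Let} (h : adm i j) :
    p.c ≤ 2 * p.sys.A i j ^ 2 ∧ p.c * |p.sys.B i j| ^ 2 ≤ 2 * p.sys.A i j ^ 2 ∧
      p.sys.A i j ≤ 5 * p.c := by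
  have hA : p.sys.A i j = p.c * |p.om i j| := rfl
  have hr := p.rr_pos
  obtain ⟨h4, h5⟩ := p.rr_le hc
  have hrel := p.rel_r
  have k1 : 2 * p.rr ≤ p.c * (1 - p.rr) ^ 2 := by nlinarith [sq_nonneg (1 - p.rr)]
  have k2 : 2 * p.rr ≤ p.c * (1 + p.rr) ^ 2 := by nlinarith
  have hab : |1 - p.rr| ≤ 5 := by rw [abs_le]; constructor <;> linarith
  have hab' : |1 - p.rr| ≤ 5 * p.rr := by rw [abs_le]; constructor <;> linarith
  have ha : |p.a| = p.rr := by rw [abs_of_neg p.ha]; rfl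
  have hc0 : 0 < p.c := by linarith
  -- reduction to a statement on `|om|`
  have red : ∀ w t : ℝ, w ≤ 5 → 1 ≤ 2 * (p.c * w ^ 2) → t ^ 2 ≤ 2 * (p.c * w ^ 2) →
      p.c ≤ 2 * (p.c * w) ^ 2 ∧ p.c * t ^ 2 ≤ 2 * (p.c * w) ^ 2 ∧ p.c * w ≤ 5 * p.c := by
    intro w t h1 h2 h3
    refine ⟨?_, ?_, by nlinarith⟩
    · nlinarith
    · nlinarith
  rw [hA, abs_B]
  apply red
  all_goals
    obtain ⟨i1, i2⟩ := i
    obtain ⟨j1, j2⟩ := j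
    cases i1 <;> cases j1
  all_goals simp only [abs_om_ff, abs_om_ft, abs_om_tf, kap, if_true, Bool.false_eq_true, if_false]
  all_goals simp only [adm, forall_true_left, reduceCtorEq, false_imp_iff] at h
  all_goals try simp only [h, if_true]
  all_goals try simp only [abs_div, ha, abs_one, div_self p.ha.ne, div_self hr.ne', div_one]
  all_goals try split_ifs
  all_goals try simp only [div_pow, sq_abs, one_pow, div_self hr.ne']
  all_goals try (norm_num; done)
  all_goals try nlinarith
  all_goals try (rw [div_le_iff₀ hr]; linarith)
  all_goals
    rw [← mul_div_assoc, ← mul_div_assoc]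
    first
      | (rw [le_div_iff₀ (by positivity)]; nlinarith)
      | (gcongr; nlinarith)

/-- Uniform bounds for the transfer system. -/
lemma bd {ℓ R : ℝ} (hl : 12 ≤ ℓ) (hR : 0 ≤ R) (hlR : 2 * R ≤ ℓ) (hp : p.c = Real.cosh (ℓ / 2)) :
    p.sys.Bd (Real.exp ℓ) (2 * Real.exp (-ℓ / 4)) (R / ℓ) := by
  set E := Real.exp (ℓ / 2) with hE
  have hEc : E ≤ 2 * p.c := by
    rw [hp, Real.cosh_eq]; have := Real.exp_pos (-(ℓ / 2)); linarith
  have hcE : p.c ≤ E := by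
    rw [hp, Real.cosh_eq]
    have : Real.exp (-(ℓ / 2)) ≤ Real.exp (ℓ / 2) := Real.exp_le_exp.2 (by linarith)
    linarith
  have hE7 : 7 ≤ E := by have := Real.add_one_le_exp (ℓ / 2); linarith
  have hc : 2 ≤ p.c := by linarith
  have hq : 2 * Real.exp (-ℓ / 4) ≤ 1 / 4 := by
    have h1 : 8 ≤ Real.exp (ℓ / 4) := by
      have h2 : Real.exp 3 ≤ Real.exp (ℓ / 4) := Real.exp_le_exp.2 (by linarith)
      have h3 : Real.exp 3 = Real.exp 1 ^ 3 := by rw [← Real.exp_nat_mul]; norm_num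
      have h4 : (2 : ℝ) ≤ Real.exp 1 := by have := Real.add_one_le_exp (1 : ℝ); linarith
      have h5 : (2 : ℝ) ^ 3 ≤ Real.exp 1 ^ 3 := by gcongr
      linarith
    have : Real.exp (-ℓ / 4) = (Real.exp (ℓ / 4))⁻¹ := by rw [← Real.exp_neg]; congr 1; ring
    rw [this]
    have := inv_anti₀ (by norm_num) h1
    linarith
  have hd2 : (2 * Real.exp (-ℓ / 4)) ^ 2 * E = 4 := by
    rw [mul_pow, hE, ← Real.exp_nat_mul, mul_assoc, ← Real.exp_add]
    have : ((2 : ℕ) : ℝ) * (-ℓ / 4) + ℓ / 2 = 0 := by push_cast; ring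
    rw [this]; norm_num
  have hd : 0 < 2 * Real.exp (-ℓ / 4) := by positivity
  generalize 2 * Real.exp (-ℓ / 4) = δ at *
  have hdc : 2 ≤ δ ^ 2 * p.c := by nlinarith [sq_nonneg δ]
  have hEl : Real.exp ℓ = E * E := by rw [hE, ← Real.exp_add]; congr 1; ring
  refine ⟨hd, hq, by positivity, ?_, ?_, ?_, ?_⟩
  · rw [← mul_div_assoc, div_le_one (by linarith)]; exact hlR
  · intro i j h
    have := (p.bounds hc h).2.2
    rw [hEl]; nlinarith
  · intro i j h
    have h1 := (p.bounds hc h).1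
    have hA := p.sys.A_pos h
    refine le_of_sq_le_sq ?_ (by positivity)
    have : p.c * 1 ≤ p.c * (δ * p.sys.A i j) ^ 2 := by
      rw [mul_pow]; nlinarith [sq_nonneg (p.sys.A i j)]
    have := le_of_mul_le_mul_left this (by linarith)
    linarith
  · intro i j h
    have h1 := (p.bounds hc h).2.1
    have hA := p.sys.A_pos h
    refine le_of_sq_le_sq ?_ (by positivity)
    have : p.c * |p.sys.B i j| ^ 2 ≤ p.c * (δ * p.sys.A i j) ^ 2 := by
      rw [mul_pow]; nlinarith [sq_nonneg (p.sys.A i j)]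
    exact le_of_mul_le_mul_left this (by linarith)

end Par

lemma cpow_close {ℓ R θ u : ℝ} (k : ℝ) (hl : 12 ≤ ℓ) (hlR : 2 * R ≤ ℓ) (s : ℂ) (hs : ‖s‖ ≤ R)
    (hk0 : 0 ≤ k) (hk : k ≤ 2)
    (hu1 : Real.exp (k * (ℓ / 2)) ≤ u) (hu2 : u ≤ Real.exp (k * (ℓ / 2)) * (1 + θ)) (hθ : θ ≤ 1) :
    ‖(u : ℂ) ^ (-(2 * (s / (ℓ : ℂ)))) - Complex.exp (-k * s)‖ ≤ 2 * Real.exp (2 * R) * θ := by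
  have hu : 0 < u := (Real.exp_pos _).trans_le hu1
  have hl0 : (ℓ : ℂ) ≠ 0 := by exact_mod_cast (by linarith : ℓ ≠ 0)
  set η := Real.log u - k * (ℓ / 2) with hη
  have h0 : 0 ≤ η := by
    have := Real.log_le_log (Real.exp_pos _) hu1
    rw [Real.log_exp] at this; linarith
  have hθ0 : 0 ≤ θ := by
    have h3 := hu1.trans hu2
    have := Real.exp_pos (k * (ℓ / 2))
    nlinarith
  have h1 : η ≤ θ := by
    have := Real.log_le_log hu hu2
    rw [Real.log_mul (Real.exp_pos _).ne' (by linarith), Real.log_exp] at this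
    have h2 := Real.log_le_sub_one_of_pos (by linarith : 0 < 1 + θ)
    linarith
  have e1 : (u : ℂ) ^ (-(2 * (s / (ℓ : ℂ)))) =
      Complex.exp (-k * s) * Complex.exp (-(2 * (s / ℓ)) * η) := by
    rw [Complex.cpow_def_of_ne_zero (by exact_mod_cast hu.ne'), ← Complex.exp_add,
      ← Complex.ofReal_log hu.le]
    congr 1
    have : Real.log u = k * (ℓ / 2) + η := by rw [hη]; ring
    rw [this]; push_cast; field_simp; ring
  have hn : ‖-(2 * (s / ℓ)) * (η : ℂ)‖ ≤ θ := by
    rw [norm_mul, norm_neg, norm_mul, norm_div, Complex.norm_real, Complex.norm_real,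
      Complex.norm_ofNat, Real.norm_of_nonneg h0, Real.norm_of_nonneg (by linarith : 0 ≤ ℓ)]
    have : 2 * (‖s‖ / ℓ) ≤ 1 := by
      rw [← mul_div_assoc, div_le_one (by linarith)]; linarith
    nlinarith [norm_nonneg s]
  have h3 : ‖Complex.exp (-(2 * (s / ℓ)) * η) - 1‖ ≤ 2 * θ :=
    (Complex.norm_exp_sub_one_le (hn.trans hθ)).trans (by linarith)
  have h4 : ‖Complex.exp (-k * s)‖ ≤ Real.exp (2 * R) := by
    refine (Complex.norm_exp_le_exp_norm _).trans (Real.exp_le_exp.2 ?_)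
    rw [norm_mul, norm_neg, Complex.norm_real, Real.norm_of_nonneg hk0]
    have := norm_nonneg s
    nlinarith
  rw [e1, ← mul_sub_one, norm_mul]
  calc _ ≤ Real.exp (2 * R) * (2 * θ) := by gcongr
    _ = _ := by ring

/-- The limiting polynomial in three variables. -/
def FF (x P Q : ℂ) : ℂ := ((1 - x) ^ 2 - (P + Q)) ^ 2 - 4 * P * Q

lemma FF_close {x P Q x' P' Q' : ℂ} {W ζ : ℝ} (hW : 1 ≤ W) (hx : ‖x‖ ≤ W) (hP : ‖P‖ ≤ W)
    (hQ : ‖Q‖ ≤ W) (hx' : ‖x'‖ ≤ W) (hP' : ‖P'‖ ≤ W) (hQ' : ‖Q'‖ ≤ W)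
    (h1 : ‖x - x'‖ ≤ ζ) (h2 : ‖P - P'‖ ≤ ζ) (h3 : ‖Q - Q'‖ ≤ ζ) :
    ‖FF x P Q - FF x' P' Q'‖ ≤ 80 * W ^ 3 * ζ := by
  have hζ : 0 ≤ ζ := (norm_nonneg _).trans h1
  have hU : ∀ x P Q : ℂ, ‖x‖ ≤ W → ‖P‖ ≤ W → ‖Q‖ ≤ W → ‖(1 - x) ^ 2 - (P + Q)‖ ≤ 6 * W ^ 2 := by
    intro x P Q hx hP hQ
    calc _ ≤ ‖(1 - x) ^ 2‖ + ‖P + Q‖ := norm_sub_le _ _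
      _ ≤ (1 + W) ^ 2 + (W + W) := by
        rw [norm_pow]
        gcongr
        · exact (norm_sub_le _ _).trans (by rw [norm_one]; linarith)
        · exact (norm_add_le _ _).trans (by linarith)
      _ ≤ 6 * W ^ 2 := by nlinarith
  have hd : ‖((1 - x) ^ 2 - (P + Q)) - ((1 - x') ^ 2 - (P' + Q'))‖ ≤ 6 * W * ζ := by
    have : ((1 - x) ^ 2 - (P + Q)) - ((1 - x') ^ 2 - (P' + Q')) =
      (x - x') * (x + x' - 2) - ((P - P') + (Q - Q')) := by ring
    rw [this]
    calc _ ≤ ‖(x - x') * (x + x' - 2)‖ + ‖(P - P') + (Q - Q')‖ := norm_sub_le _ _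
      _ ≤ ζ * (W + W + 2) + (ζ + ζ) := by
        rw [norm_mul]
        gcongr
        · refine (norm_sub_le _ _).trans ?_
          rw [Complex.norm_ofNat]
          linarith [norm_add_le x x']
        · exact (norm_add_le _ _).trans (by linarith)
      _ ≤ 6 * W * ζ := by nlinarith
  have hpq : ‖P * Q - P' * Q'‖ ≤ 2 * W * ζ := by
    have : P * Q - P' * Q' = (P - P') * Q + P' * (Q - Q') := by ring
    rw [this]
    calc _ ≤ ‖(P - P') * Q‖ + ‖P' * (Q - Q')‖ := norm_add_le _ _
      _ ≤ ζ * W + W * ζ := by rw [norm_mul, norm_mul]; gcongr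
      _ = _ := by ring
  have e : FF x P Q - FF x' P' Q' = (((1 - x) ^ 2 - (P + Q)) - ((1 - x') ^ 2 - (P' + Q'))) *
      (((1 - x) ^ 2 - (P + Q)) + ((1 - x') ^ 2 - (P' + Q'))) - 4 * (P * Q - P' * Q') := by
    unfold FF; ring
  rw [e]
  calc _ ≤ _ := norm_sub_le _ _
    _ ≤ (6 * W * ζ) * (6 * W ^ 2 + 6 * W ^ 2) + 4 * (2 * W * ζ) := by
      rw [norm_mul, norm_mul, Complex.norm_ofNat]
      gcongr
      exact (norm_add_le _ _).trans (add_le_add (hU _ _ _ hx hP hQ) (hU _ _ _ hx' hP' hQ'))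
    _ ≤ 80 * W ^ 3 * ζ := by
      have : W ≤ W ^ 3 := by nlinarith [sq_nonneg W]
      have := mul_le_mul_of_nonneg_right this hζ
      nlinarith

end Fred

end

noncomputable section

set_option linter.unusedSectionVars false

open Filter Topology

namespace Fred
namespace Par

variable (p : Par)

lemma fdet_close {ℓ R : ℝ} (hl : 12 ≤ ℓ) (hR : 0 ≤ R) (hlR : 2 * R ≤ ℓ)
    (hp : p.c = Real.cosh (ℓ / 2)) (s : ℂ) (hs : ‖s‖ ≤ R) :
    ‖fdet (p.sys.mat (s / (ℓ : ℂ))) Sys.G0 - (1 - 6 * Complex.exp (-s) + 9 * Complex.exp (-2 * s)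
      - 4 * Complex.exp (-3 * s))‖ ≤
      80 * (3 * Real.exp (2 * R)) ^ 3 * (2 * Real.exp (2 * R) * (9 * Real.exp (-ℓ / 2))) := by
  set E := Real.exp (ℓ / 2) with hE
  have hinv : Real.exp (-ℓ / 2) = E⁻¹ := by rw [hE, ← Real.exp_neg]; congr 1; ring
  have hcE : 2 * p.c = E + E⁻¹ := by
    rw [hp, Real.cosh_eq, ← hinv, hE, show -(ℓ / 2) = -ℓ / 2 by ring]; ring
  have hE9 : 9 ≤ E := by
    have h2 : Real.exp 6 ≤ Real.exp (ℓ / 2) := Real.exp_le_exp.2 (by linarith)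
    have h3 : Real.exp 6 = Real.exp 1 ^ 6 := by rw [← Real.exp_nat_mul]; norm_num
    have h4 : (2 : ℝ) ≤ Real.exp 1 := by have := Real.add_one_le_exp (1 : ℝ); linarith
    have h5 : (2 : ℝ) ^ 6 ≤ Real.exp 1 ^ 6 := by gcongr
    linarith
  have hE0 : 0 < E := by linarith
  have hI0 : 0 < E⁻¹ := by positivity
  have hI1 : E⁻¹ ≤ 1 := inv_le_one_of_one_le₀ (by linarith)
  have hEI : E * E⁻¹ = 1 := mul_inv_cancel₀ hE0.ne'
  have hθ : 9 * E⁻¹ ≤ 1 := by nlinarith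
  have hc : 4 ≤ p.c := by linarith
  have hc1 : 0 < p.c - 1 := by linarith
  have hd : 2 * p.c ^ 2 / (p.c - 1) = 2 * p.c + 2 + 2 / (p.c - 1) := by
    field_simp; ring
  have hd0 : 0 < 2 / (p.c - 1) := by positivity
  have hd1 : 2 / (p.c - 1) ≤ 1 := by rw [div_le_one hc1]; linarith
  have h4c : 4 * p.c ^ 2 = E ^ 2 + 2 + E⁻¹ ^ 2 := by
    have : 4 * p.c ^ 2 = (2 * p.c) ^ 2 := by ring
    rw [this, hcE]; linear_combination 2 * hEI
  have k1 : Real.exp (1 * (ℓ / 2)) = E := by rw [one_mul]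
  have k2 : Real.exp (2 * (ℓ / 2)) = E ^ 2 := by
    rw [hE, ← Real.exp_nat_mul]; norm_num
  have c1 := cpow_close (θ := 9 * E⁻¹) (u := 2 * p.c) 1 hl hlR s hs (by norm_num) (by norm_num)
    (by rw [k1]; linarith) (by rw [k1]; nlinarith) hθ
  have c2 := cpow_close (θ := 9 * E⁻¹) (u := 2 * p.c ^ 2 / (p.c - 1)) 1 hl hlR s hs (by norm_num)
    (by norm_num) (by rw [k1]; linarith) (by rw [k1]; nlinarith) hθ
  have c3 := cpow_close (θ := 9 * E⁻¹) (u := 4 * p.c ^ 2 + 2 * p.c ^ 2 / (p.c - 1)) 2 hl hlR s hs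
    (by norm_num) (by norm_num) (by rw [k2]; nlinarith) (by
      rw [k2]
      have : E ^ 2 * (1 + 9 * E⁻¹) = E ^ 2 + 9 * E := by linear_combination 9 * E * hEI
      rw [this]; nlinarith) hθ
  have e1 : Complex.exp (-((1 : ℝ) : ℂ) * s) = Complex.exp (-s) := by simp
  have e2 : Complex.exp (-((2 : ℝ) : ℂ) * s) = Complex.exp (-2 * s) := by simp
  rw [e1] at c1 c2
  rw [e2] at c3
  have n1 : ‖Complex.exp (-s)‖ ≤ Real.exp (2 * R) := by
    refine (Complex.norm_exp_le_exp_norm _).trans (Real.exp_le_exp.2 ?_)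
    rw [norm_neg]; linarith
  have n2 : ‖Complex.exp (-2 * s)‖ ≤ Real.exp (2 * R) := by
    refine (Complex.norm_exp_le_exp_norm _).trans (Real.exp_le_exp.2 ?_)
    rw [norm_mul, norm_neg, Complex.norm_ofNat]; linarith
  have hex : 1 ≤ Real.exp (2 * R) := Real.one_le_exp (by linarith)
  have hz : 2 * Real.exp (2 * R) * (9 * E⁻¹) ≤ 2 * Real.exp (2 * R) := by nlinarith
  have tri : ∀ u v : ℂ, ‖u - v‖ ≤ 2 * Real.exp (2 * R) * (9 * E⁻¹) → ‖v‖ ≤ Real.exp (2 * R) →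
      ‖u‖ ≤ 3 * Real.exp (2 * R) := by
    intro u v h1 h2
    have := norm_add_le (u - v) v
    rw [sub_add_cancel] at this
    linarith
  have key := FF_close (W := 3 * Real.exp (2 * R)) (by linarith) (tri _ _ c1 n1) (tri _ _ c2 n1)
    (tri _ _ c3 n2) (n1.trans (by linarith)) (n1.trans (by linarith)) (n2.trans (by linarith))
    c1 c2 c3
  rw [hinv]
  convert key using 2
  rw [fdet_eq]
  have x2 : Complex.exp (-2 * s) = Complex.exp (-s) ^ 2 := by
    rw [← Complex.exp_nat_mul]; congr 1; push_cast; ring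
  have x3 : Complex.exp (-3 * s) = Complex.exp (-s) ^ 3 := by
    rw [← Complex.exp_nat_mul]; congr 1; push_cast; ring
  rw [x2, x3]
  unfold FF
  ring

/-- The asymptotic estimate. -/
theorem asymp (R : ℝ) (hR : 0 ≤ R) : ∃ C : ℝ, 0 < C ∧ ∀ (p : Par) (ℓ : ℝ), 12 ≤ ℓ → 2 * R ≤ ℓ →
    p.c = Real.cosh (ℓ / 2) → ∀ s : ℂ, ‖s‖ ≤ R →
    ‖FD (p.sys.mat (s / (ℓ : ℂ))) - (1 - 6 * Complex.exp (-s) + 9 * Complex.exp (-2 * s)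
      - 4 * Complex.exp (-3 * s))‖ ≤ C * Real.exp (-ℓ / 4) := by
  refine ⟨(4 * (4 * (Real.exp (2 * R) * (12 * 2)))) *
        Real.exp (2 * (4 * (4 * (Real.exp (2 * R) * 3))) + 1) +
      80 * (3 * Real.exp (2 * R)) ^ 3 * (2 * Real.exp (2 * R) * 9), by positivity, ?_⟩
  intro p ℓ hl hlR hp s hs
  have hbd := p.bd hl hR hlR hp
  have hl0 : 0 < ℓ := by linarith
  have hσ : ‖s / (ℓ : ℂ)‖ ≤ R / ℓ := by
    rw [norm_div, Complex.norm_real, Real.norm_of_nonneg hl0.le]; gcongr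
  have h1 := hbd.FD_le (Real.one_le_exp hl0.le) hσ (M := Real.exp (2 * R)) (by
    rw [← Real.exp_mul]
    refine Real.exp_le_exp.2 (le_of_eq ?_)
    field_simp)
  have h2 := p.fdet_close hl hR hlR hp s hs
  have hcard : (Fintype.card Let : ℝ) = 4 := by simp [Let]
  rw [hcard] at h1
  have h3 : Real.exp (-ℓ / 2) ≤ Real.exp (-ℓ / 4) := Real.exp_le_exp.2 (by linarith)
  have h4 := (norm_sub_le_norm_sub_add_norm_sub _ (fdet (p.sys.mat (s / (ℓ : ℂ))) Sys.G0) _).trans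
    (add_le_add h1 h2)
  refine h4.trans ?_
  rw [add_mul]
  refine add_le_add (le_of_eq (by ring)) ?_
  calc _ ≤ 80 * (3 * Real.exp (2 * R)) ^ 3 * (2 * Real.exp (2 * R) * (9 * Real.exp (-ℓ / 4))) := by
        gcongr
    _ = _ := by ring

end Par
end Fred
end

/-- **Theorem 1.1** (second part): the Selberg zeta function
`Z(Γ(ℓ),s) = ∏_{[γ]∈𝒫} ∏_{k≥0} (1 - e^{-(s+k)ℓ(γ)})` of the symmetric three-funnel surface
converges for `Re s > 1` and extends to an entire function `Z_ℓ`, and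
`|Z_ℓ(s/ℓ) - (1 - 6e^{-s} + 9e^{-2s} - 4e^{-3s})| = O_{K,ε}(e^{-(1-ε)ℓ/4})` on compacts. -/
theorem selberg_zeta_three_funnel :
    (∀ ℓ : ℝ, 0 < ℓ → ∀ a : ℝ, a ≠ 0 →
      2 * Real.cosh (ℓ / 2) ^ 2 + (a + a⁻¹) * Real.sinh (ℓ / 2) ^ 2
          = -2 * Real.cosh (ℓ / 2) →
      (∀ s : ℂ, 1 < s.re → Multipliable (selbergTerm (threeFunnelGroup ℓ a) s)) ∧
      ∃ Z : ℂ → ℂ, Differentiable ℂ Z ∧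
        ∀ s : ℂ, 1 < s.re → Z s = ∏' p, selbergTerm (threeFunnelGroup ℓ a) s p) ∧
    (∀ ε ∈ Set.Ioo (0 : ℝ) 1, ∀ K : Set ℂ, IsCompact K →
      ∃ C : ℝ, 0 < C ∧ ∃ ℓ₀ : ℝ, 1 ≤ ℓ₀ ∧
        ∀ ℓ : ℝ, ℓ₀ ≤ ℓ → ∀ a : ℝ, a ≠ 0 →
          2 * Real.cosh (ℓ / 2) ^ 2 + (a + a⁻¹) * Real.sinh (ℓ / 2) ^ 2
              = -2 * Real.cosh (ℓ / 2) →
          ∀ Z : ℂ → ℂ, Differentiable ℂ Z →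
            (∀ s : ℂ, 1 < s.re → Z s = ∏' p, selbergTerm (threeFunnelGroup ℓ a) s p) →
            ∀ s ∈ K,
              ‖Z (s / (ℓ : ℂ)) - (1 - 6 * Complex.exp (-s) + 9 * Complex.exp (-2 * s)
                  - 4 * Complex.exp (-3 * s))‖
                ≤ C * Real.exp (-(1 - ε) * ℓ / 4)) := by
  refine ⟨?_, ?_⟩
  · intro ℓ hl a ha h
    rw [Fred.Par.Gam_ofLA ℓ a hl ha h]
    set p := Fred.Par.ofLA ℓ a hl ha h
    exact ⟨fun s hs => (p.part_one s hs).1, fun s => Fred.FD (p.sys.mat s),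
      p.sys.differentiable_FD, fun s hs => (p.part_one s hs).2⟩
  · intro ε hε K hK
    obtain ⟨R, hR⟩ := hK.isBounded.exists_norm_le
    obtain ⟨C, hC, H⟩ := Fred.Par.asymp (max R 0) (le_max_right _ _)
    refine ⟨C, hC, max 12 (2 * max R 0), le_trans (by norm_num) (le_max_left _ _), ?_⟩
    intro ℓ hl a ha h Z hZ hZ2 s hs
    have hl1 : 12 ≤ ℓ := (le_max_left _ _).trans hl
    have hl2 : 2 * max R 0 ≤ ℓ := (le_max_right _ _).trans hl
    have hl0 : 0 < ℓ := by linarith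
    rw [Fred.Par.Gam_ofLA ℓ a hl0 ha h] at hZ2
    rw [(Fred.Par.ofLA ℓ a hl0 ha h).Z_unique hZ hZ2]
    refine (H (Fred.Par.ofLA ℓ a hl0 ha h) ℓ hl1 hl2 rfl s ((hR s hs).trans (le_max_left _ _))).trans ?_
    have h1 := hε.1
    gcongr
    nlinarith

end
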